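/- Let d > 4. There exist β0 > 0 and C > 0 such that for all β ∈ (0, β0] the limit A = lim_{n→∞} c_n μ^{−n} exists and is positive, and for all real z ∈ [0, z_c), writing ε = 1 − z/z_c: |χ(z) − A/ε| ≤ C β ε^{−(6−d)_+/2} if d ≠ 6 and |χ(z) − A/ε| ≤ C β (1 + |log ε|) if d = 6; and |z χ'(z) − A (z/z_c)/ε²| ≤ C β ε^{−(8−d)_+/2} if d ≠ 8 and |z χ'(z) − A (z/z_c)/ε²| ≤ C β (1 + |log ε|) if d = 8. Here (x)_+ = max{x,0}. -/

import Mathlib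

open scoped BigOperators

/-- A unit step in `ℤ^d`: a coordinate direction together with a sign. -/
def wsawStep (d : ℕ) (e : Fin d × Bool) : Fin d → ℤ :=
  fun i => if i = e.1 then (if e.2 then 1 else -1) else 0

/-- The position after `k` steps of the walk on `ℤ^d` with step sequence `s`.
(An `n`-step nearest-neighbour walk on `ℤ^d` started at `0` is the same thing as a
sequence of `n` unit steps.) -/
def wsawPos {d n : ℕ} (s : Fin n → Fin d × Bool) (k : ℕ) : Fin d → ℤ :=
  ∑ j ∈ Finset.univ.filter (fun j : Fin n => (j : ℕ) < k), wsawStep d (s j)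

/-- The weakly self-avoiding walk weight `∏_{0 ≤ s < t ≤ n} (1 + β U_{st}(ω))`
of the `ℤ^d` walk with step sequence `s`. -/
noncomputable def wsawWeight {d : ℕ} (β : ℝ) (n : ℕ) (s : Fin n → Fin d × Bool) : ℝ :=
  ∏ p ∈ (Finset.range (n + 1) ×ˢ Finset.range (n + 1)).filter (fun p => p.1 < p.2),
    (1 + β * (if wsawPos s p.1 = wsawPos s p.2 then (-1 : ℝ) else 0))

/-- The two-point partition function `c_n(x)` on `ℤ^d`. -/
noncomputable def cZx (d : ℕ) (β : ℝ) (n : ℕ) (x : Fin d → ℤ) : ℝ :=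
  ∑ s ∈ Finset.univ.filter (fun s : Fin n → Fin d × Bool => wsawPos s n = x),
    wsawWeight β n s

/-- The partition function `c_n = Σ_x c_n(x)` on `ℤ^d`. -/
noncomputable def cZ (d : ℕ) (β : ℝ) (n : ℕ) : ℝ :=
  ∑ s : Fin n → Fin d × Bool, wsawWeight β n s

/-- The position after `k` steps of the torus walk with step sequence `s`:
the mod-`r` projection of the `ℤ^d` position (for `r ≥ 3`, `n`-step torus walks
started at `0` correspond bijectively to step sequences). -/
def wsawPosT {d : ℕ} (r : ℕ) {n : ℕ} (s : Fin n → Fin d × Bool) (k : ℕ) : Fin d → ZMod r :=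
  fun i => ((wsawPos s k i : ℤ) : ZMod r)

/-- The weakly self-avoiding walk weight of the torus walk with step sequence `s`. -/
noncomputable def wsawWeightT {d : ℕ} (r : ℕ) (β : ℝ) (n : ℕ) (s : Fin n → Fin d × Bool) : ℝ :=
  ∏ p ∈ (Finset.range (n + 1) ×ˢ Finset.range (n + 1)).filter (fun p => p.1 < p.2),
    (1 + β * (if wsawPosT r s p.1 = wsawPosT r s p.2 then (-1 : ℝ) else 0))

/-- The torus partition function `c_n^𝕋`. -/
noncomputable def cT (d r : ℕ) (β : ℝ) (n : ℕ) : ℝ :=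
  ∑ s : Fin n → Fin d × Bool, wsawWeightT r β n s

/-- `μ` is the growth constant: `μ = lim_{n→∞} c_n^{1/n}`. -/
def HasGrowthConst (d : ℕ) (β μ : ℝ) : Prop :=
  Filter.Tendsto (fun n : ℕ => (cZ d β n) ^ ((n : ℝ)⁻¹)) Filter.atTop (nhds μ)

/-- The susceptibility `χ(z)` on `ℤ^d`, for complex `z`. -/
noncomputable def chi (d : ℕ) (β : ℝ) (z : ℂ) : ℂ := ∑' n : ℕ, (cZ d β n : ℂ) * z ^ n

/-- The susceptibility `χ(z)` on `ℤ^d`, for real `z`. -/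
noncomputable def chiR (d : ℕ) (β : ℝ) (z : ℝ) : ℝ := ∑' n : ℕ, cZ d β n * z ^ n

/-- The torus susceptibility `χ^𝕋(z)`, for complex `z`. -/
noncomputable def chiT (d r : ℕ) (β : ℝ) (z : ℂ) : ℂ := ∑' n : ℕ, (cT d r β n : ℂ) * z ^ n

/-- The torus susceptibility `χ^𝕋(z)`, for real `z`. -/
noncomputable def chiTR (d r : ℕ) (β : ℝ) (z : ℝ) : ℝ := ∑' n : ℕ, cT d r β n * z ^ n

/-- The sup norm `‖x‖_∞` of `x ∈ ℤ^d`, as a real number. -/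
noncomputable def nInf {d : ℕ} (x : Fin d → ℤ) : ℝ :=
  ((Finset.univ.sup fun i => (x i).natAbs : ℕ) : ℝ)

/-- `⟨x⟩ = max {1, ‖x‖_∞}`. -/
noncomputable def vee {d : ℕ} (x : Fin d → ℤ) : ℝ := max 1 (nInf x)

/-- The two-point function `G_z(x) = Σ_n c_n(x) z^n` on `ℤ^d`. -/
noncomputable def Gpt (d : ℕ) (β z : ℝ) (x : Fin d → ℤ) : ℝ := ∑' n : ℕ, cZx d β n x * z ^ n

/-- The bubble diagram `B_z = G_z * G_z`. -/
noncomputable def Bpt (d : ℕ) (β z : ℝ) (x : Fin d → ℤ) : ℝ :=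
  ∑' y : Fin d → ℤ, Gpt d β z (x - y) * Gpt d β z y

/-- The triangle diagram `T_z = G_z * G_z * G_z`. -/
noncomputable def Tpt (d : ℕ) (β z : ℝ) (x : Fin d → ℤ) : ℝ :=
  ∑' y : Fin d → ℤ, Bpt d β z (x - y) * Gpt d β z y

/-- The representative in `[-r/2, r/2) ∩ ℤ` of `x ∈ ℤ/rℤ`. -/
def repC (r : ℕ) (x : ZMod r) : ℤ :=
  if 2 * (x.val : ℤ) < (r : ℤ) then (x.val : ℤ) else (x.val : ℤ) - (r : ℤ)

namespace Lace

open Finset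

/-- The product of the pair weights `q s t` over all `a ≤ s < t ≤ b`. -/
def pairProd (q : ℕ → ℕ → ℝ) (a b : ℕ) : ℝ := ∏ t ∈ Ioc a b, ∏ s ∈ Ico a t, q s t

/-- The interaction of the time `t` with the time interval `[a, b)`. -/
def crossProd (q : ℕ → ℕ → ℝ) (a b t : ℕ) : ℝ := ∏ s ∈ Ico a b, q s t

/-- The lace kernel: the signed sum over laces whose first two endpoints are `a`, `b`, covering
the times up to `m`. -/
def laceSum (q : ℕ → ℕ → ℝ) (a b m : ℕ) : ℝ :=
  (if m = b then 1 else 0) + ∑ t : {t // t ∈ Ioc b m},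
    (crossProd q a b t - 1) * (∏ u ∈ Ioo b t.1, crossProd q a b u) * pairProd q b t *
      laceSum q b t m
termination_by m - b
decreasing_by
  have := mem_Ioc.1 t.2
  omega

theorem laceSum_eq (q : ℕ → ℕ → ℝ) (a b m : ℕ) :
    laceSum q a b m = (if m = b then 1 else 0) + ∑ t ∈ Ioc b m,
      (crossProd q a b t - 1) * (∏ u ∈ Ioo b t, crossProd q a b u) * pairProd q b t *
        laceSum q b t m := by
  rw [laceSum, ← Finset.sum_coe_sort (Ioc b m)]

theorem pairProd_self (q : ℕ → ℕ → ℝ) (a : ℕ) : pairProd q a a = 1 := by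
  simp [pairProd]

theorem pairProd_split (q : ℕ → ℕ → ℝ) {a b n : ℕ} (hab : a ≤ b) (hbn : b ≤ n) :
    pairProd q a n = pairProd q a b * ((∏ t ∈ Ioc b n, crossProd q a b t) * pairProd q b n) := by
  unfold pairProd crossProd
  rw [← Finset.prod_Ioc_consecutive _ hab hbn, ← Finset.prod_mul_distrib]
  congr 1
  refine Finset.prod_congr rfl fun t ht => ?_
  rw [Finset.prod_Ico_consecutive _ hab (mem_Ioc.1 ht).1.le]

theorem prod_Ioc_eq_one_add (f : ℕ → ℝ) (b n : ℕ) :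
    ∏ t ∈ Ioc b n, f t = 1 + ∑ t ∈ Ioc b n, (f t - 1) * ∏ u ∈ Ioo b t, f u := by
  have h := Finset.prod_add_ordered (Ioc b n) (fun _ => (1 : ℝ)) (fun t => f t - 1)
  simp only [add_sub_cancel, prod_const_one, mul_one] at h
  rw [h]
  congr 1
  refine Finset.sum_congr rfl fun t ht => ?_
  congr 2
  ext u
  simp only [mem_filter, mem_Ioc, mem_Ioo] at *
  omega

theorem cross_mul_pairProd_eq (q : ℕ → ℕ → ℝ) (n : ℕ) : ∀ (k a b : ℕ), n - b ≤ k → b ≤ n →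
    (∏ t ∈ Ioc b n, crossProd q a b t) * pairProd q b n =
      ∑ m ∈ Icc b n, laceSum q a b m * pairProd q m n := by
  intro k
  induction k with
  | zero =>
    intro a b h1 h2
    obtain rfl : b = n := by omega
    rw [Icc_self, sum_singleton, laceSum_eq]
    simp [pairProd_self]
  | succ k ih =>
    intro a b h1 h2
    have hR : ∑ m ∈ Icc b n, laceSum q a b m * pairProd q m n = pairProd q b n +
        ∑ m ∈ Icc b n, ∑ t ∈ Ioc b m, (crossProd q a b t - 1) *
          (∏ u ∈ Ioo b t, crossProd q a b u) * pairProd q b t * laceSum q b t m *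
            pairProd q m n := by
      have : ∀ m ∈ Icc b n, laceSum q a b m * pairProd q m n =
          (if m = b then pairProd q m n else 0) + ∑ t ∈ Ioc b m, (crossProd q a b t - 1) *
          (∏ u ∈ Ioo b t, crossProd q a b u) * pairProd q b t * laceSum q b t m *
            pairProd q m n := by
        intro m _
        rw [laceSum_eq, add_mul, Finset.sum_mul]
        split_ifs <;> simp
      rw [Finset.sum_congr rfl this, Finset.sum_add_distrib]
      simp [h2]
    rw [hR, prod_Ioc_eq_one_add, add_mul, one_mul, Finset.sum_mul]
    congr 1
    rw [Finset.sum_comm' (t' := Ioc b n) (s' := fun t => Icc t n)]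
    · refine Finset.sum_congr rfl fun t ht => ?_
      obtain ⟨h3, h4⟩ := mem_Ioc.1 ht
      rw [pairProd_split q h3.le h4, ih b t (by omega) h4, Finset.mul_sum, Finset.mul_sum]
      refine Finset.sum_congr rfl fun m _ => ?_
      ring
    · intro m t
      simp only [mem_Icc, mem_Ioc]
      omega

/-- The lace expansion, for the interaction along a single path. -/
theorem pairProd_eq_sum_laceSum (q : ℕ → ℕ → ℝ) (h01 : q 0 1 = 1) {n : ℕ} (hn : 1 ≤ n) :
    pairProd q 0 n = ∑ m ∈ Icc 1 n, laceSum q 0 1 m * pairProd q m n := by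
  rw [← cross_mul_pairProd_eq q n n 0 1 (by omega) hn, pairProd_split q zero_le_one hn]
  have : pairProd q 0 1 = 1 := by
    rw [pairProd, show Ioc 0 1 = {1} from rfl]
    simp [h01]
  rw [this, one_mul]

end Lace

namespace Lace

open Finset
open scoped ENNReal

/-- A positive majorant of the lace kernel. -/
noncomputable def laceMaj (q : ℕ → ℕ → ℝ) (a b m : ℕ) : ℝ≥0∞ :=
  (if m = b then 1 else 0) + ∑ t : {t // t ∈ Ioc b m},
    (∑ s ∈ Ico a b, ENNReal.ofReal (1 - q s t)) * ENNReal.ofReal (pairProd q b t) *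
      laceMaj q b t m
termination_by m - b
decreasing_by
  have := mem_Ioc.1 t.2
  omega

theorem laceMaj_eq (q : ℕ → ℕ → ℝ) (a b m : ℕ) :
    laceMaj q a b m = (if m = b then 1 else 0) + ∑ t ∈ Ioc b m,
      (∑ s ∈ Ico a b, ENNReal.ofReal (1 - q s t)) * ENNReal.ofReal (pairProd q b t) *
        laceMaj q b t m := by
  rw [laceMaj, ← Finset.sum_coe_sort (Ioc b m)]

theorem pairProd_congr {q q' : ℕ → ℕ → ℝ} {a b : ℕ} (h : ∀ t ≤ b, ∀ s < t, q s t = q' s t) :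
    pairProd q a b = pairProd q' a b :=
  Finset.prod_congr rfl fun t ht => Finset.prod_congr rfl fun s hs =>
    h t (mem_Ioc.1 ht).2 s (mem_Ico.1 hs).2

theorem laceSum_congr {q q' : ℕ → ℕ → ℝ} {m : ℕ} (h : ∀ t ≤ m, ∀ s < t, q s t = q' s t) :
    ∀ (k a b : ℕ), m - b ≤ k → laceSum q a b m = laceSum q' a b m := by
  intro k
  induction k with
  | zero =>
    intro a b hb
    rw [laceSum_eq, laceSum_eq, Ioc_eq_empty (by omega)]
    simp
  | succ k ih =>
    intro a b hb
    rw [laceSum_eq, laceSum_eq]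
    congr 1
    refine Finset.sum_congr rfl fun t ht => ?_
    obtain ⟨h1, h2⟩ := mem_Ioc.1 ht
    have hc : ∀ u, b < u → u ≤ m → crossProd q a b u = crossProd q' a b u := fun u hu hum =>
      Finset.prod_congr rfl fun s hs => h u hum s (by have := mem_Ico.1 hs; omega)
    rw [hc t h1 h2, ih b t (by omega), pairProd_congr fun u hu s hs => h u (by omega) s hs]
    congr 3
    refine Finset.prod_congr rfl fun u hu => hc u ?_ ?_ <;>
    · have := mem_Ioo.1 hu
      omega

theorem pairProd_shift (q : ℕ → ℕ → ℝ) (c a b : ℕ) :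
    pairProd q (c + a) (c + b) = pairProd (fun s t => q (c + s) (c + t)) a b := by
  unfold pairProd
  rw [← Finset.map_add_left_Ioc, Finset.prod_map]
  refine Finset.prod_congr rfl fun t _ => ?_
  simp only [addLeftEmbedding_apply]
  rw [← Finset.map_add_left_Ico, Finset.prod_map]
  rfl

theorem laceMaj_shift (q : ℕ → ℕ → ℝ) (c m : ℕ) : ∀ (k a b : ℕ), m - b ≤ k →
    laceMaj q (c + a) (c + b) (c + m) = laceMaj (fun s t => q (c + s) (c + t)) a b m := by
  intro k
  induction k with
  | zero =>
    intro a b hb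
    rw [laceMaj_eq, laceMaj_eq, Ioc_eq_empty (by omega), Ioc_eq_empty (by omega)]
    simp
  | succ k ih =>
    intro a b hb
    rw [laceMaj_eq, laceMaj_eq]
    congr 1
    · simp
    rw [← Finset.map_add_left_Ioc, Finset.sum_map]
    refine Finset.sum_congr rfl fun t ht => ?_
    obtain ⟨h1, h2⟩ := mem_Ioc.1 ht
    simp only [addLeftEmbedding_apply]
    rw [ih b t (by omega), pairProd_shift, ← Finset.map_add_left_Ico, Finset.sum_map]
    rfl

section Bounds

variable {q : ℕ → ℕ → ℝ}

theorem pairProd_nonneg (h0 : ∀ s t, 0 ≤ q s t) (a b : ℕ) : 0 ≤ pairProd q a b :=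
  Finset.prod_nonneg fun _ _ => Finset.prod_nonneg fun _ _ => h0 _ _

theorem crossProd_nonneg (h0 : ∀ s t, 0 ≤ q s t) (a b t : ℕ) : 0 ≤ crossProd q a b t :=
  Finset.prod_nonneg fun _ _ => h0 _ _

theorem crossProd_le_one (h0 : ∀ s t, 0 ≤ q s t) (h1 : ∀ s t, q s t ≤ 1) (a b t : ℕ) :
    crossProd q a b t ≤ 1 :=
  Finset.prod_le_one (fun _ _ => h0 _ _) fun _ _ => h1 _ _

theorem pairProd_le_mul (h0 : ∀ s t, 0 ≤ q s t) (h1 : ∀ s t, q s t ≤ 1) {a s b : ℕ}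
    (has : a ≤ s) (hsb : s ≤ b) : pairProd q a b ≤ pairProd q a s * pairProd q s b := by
  rw [pairProd_split q has hsb]
  gcongr
  · exact pairProd_nonneg h0 _ _
  · exact mul_le_of_le_one_left (pairProd_nonneg h0 _ _)
      (Finset.prod_le_one (fun _ _ => crossProd_nonneg h0 _ _ _)
        fun _ _ => crossProd_le_one h0 h1 _ _ _)

theorem one_sub_prod_le {ι : Type*} (s : Finset ι) {f : ι → ℝ} (h0 : ∀ i, 0 ≤ f i)
    (h1 : ∀ i, f i ≤ 1) : 1 - ∏ i ∈ s, f i ≤ ∑ i ∈ s, (1 - f i) := by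
  classical
  induction s using Finset.induction_on with
  | empty => simp
  | insert i s hi ih =>
    rw [prod_insert hi, sum_insert hi]
    have hP : ∏ i ∈ s, f i ≤ 1 := Finset.prod_le_one (fun _ _ => h0 _) fun _ _ => h1 _
    nlinarith [h0 i, h1 i]

theorem enorm_crossProd_sub_one_le (h0 : ∀ s t, 0 ≤ q s t) (h1 : ∀ s t, q s t ≤ 1) (a b t : ℕ) :
    ‖crossProd q a b t - 1‖ₑ ≤ ∑ s ∈ Ico a b, ENNReal.ofReal (1 - q s t) := by
  have h2 := one_sub_prod_le (Ico a b) (f := fun s => q s t) (fun s => h0 s t) fun s => h1 s t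
  rw [← ENNReal.ofReal_sum_of_nonneg fun s _ => sub_nonneg.2 (h1 s t), Real.enorm_eq_ofReal_abs]
  apply ENNReal.ofReal_le_ofReal
  rw [abs_of_nonpos (sub_nonpos.2 (crossProd_le_one h0 h1 _ _ _))]
  unfold crossProd
  linarith

theorem enorm_laceSum_le (h0 : ∀ s t, 0 ≤ q s t) (h1 : ∀ s t, q s t ≤ 1) (m : ℕ) :
    ∀ (k a b : ℕ), m - b ≤ k → ‖laceSum q a b m‖ₑ ≤ laceMaj q a b m := by
  intro k
  induction k with
  | zero =>
    intro a b hb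
    rw [laceSum_eq, laceMaj_eq, Ioc_eq_empty (by omega)]
    split_ifs <;> simp
  | succ k ih =>
    intro a b hb
    rw [laceSum_eq, laceMaj_eq]
    refine (enorm_add_le _ _).trans (add_le_add ?_ ((enorm_sum_le _ _).trans ?_))
    · split_ifs <;> simp
    refine Finset.sum_le_sum fun t ht => ?_
    obtain ⟨h3, h4⟩ := mem_Ioc.1 ht
    rw [enorm_mul, enorm_mul, enorm_mul]
    have hP : ‖∏ u ∈ Ioo b t, crossProd q a b u‖ₑ ≤ 1 := by
      rw [Real.enorm_eq_ofReal (Finset.prod_nonneg fun _ _ => crossProd_nonneg h0 _ _ _),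
        ENNReal.ofReal_le_one]
      exact Finset.prod_le_one (fun _ _ => crossProd_nonneg h0 _ _ _)
        fun _ _ => crossProd_le_one h0 h1 _ _ _
    calc _ ≤ (∑ s ∈ Ico a b, ENNReal.ofReal (1 - q s t)) * 1 * ENNReal.ofReal (pairProd q b t) *
          laceMaj q b t m := by
          gcongr
          · exact enorm_crossProd_sub_one_le h0 h1 _ _ _
          · rw [Real.enorm_eq_ofReal (pairProd_nonneg h0 _ _)]
          · exact ih b t (by omega)
      _ = _ := by rw [mul_one]

/-- The weight of the first loop of a lace starting at time `0`. -/
noncomputable def loopProd (q : ℕ → ℕ → ℝ) (t : ℕ) : ℝ :=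
  (∏ u ∈ Ioo 1 t, q 0 u) * pairProd q 1 t

theorem enorm_laceSum_zero_one_le (h0 : ∀ s t, 0 ≤ q s t) (h1 : ∀ s t, q s t ≤ 1) {m : ℕ}
    (hm : 2 ≤ m) : ‖laceSum q 0 1 m‖ₑ ≤ ∑ t ∈ Ioc 1 m,
      ENNReal.ofReal (1 - q 0 t) * ENNReal.ofReal (loopProd q t) * laceMaj q 1 t m := by
  rw [laceSum_eq, if_neg (by omega), zero_add]
  refine (enorm_sum_le _ _).trans (Finset.sum_le_sum fun t _ => ?_)
  rw [enorm_mul, mul_assoc (_ - _), enorm_mul]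
  have hc : ∀ u, crossProd q 0 1 u = q 0 u := fun u => by simp [crossProd]
  simp only [hc]
  gcongr
  · rw [← enorm_neg, neg_sub, Real.enorm_eq_ofReal (sub_nonneg.2 (h1 _ _))]
  · rw [Real.enorm_eq_ofReal, loopProd]
    exact mul_nonneg (Finset.prod_nonneg fun _ _ => h0 _ _) (pairProd_nonneg h0 _ _)
  · exact enorm_laceSum_le h0 h1 m m 1 t (by omega)

theorem loopProd_le_mul (h0 : ∀ s t, 0 ≤ q s t) (h1 : ∀ s t, q s t ≤ 1) (h01 : q 0 1 = 1)
    {s t : ℕ} (hs : 1 ≤ s) (hst : s < t) :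
    loopProd q t ≤ pairProd q 0 s * pairProd q s t := by
  have h2 : pairProd q 0 1 = 1 := by
    rw [pairProd, show Ioc 0 1 = {1} from rfl]
    simp [h01]
  rw [pairProd_split q zero_le_one hs, h2, one_mul, mul_assoc, loopProd]
  gcongr
  · exact pairProd_nonneg h0 _ _
  · exact Finset.prod_nonneg fun _ _ => crossProd_nonneg h0 _ _ _
  · calc ∏ u ∈ Ioo 1 t, q 0 u ≤ ∏ u ∈ Ioc 1 s, q 0 u := by
          apply Finset.prod_le_prod_of_subset_of_le_one
          · intro u hu
            simp only [mem_Ioc, mem_Ioo] at *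
            omega
          · exact fun _ _ => h0 _ _
          · exact fun _ _ _ => h1 _ _
      _ = _ := by simp [crossProd]
  · exact pairProd_le_mul h0 h1 hs hst.le

end Bounds

end Lace

namespace WSAW

open Finset Lace
open scoped ENNReal

section WalkSum

variable {S R R' : Type*} [Fintype S] [CommSemiring R] [CommSemiring R']

/-- The sum of `F` over all step sequences of length `n`, with weight `z` per step. -/
def walkSum (z : R) (n : ℕ) (F : List S → R) : R := z ^ n * ∑ v : Fin n → S, F (List.ofFn v)

theorem walkSum_zero (z : R) (F : List S → R) : walkSum z 0 F = F [] := by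
  simp [walkSum]

theorem walkSum_succ (z : R) (n : ℕ) (F : List S → R) :
    walkSum z (n + 1) F = z * ∑ e, walkSum z n fun l => F (e :: l) := by
  unfold walkSum
  rw [← (Fin.consEquiv fun _ => S).sum_comp, Fintype.sum_prod_type, ← Finset.mul_sum, pow_succ']
  rw [mul_assoc]
  congr 2
  refine Finset.sum_congr rfl fun e _ => Finset.sum_congr rfl fun v _ => ?_
  simp [Fin.consEquiv, List.ofFn_succ]

theorem walkSum_congr (z : R) {n : ℕ} {F G : List S → R} (h : ∀ l, l.length = n → F l = G l) :
    walkSum z n F = walkSum z n G := by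
  unfold walkSum
  congr 1
  exact Finset.sum_congr rfl fun v _ => h _ (by simp)

theorem walkSum_add_length (z : R) (m n : ℕ) (F : List S → R) :
    walkSum z (m + n) F = walkSum z m fun l => walkSum z n fun l' => F (l ++ l') := by
  induction m generalizing F with
  | zero => simp [walkSum_zero]
  | succ m ih =>
    rw [Nat.add_right_comm, walkSum_succ, walkSum_succ]
    simp [ih]

theorem walkSum_add (z : R) (n : ℕ) (F G : List S → R) :
    walkSum z n (fun l => F l + G l) = walkSum z n F + walkSum z n G := by
  simp [walkSum, Finset.sum_add_distrib, mul_add]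

theorem walkSum_mul_left (z : R) (n : ℕ) (c : R) (F : List S → R) :
    walkSum z n (fun l => c * F l) = c * walkSum z n F := by
  simp only [walkSum, ← Finset.mul_sum]
  ring

theorem walkSum_mul_right (z : R) (n : ℕ) (c : R) (F : List S → R) :
    walkSum z n (fun l => F l * c) = walkSum z n F * c := by
  simp only [walkSum, ← Finset.sum_mul]
  ring

theorem walkSum_sum {ι : Type*} (z : R) (n : ℕ) (s : Finset ι) (F : ι → List S → R) :
    walkSum z n (fun l => ∑ i ∈ s, F i l) = ∑ i ∈ s, walkSum z n (F i) := by
  simp only [walkSum]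
  rw [Finset.sum_comm, Finset.mul_sum]

theorem walkSum_eq_pow_mul (z : R) (n : ℕ) (F : List S → R) :
    walkSum z n F = z ^ n * walkSum 1 n F := by
  simp [walkSum]

theorem walkSum_comp_equiv (z : R) (n : ℕ) (σ : S ≃ S) (F : List S → R) :
    walkSum z n (fun l => F (l.map σ)) = walkSum z n F := by
  unfold walkSum
  congr 1
  refine Fintype.sum_equiv (Equiv.arrowCongr (Equiv.refl (Fin n)) σ) _ _ fun v => ?_
  simp only [List.map_ofFn]
  rfl

theorem walkSum_mono {n : ℕ} (z : ℝ≥0∞) {F G : List S → ℝ≥0∞}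
    (h : ∀ l, l.length = n → F l ≤ G l) : walkSum z n F ≤ walkSum z n G := by
  unfold walkSum
  gcongr with v
  exact h _ (by simp)

theorem walkSum_mono_real {n : ℕ} {z : ℝ} (hz : 0 ≤ z) {F G : List S → ℝ}
    (h : ∀ l, l.length = n → F l ≤ G l) : walkSum z n F ≤ walkSum z n G := by
  unfold walkSum
  gcongr with v
  exact h _ (by simp)

theorem walkSum_nonneg {n : ℕ} {z : ℝ} (hz : 0 ≤ z) {F : List S → ℝ}
    (h : ∀ l, 0 ≤ F l) : 0 ≤ walkSum z n F :=
  mul_nonneg (pow_nonneg hz _) (Finset.sum_nonneg fun _ _ => h _)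

theorem ofReal_walkSum {n : ℕ} {z : ℝ} (hz : 0 ≤ z) {F : List S → ℝ} (h : ∀ l, 0 ≤ F l) :
    ENNReal.ofReal (walkSum z n F) =
      walkSum (ENNReal.ofReal z) n fun l => ENNReal.ofReal (F l) := by
  unfold walkSum
  rw [ENNReal.ofReal_mul (pow_nonneg hz _), ENNReal.ofReal_pow hz,
    ENNReal.ofReal_sum_of_nonneg fun _ _ => h _]

theorem tsum_walkSum {V : Type*} (z : ℝ≥0∞) (n : ℕ) (F : V → List S → ℝ≥0∞) :
    ∑' x, walkSum z n (F x) = walkSum z n fun l => ∑' x, F x l := by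
  simp only [walkSum]
  rw [ENNReal.tsum_mul_left, Summable.tsum_finsetSum fun _ _ => ENNReal.summable]

end WalkSum

section Path

variable {d : ℕ}

/-- The endpoint of a step sequence. -/
def endpt (l : List (Fin d × Bool)) : Fin d → ℤ := (l.map (wsawStep d)).sum

/-- The position after `k` steps. -/
def listPos (l : List (Fin d × Bool)) (k : ℕ) : Fin d → ℤ := endpt (l.take k)

theorem endpt_append (l l' : List (Fin d × Bool)) : endpt (l ++ l') = endpt l + endpt l' := by
  simp [endpt]

@[simp] theorem endpt_nil : endpt ([] : List (Fin d × Bool)) = 0 := rfl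

theorem endpt_cons (e : Fin d × Bool) (l : List (Fin d × Bool)) :
    endpt (e :: l) = wsawStep d e + endpt l := by
  simp [endpt]

theorem listPos_length (l : List (Fin d × Bool)) : listPos l l.length = endpt l := by
  simp [listPos]

theorem listPos_zero (l : List (Fin d × Bool)) : listPos l 0 = 0 := by simp [listPos]

theorem listPos_append_left (l l' : List (Fin d × Bool)) {k : ℕ} (hk : k ≤ l.length) :
    listPos (l ++ l') k = listPos l k := by
  rw [listPos, List.take_append_of_le_length hk, listPos]

theorem listPos_append_right (l l' : List (Fin d × Bool)) (k : ℕ) :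
    listPos (l ++ l') (l.length + k) = endpt l + listPos l' k := by
  rw [listPos, List.take_length_add_append, endpt_append, listPos]

/-- The interaction between the times `s` and `t`. -/
noncomputable def pairWt (β : ℝ) (l : List (Fin d × Bool)) (s t : ℕ) : ℝ :=
  if listPos l s = listPos l t then 1 - β else 1

theorem pairWt_append_left (β : ℝ) (l l' : List (Fin d × Bool)) {s t : ℕ} (hs : s ≤ l.length)
    (ht : t ≤ l.length) : pairWt β (l ++ l') s t = pairWt β l s t := by
  rw [pairWt, listPos_append_left _ _ hs, listPos_append_left _ _ ht, pairWt]

theorem pairWt_append_right (β : ℝ) (l l' : List (Fin d × Bool)) (s t : ℕ) :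
    pairWt β (l ++ l') (l.length + s) (l.length + t) = pairWt β l' s t := by
  simp [pairWt, listPos_append_right]

theorem pairWt_nonneg {β : ℝ} (hβ : β ≤ 1) (l : List (Fin d × Bool)) (s t : ℕ) :
    0 ≤ pairWt β l s t := by
  unfold pairWt
  split_ifs <;> linarith

theorem pairWt_le_one {β : ℝ} (hβ : 0 ≤ β) (l : List (Fin d × Bool)) (s t : ℕ) :
    pairWt β l s t ≤ 1 := by
  unfold pairWt
  split_ifs <;> linarith

theorem wsawStep_ne_zero (e : Fin d × Bool) : wsawStep d e ≠ 0 := by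
  intro h
  have := congrFun h e.1
  simp only [wsawStep, if_true, Pi.zero_apply] at this
  split_ifs at this
  omega

theorem pairWt_zero_one (β : ℝ) {l : List (Fin d × Bool)} (hl : l ≠ []) :
    pairWt β l 0 1 = 1 := by
  obtain ⟨e, l', rfl⟩ := List.exists_cons_of_ne_nil hl
  rw [pairWt, if_neg]
  rw [listPos_zero]
  simpa [listPos, endpt] using (wsawStep_ne_zero e).symm

/-- The weight of a weakly self-avoiding walk, as a function of its list of steps. -/
noncomputable def wt (β : ℝ) (l : List (Fin d × Bool)) : ℝ :=
  pairProd (pairWt β l) 0 l.length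

theorem pairProd_append_left (β : ℝ) (l l' : List (Fin d × Bool)) (a : ℕ) {b : ℕ}
    (hb : b ≤ l.length) : pairProd (pairWt β (l ++ l')) a b = pairProd (pairWt β l) a b :=
  pairProd_congr fun t ht s hs => pairWt_append_left β l l' (by omega) (by omega)

theorem pairProd_append_right (β : ℝ) (l l' : List (Fin d × Bool)) (a b : ℕ) :
    pairProd (pairWt β (l ++ l')) (l.length + a) (l.length + b) = pairProd (pairWt β l') a b := by
  rw [pairProd_shift]
  simp only [pairWt_append_right]

theorem laceSum_append_left (β : ℝ) (l l' : List (Fin d × Bool)) (a b : ℕ) {m : ℕ}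
    (hm : m ≤ l.length) : laceSum (pairWt β (l ++ l')) a b m = laceSum (pairWt β l) a b m :=
  laceSum_congr (fun t ht s hs => pairWt_append_left β l l' (by omega) (by omega)) _ a b le_rfl

theorem laceMaj_append_right (β : ℝ) (l l' : List (Fin d × Bool)) (a b m : ℕ) :
    laceMaj (pairWt β (l ++ l')) (l.length + a) (l.length + b) (l.length + m) =
      laceMaj (pairWt β l') a b m := by
  rw [laceMaj_shift _ _ _ _ a b le_rfl]
  simp only [pairWt_append_right]

theorem wt_nonneg {β : ℝ} (hβ : β ≤ 1) (l : List (Fin d × Bool)) : 0 ≤ wt β l :=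
  pairProd_nonneg (pairWt_nonneg hβ l) _ _

theorem wsawPos_eq_listPos {n : ℕ} (v : Fin n → Fin d × Bool) (k : ℕ) :
    wsawPos v k = listPos (List.ofFn v) k := by
  induction n generalizing k with
  | zero => simp [wsawPos, listPos]
  | succ n ih =>
    cases k with
    | zero => simp [wsawPos, listPos]
    | succ k =>
      rw [List.ofFn_succ, listPos, List.take_succ_cons, endpt_cons, ← listPos, ← ih, wsawPos,
        wsawPos, Finset.sum_filter, Fin.sum_univ_succ, Finset.sum_filter]
      simp

theorem wsawWeight_eq_wt (β : ℝ) {n : ℕ} (v : Fin n → Fin d × Bool) :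
    wsawWeight β n v = wt β (List.ofFn v) := by
  rw [wsawWeight, wt, pairProd, Finset.prod_sigma', List.length_ofFn]
  refine Finset.prod_bij' (fun p _ => ⟨p.2, p.1⟩) (fun p _ => (p.2, p.1)) ?_ ?_ ?_ ?_ ?_
  · intro p hp
    simp only [mem_filter, mem_product, mem_range, mem_sigma, mem_Ioc, mem_Ico] at *
    omega
  · intro p hp
    simp only [mem_filter, mem_product, mem_range, mem_sigma, mem_Ioc, mem_Ico] at *
    omega
  · simp
  · simp
  · intro p _
    rw [pairWt, wsawPos_eq_listPos, wsawPos_eq_listPos]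
    split_ifs <;> ring

theorem cZ_eq_walkSum (β : ℝ) (n : ℕ) : cZ d β n = walkSum 1 n (wt (d := d) β) := by
  simp [cZ, walkSum, wsawWeight_eq_wt]

end Path

end WSAW

namespace WSAW

open Finset Lace
open scoped ENNReal

section Decay

/-- The decay rate `(j + 1) ^ (-d / 2)`. -/
noncomputable def decay (d j : ℕ) : ℝ := ((j : ℝ) + 1) ^ (-((d : ℝ) / 2))

/-- The square root of `decay`, as an extended nonnegative real. -/
noncomputable def sqrtDecay (d j : ℕ) : ℝ≥0∞ := ENNReal.ofReal (((j : ℝ) + 1) ^ (-((d : ℝ) / 4)))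

/-- `decay` as an extended nonnegative real. -/
noncomputable def edecay (d j : ℕ) : ℝ≥0∞ := ENNReal.ofReal (decay d j)

theorem decay_pos (d j : ℕ) : 0 < decay d j := by unfold decay; positivity

theorem decay_le_of_le {d p l c : ℕ} (h : l + 1 ≤ c * (p + 1)) :
    decay d p ≤ (c : ℝ) ^ ((d : ℝ) / 2) * decay d l := by
  unfold decay
  have hc : (0 : ℝ) < c := by
    rcases Nat.eq_zero_or_pos c with rfl | hc
    · omega
    · exact_mod_cast hc
  have h1 : ((l : ℝ) + 1) / c ≤ (p : ℝ) + 1 := by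
    rw [div_le_iff₀ hc, mul_comm]
    exact_mod_cast h
  calc ((p : ℝ) + 1) ^ (-((d : ℝ) / 2)) ≤ (((l : ℝ) + 1) / c) ^ (-((d : ℝ) / 2)) :=
        Real.rpow_le_rpow_of_nonpos (by positivity) h1 (by simp; positivity)
    _ = _ := by
        rw [Real.div_rpow (by positivity) hc.le, Real.rpow_neg hc.le, div_inv_eq_mul, mul_comm]

/-- The doubling constant `c ^ (d / 2)`. -/
noncomputable def dbl (d c : ℕ) : ℝ≥0∞ := ENNReal.ofReal ((c : ℝ) ^ ((d : ℝ) / 2))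

theorem edecay_le_of_le {d p l c : ℕ} (h : l + 1 ≤ c * (p + 1)) :
    edecay d p ≤ dbl d c * edecay d l := by
  unfold edecay dbl
  rw [← ENNReal.ofReal_mul (by positivity)]
  exact ENNReal.ofReal_le_ofReal (decay_le_of_le h)

theorem sqrtDecay_mul_self (d j : ℕ) : sqrtDecay d j * sqrtDecay d j = edecay d j := by
  unfold sqrtDecay edecay decay
  rw [← ENNReal.ofReal_mul (by positivity), ← Real.rpow_add (by positivity)]
  congr 2
  ring

theorem min_edecay_le (d q r : ℕ) :
    min (edecay d q) (edecay d r) ≤ sqrtDecay d q * sqrtDecay d r := by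
  rw [← sqrtDecay_mul_self, ← sqrtDecay_mul_self]
  rcases le_total (sqrtDecay d q) (sqrtDecay d r) with h | h
  · exact (min_le_left _ _).trans (by gcongr)
  · exact (min_le_right _ _).trans (by gcongr)

/-- The squared sum of `sqrtDecay`. -/
noncomputable def decaySum (d : ℕ) : ℝ≥0∞ := (∑' j, sqrtDecay d j) * ∑' j, sqrtDecay d j

theorem decaySum_ne_top {d : ℕ} (hd : 4 < d) : decaySum d ≠ ∞ := by
  have : ∑' j, sqrtDecay d j ≠ ∞ := by
    unfold sqrtDecay
    have hs : Summable fun j : ℕ => ((j : ℝ) + 1) ^ (-((d : ℝ) / 4)) := by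
      have := (Real.summable_nat_rpow (p := -((d : ℝ) / 4))).2 (by
        have : (4 : ℝ) < d := by exact_mod_cast hd
        linarith)
      simpa using (summable_nat_add_iff 1).2 this
    exact hs.tsum_ofReal_ne_top
  exact ENNReal.mul_ne_top this this

theorem sum_comp_le_tsum {ι κ : Type*} (s : Finset ι) (φ : ι → κ) (g : κ → ℝ≥0∞)
    (h : Set.InjOn φ s) : ∑ i ∈ s, g (φ i) ≤ ∑' j, g j := by
  classical
  rw [← Finset.sum_image h]
  exact ENNReal.sum_le_tsum _

theorem sum_sqrtDecay_le {ι : Type*} (d : ℕ) (s : Finset ι) (q r : ι → ℕ)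
    (h : ∀ i ∈ s, ∀ j ∈ s, q i = q j → r i = r j → i = j) :
    ∑ i ∈ s, sqrtDecay d (q i) * sqrtDecay d (r i) ≤ decaySum d := by
  refine (sum_comp_le_tsum s (fun i => (q i, r i))
    (fun p => sqrtDecay d p.1 * sqrtDecay d p.2) ?_).trans ?_
  · intro i hi j hj hij
    simp only [Prod.mk.injEq] at hij
    exact h i hi j hj hij.1 hij.2
  · rw [ENNReal.tsum_prod (f := fun a b => sqrtDecay d a * sqrtDecay d b), decaySum,
      ← ENNReal.tsum_mul_right]
    simp_rw [ENNReal.tsum_mul_left]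
    exact le_rfl

end Decay

section Good

variable {V : Type*} [AddCommGroup V]

/-- A function with `ℓ¹` norm at most `A` and sup norm at most `A (n + 1) ^ (-d / 2)`. -/
def Good (d : ℕ) (f : V → ℝ≥0∞) (A : ℝ≥0∞) (n : ℕ) : Prop :=
  ∑' x, f x ≤ A ∧ ∀ x, f x ≤ A * edecay d n

theorem edecay_pair_le (d p q r l : ℕ) (h : p + q + r = l) :
    min (edecay d p * edecay d q) (min (edecay d p * edecay d r) (edecay d q * edecay d r)) ≤
      dbl d 3 * edecay d l * (sqrtDecay d q * sqrtDecay d r + sqrtDecay d p * sqrtDecay d r +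
        sqrtDecay d p * sqrtDecay d q) := by
  set P := edecay d p
  set Q := edecay d q
  set R := edecay d r
  have h1 := min_edecay_le d q r
  have h2 := min_edecay_le d p r
  have h3 := min_edecay_le d p q
  have hmul : ∀ a b c : ℝ≥0∞, min (a * b) (a * c) = a * min b c := fun a b c =>
    (mul_min a b c).symm
  have : (p ≥ q ∧ p ≥ r) ∨ (q ≥ p ∧ q ≥ r) ∨ (r ≥ p ∧ r ≥ q) := by omega
  rcases this with h' | h' | h'
  · calc _ ≤ min (P * Q) (P * R) := min_le_min le_rfl (min_le_left _ _)
      _ = P * min Q R := hmul _ _ _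
      _ ≤ _ := by
        gcongr
        · exact edecay_le_of_le (by omega)
        · exact h1.trans (by rw [add_assoc]; exact le_self_add)
  · calc _ ≤ min (P * Q) (Q * R) := min_le_min le_rfl (min_le_right _ _)
      _ = Q * min P R := by rw [mul_comm P Q, hmul]
      _ ≤ _ := by
        gcongr
        · exact edecay_le_of_le (by omega)
        · refine h2.trans ?_
          rw [add_comm (sqrtDecay d q * _), add_assoc]
          exact le_self_add
  · calc _ ≤ min (P * R) (Q * R) := min_le_right _ _
      _ = R * min P Q := by rw [mul_comm P R, mul_comm Q R, hmul]
      _ ≤ _ := by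
        gcongr
        · exact edecay_le_of_le (by omega)
        · exact h3.trans le_add_self

variable {d : ℕ} {f g h : V → ℝ≥0∞} {A B p q r : ℕ}

/-- The triangle with two propagators `f`, `g` and a vertex function `h`. -/
noncomputable def tri (f g h : V → ℝ≥0∞) (y : V) : ℝ≥0∞ := ∑' w, f w * g (y - w) * h (w - y)

theorem tsum_tri_eq : ∑' y, tri f g h y = (∑' w, f w) * ∑' u, g u * h (-u) := by
  unfold tri
  rw [ENNReal.tsum_comm, ← ENNReal.tsum_mul_right]
  refine tsum_congr fun w => ?_
  simp_rw [mul_assoc]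
  rw [ENNReal.tsum_mul_left, ← (Equiv.subRight w).tsum_eq fun u => g u * h (-u)]
  simp

theorem tsum_tri_le {A B : ℝ≥0∞} (hf : Good d f A p) (hg : Good d g A q) (hh : Good d h B r) :
    ∑' y, tri f g h y ≤ A * A * B * min (edecay d q) (edecay d r) := by
  rw [tsum_tri_eq]
  have h1 : ∑' u, g u * h (-u) ≤ A * B * edecay d q := calc
    _ ≤ ∑' u, (A * edecay d q) * h (-u) := ENNReal.tsum_le_tsum fun u => by gcongr; exact hg.2 u
    _ = A * edecay d q * ∑' u, h u := by rw [ENNReal.tsum_mul_left, ← (Equiv.neg V).tsum_eq h]; rfl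
    _ ≤ A * edecay d q * B := by gcongr; exact hh.1
    _ = _ := by ring
  have h2 : ∑' u, g u * h (-u) ≤ A * B * edecay d r := calc
    _ ≤ ∑' u, g u * (B * edecay d r) := ENNReal.tsum_le_tsum fun u => by gcongr; exact hh.2 _
    _ = (∑' u, g u) * (B * edecay d r) := by rw [ENNReal.tsum_mul_right]
    _ ≤ A * (B * edecay d r) := by gcongr; exact hg.1
    _ = _ := by ring
  calc _ ≤ A * min (A * B * edecay d q) (A * B * edecay d r) := by
        gcongr
        · exact hf.1
        · exact le_min h1 h2
    _ = _ := by rw [← mul_min]; ring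

theorem tri_le {A B : ℝ≥0∞} (hf : Good d f A p) (hg : Good d g A q) (hh : Good d h B r) (y : V) :
    tri f g h y ≤ A * A * B * min (edecay d p * edecay d q)
      (min (edecay d p * edecay d r) (edecay d q * edecay d r)) := by
  unfold tri
  have h1 : ∑' w, f w * g (y - w) * h (w - y) ≤ A * A * B * (edecay d p * edecay d q) := calc
    _ ≤ ∑' w, (A * edecay d p) * (A * edecay d q) * h (w - y) :=
        ENNReal.tsum_le_tsum fun w => by gcongr; exacts [hf.2 _, hg.2 _]
    _ = (A * edecay d p) * (A * edecay d q) * ∑' w, h w := by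
        rw [ENNReal.tsum_mul_left, ← (Equiv.subRight y).tsum_eq h]; rfl
    _ ≤ (A * edecay d p) * (A * edecay d q) * B := by gcongr; exact hh.1
    _ = _ := by ring
  have h2 : ∑' w, f w * g (y - w) * h (w - y) ≤ A * A * B * (edecay d p * edecay d r) := calc
    _ ≤ ∑' w, (A * edecay d p) * g (y - w) * (B * edecay d r) :=
        ENNReal.tsum_le_tsum fun w => by gcongr; exacts [hf.2 _, hh.2 _]
    _ = (A * edecay d p) * (∑' w, g w) * (B * edecay d r) := by
        rw [ENNReal.tsum_mul_right, ENNReal.tsum_mul_left, ← (Equiv.subLeft y).tsum_eq g]; rfl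
    _ ≤ (A * edecay d p) * A * (B * edecay d r) := by gcongr; exact hg.1
    _ = _ := by ring
  have h3 : ∑' w, f w * g (y - w) * h (w - y) ≤ A * A * B * (edecay d q * edecay d r) := calc
    _ ≤ ∑' w, f w * (A * edecay d q) * (B * edecay d r) :=
        ENNReal.tsum_le_tsum fun w => by gcongr; exacts [hg.2 _, hh.2 _]
    _ = (∑' w, f w) * (A * edecay d q) * (B * edecay d r) := by
        rw [ENNReal.tsum_mul_right, ENNReal.tsum_mul_right]
    _ ≤ A * (A * edecay d q) * (B * edecay d r) := by gcongr; exact hf.1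
    _ = _ := by ring
  rw [mul_min, mul_min]
  exact le_min h1 (le_min h2 h3)

/-- The constant for a sum of triangles. -/
noncomputable def triConst (d : ℕ) : ℝ≥0∞ := 3 * dbl d 3 * decaySum d

theorem one_le_dbl (d : ℕ) {c : ℕ} (hc : 1 ≤ c) : 1 ≤ dbl d c := by
  unfold dbl
  rw [ENNReal.one_le_ofReal]
  exact Real.one_le_rpow (by exact_mod_cast hc) (by positivity)

theorem good_sum_tri {ι : Type*} {s : Finset ι} {p q r : ι → ℕ} {l : ℕ} {f g h : ι → V → ℝ≥0∞}
    {A B : ℝ≥0∞} (hl : ∀ i ∈ s, p i + q i + r i = l)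
    (hinj : ∀ i ∈ s, ∀ j ∈ s, q i = q j → r i = r j → i = j)
    (hf : ∀ i ∈ s, Good d (f i) A (p i)) (hg : ∀ i ∈ s, Good d (g i) A (q i))
    (hh : ∀ i ∈ s, Good d (h i) B (r i)) :
    Good d (fun y => ∑ i ∈ s, tri (f i) (g i) (h i) y) (triConst d * (A * A * B)) l := by
  have hqr := sum_sqrtDecay_le d s q r hinj
  constructor
  · rw [Summable.tsum_finsetSum fun _ _ => ENNReal.summable]
    calc _ ≤ ∑ i ∈ s, A * A * B * (sqrtDecay d (q i) * sqrtDecay d (r i)) := by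
          refine Finset.sum_le_sum fun i hi => (tsum_tri_le (hf i hi) (hg i hi) (hh i hi)).trans ?_
          gcongr
          exact min_edecay_le _ _ _
      _ ≤ A * A * B * decaySum d := by
          rw [← Finset.mul_sum]
          gcongr
      _ = 1 * decaySum d * (A * A * B) := by ring
      _ ≤ _ := by
          unfold triConst
          gcongr
          calc (1 : ℝ≥0∞) ≤ 3 * 1 := by norm_num
            _ ≤ _ := by gcongr; exact one_le_dbl d (by norm_num)
  · intro y
    calc _ ≤ ∑ i ∈ s, A * A * B * (dbl d 3 * edecay d l *
          (sqrtDecay d (q i) * sqrtDecay d (r i) + sqrtDecay d (p i) * sqrtDecay d (r i) +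
            sqrtDecay d (p i) * sqrtDecay d (q i))) := by
          refine Finset.sum_le_sum fun i hi => (tri_le (hf i hi) (hg i hi) (hh i hi) y).trans ?_
          gcongr
          exact edecay_pair_le d _ _ _ _ (hl i hi)
      _ ≤ A * A * B * (dbl d 3 * edecay d l * (decaySum d + decaySum d + decaySum d)) := by
          rw [← Finset.mul_sum, ← Finset.mul_sum, Finset.sum_add_distrib, Finset.sum_add_distrib]
          gcongr
          · refine sum_sqrtDecay_le d s p r fun i hi j hj h1 h2 => hinj i hi j hj ?_ h2
            have := hl i hi
            have := hl j hj
            omega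
          · refine sum_sqrtDecay_le d s p q fun i hi j hj h1 h2 => hinj i hi j hj h2 ?_
            have := hl i hi
            have := hl j hj
            omega
      _ = _ := by unfold triConst; ring

end Good

end WSAW

namespace WSAW

open Finset Lace
open scoped ENNReal

section Diagrams

variable {d : ℕ}

/-- The squared Euclidean length of a lattice point. -/
noncomputable def sqLen (x : Fin d → ℤ) : ℝ := ∑ i, (x i : ℝ) ^ 2

theorem sqLen_nonneg (x : Fin d → ℤ) : 0 ≤ sqLen x := Finset.sum_nonneg fun _ _ => sq_nonneg _

theorem sqLen_add_le (x y : Fin d → ℤ) : sqLen (x + y) ≤ 2 * sqLen x + 2 * sqLen y := by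
  unfold sqLen
  rw [Finset.mul_sum, Finset.mul_sum, ← Finset.sum_add_distrib]
  refine Finset.sum_le_sum fun i _ => ?_
  simp only [Pi.add_apply, Int.cast_add]
  nlinarith [sq_nonneg ((x i : ℝ) - y i)]

/-- `sqLen` as an extended nonnegative real. -/
noncomputable def esqLen (x : Fin d → ℤ) : ℝ≥0∞ := ENNReal.ofReal (sqLen x)

theorem esqLen_zero : esqLen (0 : Fin d → ℤ) = 0 := by simp [esqLen, sqLen]

theorem esqLen_add_le (x y : Fin d → ℤ) : esqLen (x + y) ≤ 2 * esqLen x + 2 * esqLen y := by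
  unfold esqLen
  have h2 : (2 : ℝ≥0∞) = ENNReal.ofReal 2 := by simp
  rw [h2, ← ENNReal.ofReal_mul (by norm_num), ← ENNReal.ofReal_mul (by norm_num),
    ← ENNReal.ofReal_add (mul_nonneg (by norm_num) (sqLen_nonneg _))
      (mul_nonneg (by norm_num) (sqLen_nonneg _))]
  exact ENNReal.ofReal_le_ofReal (sqLen_add_le x y)

/-- A submultiplicative weight comparable to `1 + |x|² / (L + 1)`. -/
noncomputable def rho (L : ℕ) (x : Fin d → ℤ) : ℝ≥0∞ := 2 * (1 + esqLen x * ((L : ℝ≥0∞) + 1)⁻¹)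

theorem rho_zero (L : ℕ) : rho L (0 : Fin d → ℤ) = 2 := by simp [rho, esqLen_zero]

theorem one_le_rho (L : ℕ) (x : Fin d → ℤ) : 1 ≤ rho L x := by
  unfold rho
  calc (1 : ℝ≥0∞) ≤ 2 * 1 := by norm_num
    _ ≤ _ := by gcongr; exact le_self_add

theorem rho_add_le (L : ℕ) (x y : Fin d → ℤ) : rho L (x + y) ≤ rho L x * rho L y := by
  unfold rho
  set c := ((L : ℝ≥0∞) + 1)⁻¹
  calc 2 * (1 + esqLen (x + y) * c) ≤ 2 * (1 + (2 * esqLen x + 2 * esqLen y) * c) := by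
        gcongr
        exact esqLen_add_le x y
    _ ≤ 2 * (1 + (2 * esqLen x + 2 * esqLen y) * c) +
        (2 + 4 * (esqLen x * c) * (esqLen y * c)) := le_self_add
    _ = _ := by ring

/-- `wt` as an extended nonnegative real. -/
noncomputable def ewt (β : ℝ) (l : List (Fin d × Bool)) : ℝ≥0∞ := ENNReal.ofReal (wt β l)

/-- The two-point function of `n`-step walks, with weight `ζ` per step. -/
noncomputable def twoPt (ζ : ℝ≥0∞) (β : ℝ) (n : ℕ) (x : Fin d → ℤ) : ℝ≥0∞ :=
  walkSum ζ n fun l => if endpt l = x then ewt β l else 0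

/-- The `rho`-weighted two-point function. -/
noncomputable def rhoPt (L : ℕ) (ζ : ℝ≥0∞) (β : ℝ) (n : ℕ) (x : Fin d → ℤ) : ℝ≥0∞ :=
  rho L x * twoPt ζ β n x

/-- The part of the lace majorant carried by a final piece of a walk, when the previous piece
visited `y`. -/
noncomputable def laceTail (β : ℝ) (l : List (Fin d × Bool)) (y : Fin d → ℤ) : ℝ≥0∞ :=
  ∑ t ∈ Ioc 0 l.length, (if y = listPos l t then ENNReal.ofReal β else 0) *
    ENNReal.ofReal (pairProd (pairWt β l) 0 t) * laceMaj (pairWt β l) 0 t l.length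

/-- The vertex function: the `rho`-weighted sum of `laceTail`. -/
noncomputable def vert (L : ℕ) (ζ : ℝ≥0∞) (β : ℝ) (k : ℕ) (y : Fin d → ℤ) : ℝ≥0∞ :=
  walkSum ζ k fun l => rho L (endpt l) * laceTail β l y

theorem ofReal_one_sub_pairWt (β : ℝ) (l : List (Fin d × Bool)) (s t : ℕ) :
    ENNReal.ofReal (1 - pairWt β l s t) =
      if listPos l s = listPos l t then ENNReal.ofReal β else 0 := by
  unfold pairWt
  split_ifs <;> simp

theorem laceMaj_append (β : ℝ) (l l' : List (Fin d × Bool)) (a : ℕ) :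
    laceMaj (pairWt β (l ++ l')) a l.length (l.length + l'.length) =
      (if l'.length = 0 then 1 else 0) +
        ∑ s ∈ Ico a l.length, laceTail β l' (listPos l s - endpt l) := by
  rw [laceMaj_eq]
  congr 1
  · simp
  · unfold laceTail
    rw [Finset.sum_comm]
    have : Ioc l.length (l.length + l'.length) =
        (Ioc 0 l'.length).map (addLeftEmbedding l.length) := by
      rw [Finset.map_add_left_Ioc, add_zero]
    rw [this, Finset.sum_map]
    refine Finset.sum_congr rfl fun t _ => ?_
    simp only [addLeftEmbedding_apply]
    have h1 := pairProd_append_right β l l' 0 t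
    have h2 := laceMaj_append_right β l l' 0 t l'.length
    rw [add_zero] at h1 h2
    rw [h1, h2, ← Finset.sum_mul, ← Finset.sum_mul]
    congr 2
    refine Finset.sum_congr rfl fun s hs => ?_
    rw [ofReal_one_sub_pairWt, listPos_append_right, listPos_append_left _ _ (mem_Ico.1 hs).2.le]
    simp only [sub_eq_iff_eq_add']

theorem walkSum_rho_laceMaj (L : ℕ) (ζ : ℝ≥0∞) (β : ℝ) (l : List (Fin d × Bool)) (a k : ℕ) :
    (walkSum ζ k fun l' => rho L (endpt l') *
      laceMaj (pairWt β (l ++ l')) a l.length (l.length + k)) =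
      (if k = 0 then 2 else 0) +
        ∑ s ∈ Ico a l.length, vert L ζ β k (listPos l s - endpt l) := by
  unfold vert
  rw [← walkSum_sum]
  have : (if k = 0 then (2 : ℝ≥0∞) else 0) =
      walkSum ζ k fun l' : List (Fin d × Bool) => rho L (endpt l') * if k = 0 then 1 else 0 := by
    split_ifs with h
    · subst h
      simp [walkSum_zero, rho_zero]
    · simp [walkSum]
  rw [this, ← walkSum_add]
  refine walkSum_congr _ fun l' hl' => ?_
  subst hl'
  rw [laceMaj_append, mul_add, Finset.mul_sum]

theorem walkSum_split (ζ : ℝ≥0∞) (β : ℝ) (s k : ℕ) (y : Fin d → ℤ) (Φ Ψ : (Fin d → ℤ) → ℝ≥0∞) :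
    (walkSum ζ (s + k) fun l => if endpt l = y then
      Φ (listPos l s) * ENNReal.ofReal (pairProd (pairWt β l) 0 s) *
        (Ψ (y - listPos l s) * ENNReal.ofReal (pairProd (pairWt β l) s (s + k))) else 0) =
      ∑' w, Φ w * twoPt ζ β s w * (Ψ (y - w) * twoPt ζ β k (y - w)) := by
  unfold twoPt
  have hw : ∀ w, (Φ w * walkSum ζ s fun l => if endpt l = w then ewt β l else 0) *
      (Ψ (y - w) * walkSum ζ k fun l => if endpt l = y - w then ewt β l else 0) =
      walkSum ζ s fun l => Φ w * (if endpt l = w then ewt β l else 0) *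
        (Ψ (y - w) * walkSum ζ k fun l => if endpt l = y - w then ewt β l else 0) := fun w => by
    rw [← walkSum_mul_left, ← walkSum_mul_right]
  simp only [hw]
  rw [tsum_walkSum, walkSum_add_length]
  refine walkSum_congr ζ fun l hl => ?_
  simp only [mul_ite, mul_zero, ite_mul, zero_mul]
  rw [tsum_eq_single (endpt l)]
  · rw [if_pos rfl]
    rw [← walkSum_mul_left, ← walkSum_mul_left]
    refine walkSum_congr _ fun l' hl' => ?_
    subst hl
    subst hl'
    have h1 := pairProd_append_right β l l' 0 l'.length
    rw [add_zero] at h1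
    rw [listPos_append_left _ _ le_rfl, listPos_length, endpt_append, h1,
      pairProd_append_left _ _ _ _ le_rfl]
    simp only [← eq_sub_iff_add_eq', ewt, wt]
    split_ifs <;> simp
  · intro w hw
    rw [if_neg hw.symm]

theorem ofReal_pairProd_le {β : ℝ} (h0 : 0 ≤ β) (h1 : β ≤ 1) (l : List (Fin d × Bool)) {s t : ℕ}
    (h : s ≤ t) : ENNReal.ofReal (pairProd (pairWt β l) 0 t) ≤
      ENNReal.ofReal (pairProd (pairWt β l) 0 s) * ENNReal.ofReal (pairProd (pairWt β l) s t) := by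
  rw [← ENNReal.ofReal_mul (pairProd_nonneg (pairWt_nonneg h1 l) _ _)]
  exact ENNReal.ofReal_le_ofReal
    (pairProd_le_mul (pairWt_nonneg h1 l) (pairWt_le_one h0 l) (Nat.zero_le _) h)

theorem ofReal_loopProd_le {β : ℝ} (h0 : 0 ≤ β) (h1 : β ≤ 1) {l : List (Fin d × Bool)}
    (hl : l ≠ []) {s t : ℕ} (hs : 1 ≤ s) (h : s < t) :
    ENNReal.ofReal (loopProd (pairWt β l) t) ≤
      ENNReal.ofReal (pairProd (pairWt β l) 0 s) * ENNReal.ofReal (pairProd (pairWt β l) s t) := by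
  rw [← ENNReal.ofReal_mul (pairProd_nonneg (pairWt_nonneg h1 l) _ _)]
  exact ENNReal.ofReal_le_ofReal
    (loopProd_le_mul (pairWt_nonneg h1 l) (pairWt_le_one h0 l) (pairWt_zero_one β hl) hs h)

theorem vert_le (L : ℕ) (ζ : ℝ≥0∞) {β : ℝ} (h0 : 0 ≤ β) (h1 : β ≤ 1) {n : ℕ}
    (y : Fin d → ℤ) :
    vert L ζ β n y ≤ ENNReal.ofReal β * (2 * rhoPt L ζ β n y +
      ∑ i ∈ (Ioc 0 n).sigma fun t => range t,
        tri (rhoPt L ζ β i.2) (rhoPt L ζ β (i.1 - i.2)) (vert L ζ β (n - i.1)) y) := by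
  have key : ∀ t ∈ Ioc 0 n, (walkSum ζ n fun l => rho L (endpt l) *
      ((if y = listPos l t then ENNReal.ofReal β else 0) *
        ENNReal.ofReal (pairProd (pairWt β l) 0 t) * laceMaj (pairWt β l) 0 t n)) ≤
      ENNReal.ofReal β * ((if n - t = 0 then 2 * rhoPt L ζ β n y else 0) + ∑ s ∈ range t,
        tri (rhoPt L ζ β s) (rhoPt L ζ β (t - s)) (vert L ζ β (n - t)) y) := by
    intro t ht
    obtain ⟨ht0, htn⟩ := mem_Ioc.1 ht
    obtain ⟨k, rfl⟩ := Nat.exists_eq_add_of_le htn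
    rw [Nat.add_sub_cancel_left, walkSum_add_length]
    calc _ ≤ walkSum ζ t fun l => ENNReal.ofReal β * ((if endpt l = y then rho L y * ewt β l else 0)
          * ((if k = 0 then 2 else 0) + ∑ s ∈ Ico 0 t, vert L ζ β k (listPos l s - y))) := by
          refine walkSum_mono _ fun l hl => ?_
          subst hl
          by_cases hy : endpt l = y
          · rw [if_pos hy]
            have e := walkSum_rho_laceMaj L ζ β l 0 k
            rw [hy] at e
            rw [← e, ← walkSum_mul_left, ← walkSum_mul_left]
            refine walkSum_mono _ fun l' hl' => ?_
            rw [listPos_append_left _ _ le_rfl, listPos_length, if_pos hy.symm,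
              pairProd_append_left _ _ _ _ le_rfl, endpt_append, hy]
            calc _ ≤ (rho L y * rho L (endpt l')) * _ := by gcongr; exact rho_add_le _ _ _
              _ = _ := by rw [ewt, wt]; ring
          · rw [walkSum_congr (G := fun _ => 0)]
            · simp [walkSum]
            · intro l' hl'
              rw [listPos_append_left _ _ le_rfl, listPos_length, if_neg (fun h => hy h.symm)]
              simp
      _ = ENNReal.ofReal β * ((if k = 0 then 2 * rhoPt L ζ β t y else 0) +
          ∑ s ∈ range t, walkSum ζ t fun l => (if endpt l = y then rho L y * ewt β l else 0) *
            vert L ζ β k (listPos l s - y)) := by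
          rw [walkSum_mul_left]
          simp only [mul_add]
          rw [walkSum_add, walkSum_mul_right]
          have e1 : ∀ l : List (Fin d × Bool), (if endpt l = y then rho L y * ewt β l else 0) *
              ∑ s ∈ Ico 0 t, vert L ζ β k (listPos l s - y) = ∑ s ∈ range t,
              (if endpt l = y then rho L y * ewt β l else 0) *
                vert L ζ β k (listPos l s - y) := fun l => by
            rw [Finset.mul_sum, Nat.Ico_zero_eq_range]
          simp only [e1]
          rw [walkSum_sum, mul_add]
          congr 2
          have e : (walkSum ζ t fun l => if endpt l = y then rho L y * ewt β l else 0) =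
              rhoPt L ζ β t y := by
            rw [rhoPt, twoPt, ← walkSum_mul_left]
            simp
          rw [e]
          split_ifs <;> ring
      _ ≤ _ := by
          gcongr with s hs
          · rcases eq_or_ne k 0 with rfl | hk
            · simp
            · simp [hk]
          have hs := mem_range.1 hs
          obtain ⟨j, rfl⟩ := Nat.exists_eq_add_of_lt hs
          have e := walkSum_split ζ β s (j + 1) y
            (fun w => rho L w * vert L ζ β k (w - y)) (rho L)
          have e' : tri (rhoPt L ζ β s) (rhoPt L ζ β (s + j + 1 - s)) (vert L ζ β k) y =
              ∑' w, rho L w * vert L ζ β k (w - y) * twoPt ζ β s w *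
                (rho L (y - w) * twoPt ζ β (j + 1) (y - w)) := by
            rw [tri, show s + j + 1 - s = j + 1 by omega]
            refine tsum_congr fun w => ?_
            unfold rhoPt
            ring
          rw [e', ← e]
          refine walkSum_mono _ fun l hl => ?_
          split_ifs with hy
          · calc rho L y * ewt β l * vert L ζ β k (listPos l s - y) ≤
                (rho L (listPos l s) * rho L (y - listPos l s)) *
                  (ENNReal.ofReal (pairProd (pairWt β l) 0 s) *
                    ENNReal.ofReal (pairProd (pairWt β l) s (s + (j + 1)))) *
                  vert L ζ β k (listPos l s - y) := by
                  gcongr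
                  · refine le_trans (le_of_eq ?_) (rho_add_le _ _ _)
                    rw [add_sub_cancel]
                  · rw [ewt, wt, hl]
                    exact ofReal_pairProd_le h0 h1 l (by omega)
              _ = _ := by ring
          · simp
  calc vert L ζ β n y = ∑ t ∈ Ioc 0 n, walkSum ζ n fun l => rho L (endpt l) *
      ((if y = listPos l t then ENNReal.ofReal β else 0) *
        ENNReal.ofReal (pairProd (pairWt β l) 0 t) * laceMaj (pairWt β l) 0 t n) := by
        rw [← walkSum_sum]
        refine walkSum_congr _ fun l hl => ?_
        subst hl
        rw [laceTail, Finset.mul_sum]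
    _ ≤ _ := Finset.sum_le_sum key
    _ ≤ _ := by
        rw [← Finset.mul_sum, Finset.sum_add_distrib, Finset.sum_sigma]
        gcongr
        rw [← Finset.sum_filter]
        rcases Nat.eq_zero_or_pos n with rfl | hn
        · simp
        rw [show (Ioc 0 n).filter (fun t => n - t = 0) = {n} by
          ext t
          simp only [mem_filter, mem_Ioc, mem_singleton]
          omega]
        simp

theorem good_vert {L : ℕ} {ζ : ℝ≥0∞} {β : ℝ} (h0 : 0 ≤ β) (h1 : β ≤ 1) {A : ℝ≥0∞} {N : ℕ}
    (hA : ∀ n < N, Good d (rhoPt (d := d) L ζ β n) A n)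
    (hβ : ENNReal.ofReal β * (triConst d * (A * A)) ≤ 2⁻¹) :
    ∀ n < N, Good d (vert (d := d) L ζ β n) (4 * ENNReal.ofReal β * A) n := by
  intro n
  induction n using Nat.strong_induction_on with
  | _ n ih =>
    intro hn
    have hT := good_sum_tri (d := d) (s := (Ioc 0 n).sigma fun t => range t)
      (p := fun i => i.2) (q := fun i => i.1 - i.2) (r := fun i => n - i.1) (l := n)
      (f := fun i => rhoPt (d := d) L ζ β i.2) (g := fun i => rhoPt L ζ β (i.1 - i.2))
      (h := fun i => vert L ζ β (n - i.1)) (A := A) (B := 4 * ENNReal.ofReal β * A)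
      (by
        rintro ⟨t, s⟩ h
        simp only [mem_sigma, mem_Ioc, mem_range] at h ⊢
        omega)
      (by
        rintro ⟨t, s⟩ h ⟨t', s'⟩ h' e e'
        simp only [mem_sigma, mem_Ioc, mem_range] at h h' e e'
        obtain rfl : t = t' := by omega
        obtain rfl : s = s' := by omega
        rfl)
      (by
        rintro ⟨t, s⟩ h
        simp only [mem_sigma, mem_Ioc, mem_range] at h
        exact hA _ (by dsimp only; omega))
      (by
        rintro ⟨t, s⟩ h
        simp only [mem_sigma, mem_Ioc, mem_range] at h
        exact hA _ (by dsimp only; omega))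
      (by
        rintro ⟨t, s⟩ h
        simp only [mem_sigma, mem_Ioc, mem_range] at h
        exact ih _ (by dsimp only; omega) (by dsimp only; omega))
    have hc : ENNReal.ofReal β * (2 * A + triConst d * (A * A * (4 * ENNReal.ofReal β * A))) ≤
        4 * ENNReal.ofReal β * A := calc
      _ = 2 * ENNReal.ofReal β * A + 4 * ENNReal.ofReal β * A *
          (ENNReal.ofReal β * (triConst d * (A * A))) := by ring
      _ ≤ 2 * ENNReal.ofReal β * A + 4 * ENNReal.ofReal β * A * 2⁻¹ := by gcongr
      _ = 2 * ENNReal.ofReal β * A + (2 * 2⁻¹) * (2 * ENNReal.ofReal β * A) := by ring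
      _ = _ := by
        rw [ENNReal.mul_inv_cancel (by norm_num) (by norm_num)]
        ring
    constructor
    · calc _ ≤ ∑' y, _ := ENNReal.tsum_le_tsum fun y => vert_le L ζ h0 h1 y
        _ ≤ ENNReal.ofReal β * (2 * A + triConst d * (A * A * (4 * ENNReal.ofReal β * A))) := by
          rw [ENNReal.tsum_mul_left, ENNReal.tsum_add, ENNReal.tsum_mul_left]
          gcongr
          · exact (hA n hn).1
          · exact hT.1
        _ ≤ _ := hc
    · intro y
      calc _ ≤ _ := vert_le L ζ h0 h1 y
        _ ≤ ENNReal.ofReal β * (2 * (A * edecay d n) +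
            triConst d * (A * A * (4 * ENNReal.ofReal β * A)) * edecay d n) := by
          gcongr
          · exact (hA n hn).2 y
          · exact hT.2 y
        _ = ENNReal.ofReal β * (2 * A + triConst d * (A * A * (4 * ENNReal.ofReal β * A))) *
            edecay d n := by ring
        _ ≤ _ := by gcongr

end Diagrams

end WSAW

namespace WSAW

open Finset Lace
open scoped ENNReal

section PiBound

variable {d : ℕ}

theorem loopProd_append_left (β : ℝ) (l l' : List (Fin d × Bool)) {t : ℕ} (ht : t ≤ l.length) :
    loopProd (pairWt β (l ++ l')) t = loopProd (pairWt β l) t := by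
  unfold loopProd
  rw [pairProd_append_left β l l' 1 ht]
  congr 1
  refine Finset.prod_congr rfl fun u hu => ?_
  have := mem_Ioo.1 hu
  exact pairWt_append_left β l l' (by omega) (by omega)

/-- The `rho`-weighted `ℓ¹` norm of the lace expansion coefficient of order `L`. -/
noncomputable def laceNorm (d L : ℕ) (ζ : ℝ≥0∞) (β : ℝ) : ℝ≥0∞ :=
  walkSum ζ L fun l : List (Fin d × Bool) =>
    rho L (endpt l) * ‖laceSum (pairWt β l) 0 1 L‖ₑ

theorem walkSum_loopProd_le {L : ℕ} {ζ : ℝ≥0∞} {β : ℝ} (h0 : 0 ≤ β) (h1 : β ≤ 1) {s j : ℕ}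
    (hs : 1 ≤ s) (hj : 1 ≤ j) (h : (Fin d → ℤ) → ℝ≥0∞) :
    (walkSum ζ (s + j) fun l : List (Fin d × Bool) => if endpt l = 0 then
      ENNReal.ofReal (loopProd (pairWt β l) (s + j)) * h (listPos l s) else 0) ≤
      tri (rhoPt L ζ β s) (rhoPt L ζ β j) h 0 := by
  have e := walkSum_split ζ β s j (0 : Fin d → ℤ) h fun _ => 1
  calc _ ≤ _ := by
        refine walkSum_mono ζ fun l hl => ?_
        split_ifs with hy
        · have hne : l ≠ [] := by
            rintro rfl
            simp at hl
            omega
          calc _ ≤ (ENNReal.ofReal (pairProd (pairWt β l) 0 s) *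
                ENNReal.ofReal (pairProd (pairWt β l) s (s + j))) * h (listPos l s) := by
                gcongr
                exact ofReal_loopProd_le h0 h1 hne hs (by omega)
            _ = h (listPos l s) * ENNReal.ofReal (pairProd (pairWt β l) 0 s) *
                (1 * ENNReal.ofReal (pairProd (pairWt β l) s (s + j))) := by ring
        · exact zero_le
    _ = _ := e
    _ ≤ _ := by
        refine ENNReal.tsum_le_tsum fun w => ?_
        calc _ = (1 * twoPt ζ β s w) * (1 * twoPt ζ β j (0 - w)) * h w := by ring
          _ ≤ _ := by
            rw [sub_zero]
            unfold rhoPt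
            gcongr
            · exact one_le_rho _ _
            · exact one_le_rho _ _

theorem laceNorm_le_sum {L : ℕ} (hL : 2 ≤ L) (ζ : ℝ≥0∞) {β : ℝ} (h0 : 0 ≤ β) (h1 : β ≤ 1) :
    laceNorm d L ζ β ≤ ENNReal.ofReal β *
      (2 * tri (rhoPt (d := d) L ζ β 1) (rhoPt L ζ β (L - 1)) 1 0 +
      ∑ i ∈ (Ioc 1 L).sigma fun t => Ico 1 t,
        tri (rhoPt (d := d) L ζ β i.2) (rhoPt L ζ β (i.1 - i.2)) (vert L ζ β (L - i.1)) 0) := by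
  have key : ∀ t ∈ Ioc 1 L, (walkSum ζ L fun l : List (Fin d × Bool) => rho L (endpt l) *
      (ENNReal.ofReal (1 - pairWt β l 0 t) * ENNReal.ofReal (loopProd (pairWt β l) t) *
        laceMaj (pairWt β l) 1 t L)) ≤
      ENNReal.ofReal β * ((if L - t = 0 then
        2 * tri (rhoPt (d := d) L ζ β 1) (rhoPt L ζ β (L - 1)) 1 0 else 0) + ∑ s ∈ Ico 1 t,
        tri (rhoPt (d := d) L ζ β s) (rhoPt L ζ β (t - s)) (vert L ζ β (L - t)) 0) := by
    intro t ht
    obtain ⟨ht0, htn⟩ := mem_Ioc.1 ht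
    obtain ⟨k, hk⟩ := Nat.exists_eq_add_of_le htn
    have hLt : L - t = k := by omega
    rw [hLt]
    calc _ = walkSum ζ (t + k) fun l : List (Fin d × Bool) => rho L (endpt l) *
          (ENNReal.ofReal (1 - pairWt β l 0 t) * ENNReal.ofReal (loopProd (pairWt β l) t) *
            laceMaj (pairWt β l) 1 t (t + k)) := by rw [← hk]
      _ = walkSum ζ t fun l : List (Fin d × Bool) => ENNReal.ofReal β *
          ((if endpt l = 0 then ENNReal.ofReal (loopProd (pairWt β l) t) else 0) *
            ((if k = 0 then 2 else 0) + ∑ s ∈ Ico 1 t, vert L ζ β k (listPos l s))) := by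
          rw [walkSum_add_length]
          refine walkSum_congr ζ fun l hl => ?_
          subst hl
          by_cases hy : endpt l = 0
          · rw [if_pos hy]
            have e := walkSum_rho_laceMaj L ζ β l 1 k
            simp only [hy, sub_zero] at e
            rw [← e, ← walkSum_mul_left, ← walkSum_mul_left]
            refine walkSum_congr ζ fun l' hl' => ?_
            rw [loopProd_append_left _ _ _ le_rfl, endpt_append, hy, zero_add,
              ofReal_one_sub_pairWt, listPos_append_left _ _ le_rfl, listPos_length, listPos_zero,
              if_pos hy.symm]
            ring
          · rw [walkSum_congr (G := fun _ => 0)]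
            · simp [walkSum, hy]
            · intro l' hl'
              rw [ofReal_one_sub_pairWt, listPos_append_left _ _ le_rfl, listPos_length,
                listPos_zero, if_neg (fun h => hy h.symm)]
              simp
      _ = ENNReal.ofReal β * ((walkSum ζ t fun l : List (Fin d × Bool) =>
            if endpt l = 0 then ENNReal.ofReal (loopProd (pairWt β l) t) else 0) *
            (if k = 0 then 2 else 0) +
          ∑ s ∈ Ico 1 t, walkSum ζ t fun l : List (Fin d × Bool) => if endpt l = 0 then
            ENNReal.ofReal (loopProd (pairWt β l) t) * vert L ζ β k (listPos l s) else 0) := by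
          rw [walkSum_mul_left]
          simp only [mul_add]
          rw [walkSum_add, walkSum_mul_right, ← walkSum_sum]
          have e1 : ∀ l : List (Fin d × Bool),
              (if endpt l = 0 then ENNReal.ofReal (loopProd (pairWt β l) t) else 0) *
                ∑ s ∈ Ico 1 t, vert L ζ β k (listPos l s) = ∑ s ∈ Ico 1 t, if endpt l = 0 then
                ENNReal.ofReal (loopProd (pairWt β l) t) * vert L ζ β k (listPos l s) else 0 :=
            fun l => by
              rw [Finset.mul_sum]
              refine Finset.sum_congr rfl fun s _ => ?_
              split_ifs <;> simp
          simp only [e1]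
          rw [mul_add]
      _ ≤ _ := by
          gcongr with s hs
          · rcases eq_or_ne k 0 with rfl | hk'
            · obtain rfl : L = t := by omega
              rw [if_pos rfl, if_pos rfl, mul_comm]
              gcongr
              have := walkSum_loopProd_le (d := d) (L := L) (ζ := ζ) h0 h1 le_rfl
                (show 1 ≤ L - 1 by omega) 1
              rw [show 1 + (L - 1) = L by omega] at this
              simpa using this
            · simp [hk']
          · have := mem_Ico.1 hs
            have := walkSum_loopProd_le (d := d) (L := L) (ζ := ζ) h0 h1 this.1
                (show 1 ≤ t - s by omega) (vert L ζ β k)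
            rwa [show s + (t - s) = t by omega] at this
  calc laceNorm d L ζ β ≤ ∑ t ∈ Ioc 1 L, walkSum ζ L fun l : List (Fin d × Bool) =>
      rho L (endpt l) * (ENNReal.ofReal (1 - pairWt β l 0 t) *
        ENNReal.ofReal (loopProd (pairWt β l) t) * laceMaj (pairWt β l) 1 t L) := by
        rw [← walkSum_sum]
        refine walkSum_mono _ fun l hl => ?_
        rw [← Finset.mul_sum]
        gcongr
        exact enorm_laceSum_zero_one_le (pairWt_nonneg h1 l) (pairWt_le_one h0 l) hL
    _ ≤ _ := Finset.sum_le_sum key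
    _ ≤ _ := by
        rw [← Finset.mul_sum, Finset.sum_add_distrib, Finset.sum_sigma]
        gcongr
        rw [← Finset.sum_filter]
        rw [show (Ioc 1 L).filter (fun t => L - t = 0) = {L} by
          ext t
          simp only [mem_filter, mem_Ioc, mem_singleton]
          omega]
        simp

theorem laceNorm_le {L : ℕ} (hL : 2 ≤ L) {ζ : ℝ≥0∞} {β : ℝ} (h0 : 0 ≤ β) (h1 : β ≤ 1)
    {A : ℝ≥0∞} (hA : ∀ n < L, Good d (rhoPt (d := d) L ζ β n) A n)
    (hβ : ENNReal.ofReal β * (triConst d * (A * A)) ≤ 2⁻¹) :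
    laceNorm d L ζ β ≤ ENNReal.ofReal β * (2 * (A * A * dbl d 2) + 2 * A) * edecay d L := by
  have hV := good_vert h0 h1 hA hβ
  have hT := good_sum_tri (d := d) (s := (Ioc 1 L).sigma fun t => Ico 1 t)
      (p := fun i => i.2) (q := fun i => i.1 - i.2) (r := fun i => L - i.1) (l := L)
      (f := fun i => rhoPt (d := d) L ζ β i.2) (g := fun i => rhoPt L ζ β (i.1 - i.2))
      (h := fun i => vert L ζ β (L - i.1)) (A := A) (B := 4 * ENNReal.ofReal β * A)
      (by
        rintro ⟨t, s⟩ h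
        simp only [mem_sigma, mem_Ioc, mem_Ico] at h ⊢
        omega)
      (by
        rintro ⟨t, s⟩ h ⟨t', s'⟩ h' e e'
        simp only [mem_sigma, mem_Ioc, mem_Ico] at h h' e e'
        obtain rfl : t = t' := by omega
        obtain rfl : s = s' := by omega
        rfl)
      (by
        rintro ⟨t, s⟩ h
        simp only [mem_sigma, mem_Ioc, mem_Ico] at h
        exact hA _ (by dsimp only; omega))
      (by
        rintro ⟨t, s⟩ h
        simp only [mem_sigma, mem_Ioc, mem_Ico] at h
        exact hA _ (by dsimp only; omega))
      (by
        rintro ⟨t, s⟩ h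
        simp only [mem_sigma, mem_Ioc, mem_Ico] at h
        exact hV _ (by dsimp only; omega))
  have h2 : tri (rhoPt (d := d) L ζ β 1) (rhoPt L ζ β (L - 1)) 1 0 ≤
      A * A * (dbl d 2 * edecay d L) := by
    unfold tri
    simp only [Pi.one_apply, mul_one]
    calc _ ≤ ∑' w, rhoPt (d := d) L ζ β 1 w * (A * edecay d (L - 1)) :=
          ENNReal.tsum_le_tsum fun w => by gcongr; exact (hA _ (by omega)).2 _
      _ ≤ A * (A * edecay d (L - 1)) := by
          rw [ENNReal.tsum_mul_right]
          gcongr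
          exact (hA _ (by omega)).1
      _ ≤ A * (A * (dbl d 2 * edecay d L)) := by
          gcongr
          exact edecay_le_of_le (by omega)
      _ = _ := by ring
  calc _ ≤ _ := laceNorm_le_sum hL ζ h0 h1
    _ ≤ ENNReal.ofReal β * (2 * (A * A * (dbl d 2 * edecay d L)) +
        triConst d * (A * A * (4 * ENNReal.ofReal β * A)) * edecay d L) := by
        gcongr
        exact hT.2 0
    _ = ENNReal.ofReal β * (2 * (A * A * dbl d 2) +
        4 * A * (ENNReal.ofReal β * (triConst d * (A * A)))) * edecay d L := by ring
    _ ≤ ENNReal.ofReal β * (2 * (A * A * dbl d 2) + 4 * A * 2⁻¹) * edecay d L := by gcongr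
    _ = ENNReal.ofReal β * (2 * (A * A * dbl d 2) + 2 * A * (2 * 2⁻¹)) * edecay d L := by ring
    _ = _ := by rw [ENNReal.mul_inv_cancel (by norm_num) (by norm_num), mul_one]

/-- The diffusive bounds on `n`-step walks: total mass, sup norm of the two-point function and
mean-square displacement. -/
def Diffusive (d : ℕ) (ζ : ℝ≥0∞) (β : ℝ) (K : ℝ≥0∞) (n : ℕ) : Prop :=
  walkSum ζ n (ewt (d := d) β) ≤ K ∧ (∀ x : Fin d → ℤ, twoPt ζ β n x ≤ K * edecay d n) ∧
    (walkSum ζ n fun l : List (Fin d × Bool) => esqLen (endpt l) * ewt β l) ≤ K * (n + 1)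

theorem tsum_mul_twoPt (ζ : ℝ≥0∞) (β : ℝ) (n : ℕ) (φ : (Fin d → ℤ) → ℝ≥0∞) :
    ∑' x, φ x * twoPt ζ β n x = walkSum ζ n fun l => φ (endpt l) * ewt β l := by
  unfold twoPt
  simp only [← walkSum_mul_left]
  rw [tsum_walkSum]
  refine walkSum_congr ζ fun l _ => ?_
  rw [tsum_eq_single (endpt l)]
  · simp
  · intro x hx
    rw [if_neg hx.symm, mul_zero]

theorem twoPt_split_le {ζ : ℝ≥0∞} {β : ℝ} (h0 : 0 ≤ β) (h1 : β ≤ 1) (s k : ℕ) (y : Fin d → ℤ) :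
    esqLen y * twoPt ζ β (s + k) y ≤
      2 * ∑' w, (esqLen w * twoPt ζ β s w) * twoPt ζ β k (y - w) +
        2 * ∑' w, twoPt ζ β s w * (esqLen (y - w) * twoPt ζ β k (y - w)) := by
  have e1 := walkSum_split ζ β s k y esqLen fun _ => 1
  have e2 := walkSum_split ζ β s k y (fun _ => 1) esqLen
  simp only [one_mul] at e1 e2
  rw [← e1, ← e2, twoPt, ← walkSum_mul_left, ← walkSum_mul_left, ← walkSum_mul_left, ← walkSum_add]
  refine walkSum_mono ζ fun l hl => ?_
  split_ifs with hy
  · have h3 := esqLen_add_le (listPos l s) (y - listPos l s)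
    rw [add_sub_cancel] at h3
    calc _ ≤ (2 * esqLen (listPos l s) + 2 * esqLen (y - listPos l s)) *
          (ENNReal.ofReal (pairProd (pairWt β l) 0 s) *
            ENNReal.ofReal (pairProd (pairWt β l) s (s + k))) := by
          gcongr
          rw [ewt, wt, hl]
          exact ofReal_pairProd_le h0 h1 l (by omega)
      _ = _ := by ring
  · simp

theorem good_rhoPt {L : ℕ} {ζ : ℝ≥0∞} {β : ℝ} (h0 : 0 ≤ β) (h1 : β ≤ 1) {K : ℝ≥0∞}
    (hK : ∀ n < L, Diffusive d ζ β K n) (n : ℕ) (hn : n < L) :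
    Good d (rhoPt (d := d) L ζ β n) (4 * K + 8 * dbl d 3 * K ^ 2) n := by
  have hr : ((n : ℝ≥0∞) + 1) * ((L : ℝ≥0∞) + 1)⁻¹ ≤ 1 := by
    rw [← div_eq_mul_inv]
    refine ENNReal.div_le_of_le_mul ?_
    rw [one_mul]
    gcongr
  constructor
  · unfold rhoPt
    rw [tsum_mul_twoPt]
    obtain ⟨ha, -, hc⟩ := hK n hn
    calc _ = 2 * walkSum ζ n (ewt (d := d) β) +
          2 * (walkSum ζ n fun l : List (Fin d × Bool) => esqLen (endpt l) * ewt β l) *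
            ((L : ℝ≥0∞) + 1)⁻¹ := by
          rw [← walkSum_mul_left, ← walkSum_mul_left, ← walkSum_mul_right, ← walkSum_add]
          refine walkSum_congr ζ fun l _ => ?_
          unfold rho
          ring
      _ ≤ 2 * K + 2 * (K * (n + 1)) * ((L : ℝ≥0∞) + 1)⁻¹ := by gcongr
      _ = 2 * K + 2 * K * ((n + 1) * ((L : ℝ≥0∞) + 1)⁻¹) := by ring
      _ ≤ 2 * K + 2 * K * 1 := by gcongr
      _ = 4 * K := by ring
      _ ≤ _ := le_self_add
  · intro x
    have hsq : esqLen x * twoPt ζ β n x ≤ 4 * dbl d 3 * K ^ 2 * edecay d n * (n + 1) := by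
      obtain ⟨s, k, rfl, hs, hk⟩ : ∃ s k, s + k = n ∧ n + 1 ≤ 3 * (s + 1) ∧ n + 1 ≤ 3 * (k + 1) :=
        ⟨n / 2, n - n / 2, by omega, by omega, by omega⟩
      have hS := hK s (by omega)
      have hk' := hK k (by omega)
      calc _ ≤ _ := twoPt_split_le h0 h1 s k x
        _ ≤ 2 * ∑' w, (esqLen w * twoPt ζ β s w) * (K * (dbl d 3 * edecay d (s + k))) +
            2 * ∑' w, (K * (dbl d 3 * edecay d (s + k))) *
              (esqLen (x - w) * twoPt ζ β k (x - w)) := by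
            gcongr with w w
            · exact (hk'.2.1 _).trans (by gcongr; exact edecay_le_of_le hk)
            · exact (hS.2.1 _).trans (by gcongr; exact edecay_le_of_le hs)
        _ = 2 * ((walkSum ζ s fun l : List (Fin d × Bool) => esqLen (endpt l) * ewt β l) *
              (K * (dbl d 3 * edecay d (s + k)))) +
            2 * ((K * (dbl d 3 * edecay d (s + k))) *
              walkSum ζ k fun l : List (Fin d × Bool) => esqLen (endpt l) * ewt β l) := by
            rw [ENNReal.tsum_mul_right, ENNReal.tsum_mul_left, tsum_mul_twoPt,
              ← tsum_mul_twoPt ζ β k, ← (Equiv.subLeft x).tsum_eq fun u => esqLen u * twoPt ζ β k u]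
            rfl
        _ ≤ 2 * ((K * (s + 1)) * (K * (dbl d 3 * edecay d (s + k)))) +
            2 * ((K * (dbl d 3 * edecay d (s + k))) * (K * (k + 1))) := by
            gcongr
            · exact hS.2.2
            · exact hk'.2.2
        _ = 2 * dbl d 3 * K ^ 2 * edecay d (s + k) * ((s + 1) + (k + 1)) := by ring
        _ ≤ 2 * dbl d 3 * K ^ 2 * edecay d (s + k) * (2 * ((s + k : ℕ) + 1)) := by
            gcongr
            push_cast
            calc (s : ℝ≥0∞) + 1 + (k + 1) ≤ s + 1 + (k + 1) + (s + k) := le_self_add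
              _ = _ := by ring
        _ = _ := by ring
    calc _ = 2 * twoPt ζ β n x + 2 * (esqLen x * twoPt ζ β n x) * ((L : ℝ≥0∞) + 1)⁻¹ := by
          unfold rhoPt rho
          ring
      _ ≤ 2 * (K * edecay d n) + 2 * (4 * dbl d 3 * K ^ 2 * edecay d n * (n + 1)) *
          ((L : ℝ≥0∞) + 1)⁻¹ := by
          gcongr
          exact (hK n hn).2.1 x
      _ = 2 * (K * edecay d n) + 8 * dbl d 3 * K ^ 2 * edecay d n *
          ((n + 1) * ((L : ℝ≥0∞) + 1)⁻¹) := by ring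
      _ ≤ 4 * (K * edecay d n) + 8 * dbl d 3 * K ^ 2 * edecay d n * 1 := by
          gcongr
          norm_num
      _ = _ := by ring

end PiBound

end WSAW

namespace WSAW

open Finset

section Scalar

theorem sum_conv_le {u v : ℕ → ℝ} (hu0 : ∀ j, 0 ≤ u j) (hv0 : ∀ j, 0 ≤ v j) {κ U V : ℝ} {n : ℕ}
    (hκ : 0 ≤ κ) (hu : ∀ j ≤ n, n + 1 ≤ 2 * (j + 1) → u j ≤ κ * u n)
    (hv : ∀ j ≤ n, n + 1 ≤ 2 * (j + 1) → v j ≤ κ * v n)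
    (hU : ∑ j ∈ range (n + 1), u j ≤ U) (hV : ∑ j ∈ range (n + 1), v j ≤ V) :
    ∑ j ∈ range (n + 1), u j * v (n - j) ≤ κ * (u n * V + v n * U) := by
  have h1 : ∀ j ∈ range (n + 1), u j * v (n - j) ≤ κ * u n * v (n - j) + κ * v n * u j := by
    intro j hj
    have hj : j ≤ n := Nat.lt_succ_iff.1 (mem_range.1 hj)
    have h3 : 0 ≤ κ * u n * v (n - j) := mul_nonneg (mul_nonneg hκ (hu0 _)) (hv0 _)
    have h4 : 0 ≤ κ * v n * u j := mul_nonneg (mul_nonneg hκ (hv0 _)) (hu0 _)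
    rcases le_total n (2 * j) with h | h
    · have := mul_le_mul_of_nonneg_right (hu j hj (by omega)) (hv0 (n - j))
      linarith
    · have := mul_le_mul_of_nonneg_left (hv (n - j) (by omega) (by omega)) (hu0 j)
      linarith
  have h2 : ∑ j ∈ range (n + 1), v (n - j) = ∑ j ∈ range (n + 1), v j := by
    have := Finset.sum_range_reflect v (n + 1)
    simpa using this
  calc _ ≤ ∑ j ∈ range (n + 1), (κ * u n * v (n - j) + κ * v n * u j) := Finset.sum_le_sum h1
    _ = κ * u n * ∑ j ∈ range (n + 1), v j + κ * v n * ∑ j ∈ range (n + 1), u j := by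
      rw [Finset.sum_add_distrib, ← Finset.mul_sum, ← Finset.mul_sum, h2]
    _ ≤ κ * u n * V + κ * v n * U := by
      have := mul_nonneg hκ (hu0 n)
      have := mul_nonneg hκ (hv0 n)
      gcongr
    _ = _ := by ring

theorem sum_range_sq_inv_le {a : ℝ} (ha0 : 0 ≤ a) (ha1 : a ≤ 1) (n : ℕ) :
    ∑ k ∈ range n, (1 / (1 + k * a) ^ 2) ≤ 2 * n / (1 + n * a) := by
  induction n with
  | zero => simp
  | succ n ih =>
    rw [Finset.sum_range_succ]
    have h : (1 : ℝ) / (1 + n * a) ^ 2 ≤ 2 * (n + 1 : ℕ) / (1 + (n + 1 : ℕ) * a) -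
        2 * n / (1 + n * a) := by
      have hp : 0 ≤ n * a := by positivity
      push_cast
      rw [div_sub_div _ _ (by positivity) (by positivity), div_le_div_iff₀ (by positivity)
        (by positivity)]
      have : 0 ≤ (1 + n * a) * ((1 + n * a) + (1 + n * a) - (1 + (n + 1) * a)) := by
        apply mul_nonneg (by positivity)
        linarith
      nlinarith
    linarith

/-- A doubling estimate for `1 + j a`. -/
theorem one_add_mul_le_two_mul {a : ℝ} (ha0 : 0 ≤ a) {n j : ℕ} (h : n + 1 ≤ 2 * (j + 1))
    (ha1 : a ≤ 1) : 1 + n * a ≤ 2 * (1 + j * a) := by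
  have : (n : ℝ) + 1 ≤ 2 * (j + 1) := by exact_mod_cast h
  nlinarith

/-- The heat-kernel factor `(1 + j a) ^ (-d)`. -/
noncomputable def heat (d : ℕ) (a : ℝ) (j : ℕ) : ℝ := 1 / (1 + j * a) ^ d

theorem heat_nonneg (d : ℕ) {a : ℝ} (ha0 : 0 ≤ a) (j : ℕ) : 0 ≤ heat d a j := by
  unfold heat; positivity

theorem heat_doubling (d : ℕ) {a : ℝ} (ha0 : 0 ≤ a) (ha1 : a ≤ 1) {n j : ℕ}
    (h : n + 1 ≤ 2 * (j + 1)) : heat d a j ≤ 2 ^ d * heat d a n := by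
  unfold heat
  have h1 := one_add_mul_le_two_mul ha0 h ha1
  have h2 : (1 + n * a) ^ d ≤ 2 ^ d * (1 + j * a) ^ d := by
    rw [← mul_pow]
    gcongr
  rw [mul_one_div, div_le_div_iff₀ (by positivity) (by positivity), one_mul]
  exact h2

theorem sum_heat_le {d : ℕ} (hd : 2 ≤ d) {a : ℝ} (ha0 : 0 ≤ a) (ha1 : a ≤ 1) (n : ℕ) :
    ∑ j ∈ range (n + 1), heat d a j ≤ 2 * (n + 1) / (1 + n * a) := by
  calc _ ≤ ∑ k ∈ range (n + 1), (1 / (1 + k * a) ^ 2) := by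
        refine Finset.sum_le_sum fun k _ => ?_
        unfold heat
        gcongr
        have : 0 ≤ k * a := by positivity
        linarith
    _ ≤ 2 * (n + 1 : ℕ) / (1 + (n + 1 : ℕ) * a) := sum_range_sq_inv_le ha0 ha1 _
    _ ≤ _ := by
        push_cast
        gcongr
        linarith

theorem mul_sum_heat_le {a : ℝ} (ha0 : 0 ≤ a) (ha1 : a ≤ 1) (n : ℕ) :
    a * (2 * (n + 1) / (1 + n * a)) ≤ 2 := by
  rw [← mul_div_assoc, div_le_iff₀ (by positivity)]
  nlinarith

/-- The constant in `one_sub_pow_le_heat`. -/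
noncomputable def heatConst (d : ℕ) : ℝ := Real.exp 1 * d.factorial

theorem one_le_heatConst (d : ℕ) : 1 ≤ heatConst d := by
  have h1 : (1 : ℝ) ≤ Real.exp 1 := Real.one_le_exp (by norm_num)
  have h2 : (1 : ℝ) ≤ d.factorial := by exact_mod_cast Nat.factorial_pos d
  exact one_le_mul_of_one_le_of_one_le h1 h2

theorem one_sub_pow_le_heat (d : ℕ) {a : ℝ} (ha0 : 0 ≤ a) (ha1 : a ≤ 1) (k : ℕ) :
    (1 - a) ^ k ≤ heatConst d * heat d a k := by
  unfold heat heatConst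
  rw [mul_one_div, le_div_iff₀ (by positivity)]
  have h1 : (1 - a) ^ k ≤ Real.exp (-(k * a)) := by
    calc (1 - a) ^ k ≤ Real.exp (-a) ^ k := by
          have := Real.add_one_le_exp (-a)
          exact pow_le_pow_left₀ (by linarith) (by linarith) k
      _ = _ := by rw [← Real.exp_nat_mul]; congr 1; ring
  have h2 : (1 + k * a) ^ d ≤ d.factorial * Real.exp (1 + k * a) := by
    have := Real.pow_div_factorial_le_exp (1 + k * a) (by positivity) d
    rwa [div_le_iff₀ (by positivity), mul_comm (Real.exp _)] at this
  calc _ ≤ Real.exp (-(k * a)) * (d.factorial * Real.exp (1 + k * a)) := by gcongr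
    _ = (Real.exp (-(k * a)) * Real.exp (1 + k * a)) * d.factorial := by ring
    _ = _ := by rw [← Real.exp_add]; congr 2; ring

theorem summable_mul_decay {d : ℕ} (hd : 4 < d) :
    Summable fun j : ℕ => ((j : ℝ) + 1) * decay d j := by
  have h : ∀ j : ℕ, ((j : ℝ) + 1) * decay d j = ((j + 1 : ℕ) : ℝ) ^ (1 - (d : ℝ) / 2) := by
    intro j
    unfold decay
    have : (0 : ℝ) < (j : ℝ) + 1 := by positivity
    push_cast
    rw [sub_eq_add_neg, Real.rpow_add this, Real.rpow_one]
  simp_rw [h]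
  refine (summable_nat_add_iff 1 (f := fun j : ℕ => (j : ℝ) ^ (1 - (d : ℝ) / 2))).2 ?_
  rw [Real.summable_nat_rpow]
  have : (4 : ℝ) + 1 ≤ d := by exact_mod_cast hd
  linarith

/-- The sum of `(j + 1) ^ (1 - d / 2)`. -/
noncomputable def momSum (d : ℕ) : ℝ := ∑' j : ℕ, ((j : ℝ) + 1) * decay d j

theorem sum_mul_decay_le {d : ℕ} (hd : 4 < d) (s : Finset ℕ) :
    ∑ j ∈ s, ((j : ℝ) + 1) * decay d j ≤ momSum d :=
  (summable_mul_decay hd).sum_le_tsum _ fun j _ => mul_nonneg (by positivity) (decay_pos d j).le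

theorem momSum_nonneg (d : ℕ) : 0 ≤ momSum d :=
  tsum_nonneg fun j => mul_nonneg (by positivity) (decay_pos d j).le

theorem decay_doubling (d : ℕ) {n j : ℕ} (h : n + 1 ≤ 2 * (j + 1)) :
    decay d j ≤ 2 ^ d * decay d n := by
  refine (decay_le_of_le (d := d) (c := 2) h).trans ?_
  have := (decay_pos d n).le
  gcongr
  rw [← Real.rpow_natCast]
  push_cast
  exact Real.rpow_le_rpow_of_exponent_le (by norm_num) (by
    have : (0 : ℝ) ≤ d := by positivity
    linarith)

/-- The weight that dominates the increments of the renewal sequence. -/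
noncomputable def incWt (d : ℕ) (a : ℝ) (j : ℕ) : ℝ :=
  a * heat d a j + (j + 1) * decay d j / (1 + j * a)

theorem incWt_nonneg (d : ℕ) {a : ℝ} (ha0 : 0 ≤ a) (j : ℕ) : 0 ≤ incWt d a j := by
  have := heat_nonneg d ha0 j
  have := (decay_pos d j).le
  unfold incWt; positivity

theorem incWt_doubling (d : ℕ) {a : ℝ} (ha0 : 0 ≤ a) (ha1 : a ≤ 1) {n j : ℕ} (hj : j ≤ n)
    (h : n + 1 ≤ 2 * (j + 1)) : incWt d a j ≤ 2 ^ (d + 1) * incWt d a n := by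
  have h1 := heat_doubling d ha0 ha1 h
  have h2 := decay_doubling d h
  have h3 := one_add_mul_le_two_mul ha0 h ha1
  have h4 := heat_nonneg d ha0 n
  have h5 := decay_pos d n
  have h6 := decay_pos d j
  have hjn : (j : ℝ) ≤ n := by exact_mod_cast hj
  unfold incWt
  rw [mul_add]
  gcongr ?_ + ?_
  · calc _ ≤ a * (2 ^ d * heat d a n) := by gcongr
      _ ≤ a * (2 ^ (d + 1) * heat d a n) := by gcongr <;> norm_num
      _ = _ := by ring
  · rw [← mul_div_assoc, div_le_div_iff₀ (by positivity) (by positivity)]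
    calc _ ≤ (n + 1) * (2 ^ d * decay d n) * (2 * (1 + j * a)) := by gcongr
      _ = _ := by ring

theorem sum_incWt_le {d : ℕ} (hd : 4 < d) {a : ℝ} (ha0 : 0 ≤ a) (ha1 : a ≤ 1) (n : ℕ) :
    ∑ j ∈ range (n + 1), incWt d a j ≤ 2 + momSum d := by
  unfold incWt
  rw [Finset.sum_add_distrib, ← Finset.mul_sum]
  gcongr ?_ + ?_
  · exact (mul_le_mul_of_nonneg_left (sum_heat_le (by omega) ha0 ha1 n) ha0).trans
      (mul_sum_heat_le ha0 ha1 n)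
  · refine (Finset.sum_le_sum fun j _ => ?_).trans (sum_mul_decay_le hd (range (n + 1)))
    refine div_le_self (mul_nonneg (by positivity) (decay_pos d j).le) ?_
    have : 0 ≤ j * a := by positivity
    linarith

/-- A renewal sequence `f` whose kernel is a small perturbation of the kernel with a single
atom of mass `D = 1 - a` at time `1`. -/
structure Renewal (d N : ℕ) (q δ a : ℝ) (p p0 f : ℕ → ℂ) : Prop where
  a_nonneg : 0 ≤ a
  a_le_one : a ≤ 1
  delta_nonneg : 0 ≤ δ
  zero : f 0 = 1
  renewal : ∀ n < N, f (n + 1) = q * (1 - a : ℝ) * f n +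
    ∑ m ∈ Icc 2 (n + 1), p m * f (n + 1 - m)
  norm_p0_le : ∀ m, 2 ≤ m → m ≤ N → ‖p0 m‖ ≤ δ * decay d m
  norm_sub_le : ∀ m, 2 ≤ m → m ≤ N → ‖p m - p0 m‖ ≤ δ * (min ((m + 1) * a) 1 * decay d m)
  norm_tail_le : ∀ n ≤ N, ‖1 - q - ∑ m ∈ Icc 2 n, p0 m‖ ≤ δ * ((n + 1) * decay d n)

/-- The increments `f n - D f (n - 1)` of a renewal sequence. -/
def incr (D : ℂ) (f : ℕ → ℂ) : ℕ → ℂ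
  | 0 => f 0
  | n + 1 => f (n + 1) - D * f n

theorem eq_sum_incr (D : ℂ) (f : ℕ → ℂ) (n : ℕ) :
    f n = ∑ j ∈ range (n + 1), D ^ (n - j) * incr D f j := by
  induction n with
  | zero => simp [incr]
  | succ n ih =>
    rw [Finset.sum_range_succ, Nat.sub_self, pow_zero, one_mul, incr]
    have : ∑ j ∈ range (n + 1), D ^ (n + 1 - j) * incr D f j = D * f n := by
      rw [ih, Finset.mul_sum]
      refine Finset.sum_congr rfl fun j hj => ?_
      rw [Nat.succ_sub (Nat.lt_succ_iff.1 (mem_range.1 hj)), pow_succ]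
      ring
    rw [this]
    ring

namespace Renewal

variable {d N : ℕ} {q δ a : ℝ} {p p0 f : ℕ → ℂ}

/-- The kernel of the renewal equation satisfied by the increments. -/
noncomputable def kern (q a : ℝ) (p : ℕ → ℂ) (n : ℕ) : ℂ :=
  ∑ m ∈ Icc 2 n, p m * ((1 - a : ℝ) : ℂ) ^ (n - m) + (q - 1) * ((1 - a : ℝ) : ℂ) ^ n

theorem incr_eq (h : Renewal d N q δ a p p0 f) {n : ℕ} (hn : n < N) :
    incr (1 - a : ℝ) f (n + 1) =
      ∑ j ∈ range (n + 1), incr (1 - a : ℝ) f j * kern q a p (n + 1 - j) := by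
  set D : ℂ := ((1 - a : ℝ) : ℂ)
  rw [incr, h.renewal n hn]
  have h1 : ∑ m ∈ Icc 2 (n + 1), p m * f (n + 1 - m) = ∑ j ∈ range (n + 1),
      incr D f j * ∑ m ∈ Icc 2 (n + 1 - j), p m * D ^ (n + 1 - j - m) := by
    simp_rw [Finset.mul_sum]
    have h2 : ∀ m ∈ Icc 2 (n + 1), p m * f (n + 1 - m) = ∑ j ∈ range (n + 1 - m + 1),
        incr D f j * (p m * D ^ (n + 1 - j - m)) := by
      intro m hm
      rw [eq_sum_incr D f (n + 1 - m), Finset.mul_sum]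
      refine Finset.sum_congr rfl fun j hj => ?_
      rw [Nat.sub_right_comm]
      ring
    rw [Finset.sum_congr rfl h2]
    refine Finset.sum_comm' fun m j => ?_
    simp only [mem_Icc, mem_range]
    omega
  have h3 : (q - 1) * D * f n = ∑ j ∈ range (n + 1), incr D f j * ((q - 1) * D ^ (n + 1 - j)) := by
    rw [eq_sum_incr D f n, Finset.mul_sum]
    refine Finset.sum_congr rfl fun j hj => ?_
    rw [Nat.succ_sub (Nat.lt_succ_iff.1 (mem_range.1 hj)), pow_succ]
    ring
  calc _ = (q - 1) * D * f n + ∑ m ∈ Icc 2 (n + 1), p m * f (n + 1 - m) := by ring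
    _ = _ := by
      rw [h1, h3, ← Finset.sum_add_distrib]
      refine Finset.sum_congr rfl fun j _ => ?_
      rw [kern]
      ring

theorem kern_eq (n : ℕ) : kern q a p n =
    ∑ m ∈ Icc 2 n, (p m - p0 m) * ((1 - a : ℝ) : ℂ) ^ (n - m) +
    ∑ m ∈ Icc 2 n, p0 m * (((1 - a : ℝ) : ℂ) ^ (n - m) * (1 - ((1 - a : ℝ) : ℂ) ^ m)) -
    (1 - q - ∑ m ∈ Icc 2 n, p0 m) * ((1 - a : ℝ) : ℂ) ^ n := by
  set D : ℂ := ((1 - a : ℝ) : ℂ)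
  have : ∑ m ∈ Icc 2 n, p0 m * (D ^ (n - m) * (1 - D ^ m)) =
      ∑ m ∈ Icc 2 n, p0 m * D ^ (n - m) - (∑ m ∈ Icc 2 n, p0 m) * D ^ n := by
    rw [Finset.sum_mul, ← Finset.sum_sub_distrib]
    refine Finset.sum_congr rfl fun m hm => ?_
    conv_rhs => rw [← Nat.sub_add_cancel (mem_Icc.1 hm).2, pow_add]
    rw [Nat.add_sub_cancel]
    ring
  rw [this, kern]
  simp_rw [sub_mul]
  rw [Finset.sum_sub_distrib]
  ring

/-- The constant in `norm_kern_le`. -/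
noncomputable def kernConst (d : ℕ) : ℝ := 2 ^ (d + 2) * heatConst d * (momSum d + 3)

theorem one_sub_pow_le_min {a : ℝ} (ha0 : 0 ≤ a) (ha1 : a ≤ 1) (m : ℕ) :
    1 - (1 - a) ^ m ≤ min ((m + 1) * a) 1 := by
  have h1 := one_add_mul_le_pow (a := -a) (by linarith) m
  have h2 : 0 ≤ (1 - a) ^ m := pow_nonneg (by linarith) _
  rw [← sub_eq_add_neg] at h1
  refine le_min ?_ (by linarith)
  linarith

theorem norm_kern_le (hd : 4 < d) (h : Renewal d N q δ a p p0 f) {n : ℕ} (hn : n ≤ N) :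
    ‖kern q a p n‖ ≤ kernConst d * δ * incWt d a n := by
  have ha0 := h.a_nonneg
  have ha1 := h.a_le_one
  have hδ := h.delta_nonneg
  have hD0 : 0 ≤ 1 - a := by linarith
  have hC := one_le_heatConst d
  set u : ℕ → ℝ := fun m => min ((m + 1) * a) 1 * decay d m
  have hu0 : ∀ m, 0 ≤ u m := fun m =>
    mul_nonneg (le_min (by positivity) zero_le_one) (decay_pos d m).le
  have hnD : ∀ k : ℕ, ‖((1 - a : ℝ) : ℂ) ^ k‖ = (1 - a) ^ k := fun k => by
    rw [norm_pow, Complex.norm_real, Real.norm_of_nonneg hD0]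
  have hconv : ∑ m ∈ range (n + 1), u m * heat d a (n - m) ≤
      2 ^ d * (u n * (2 * (n + 1) / (1 + n * a)) + heat d a n * (a * momSum d)) := by
    refine sum_conv_le hu0 (heat_nonneg d ha0) (by positivity) ?_ ?_ ?_
      (sum_heat_le (by omega) ha0 ha1 n)
    · intro j hj hj'
      have h5 := decay_doubling d hj'
      have h6 := (decay_pos d j).le
      calc u j ≤ min ((n + 1) * a) 1 * (2 ^ d * decay d n) := by
            simp only [u]
            gcongr
        _ = _ := by simp only [u]; ring
    · exact fun j _ hj' => heat_doubling d ha0 ha1 hj'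
    · calc _ ≤ ∑ j ∈ range (n + 1), a * ((j + 1) * decay d j) := by
            refine Finset.sum_le_sum fun j _ => ?_
            have := (decay_pos d j).le
            calc u j ≤ (j + 1) * a * decay d j := by
                  simp only [u]
                  gcongr
                  exact min_le_left _ _
              _ = _ := by ring
        _ ≤ _ := by
            rw [← Finset.mul_sum]
            have := sum_mul_decay_le hd (range (n + 1))
            gcongr
  have hsum : ∑ m ∈ Icc 2 n, u m * (1 - a) ^ (n - m) ≤
      heatConst d * ∑ m ∈ range (n + 1), u m * heat d a (n - m) := by
    rw [Finset.mul_sum]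
    calc _ ≤ ∑ m ∈ Icc 2 n, heatConst d * (u m * heat d a (n - m)) := by
          refine Finset.sum_le_sum fun m _ => ?_
          have := one_sub_pow_le_heat d ha0 ha1 (n - m)
          calc _ ≤ u m * (heatConst d * heat d a (n - m)) := by
                have := hu0 m
                gcongr
            _ = _ := by ring
      _ ≤ _ := by
          refine Finset.sum_le_sum_of_subset_of_nonneg ?_ fun m _ _ => ?_
          · intro m hm
            simp only [mem_Icc, mem_range] at *
            omega
          · have := hu0 m
            have := heat_nonneg d ha0 (n - m)
            positivity
  have h1 : ‖kern q a p n‖ ≤ δ * (2 * ∑ m ∈ Icc 2 n, u m * (1 - a) ^ (n - m) +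
      (n + 1) * decay d n * (1 - a) ^ n) := by
    rw [kern_eq (p0 := p0)]
    calc _ ≤ ∑ m ∈ Icc 2 n, δ * (u m * (1 - a) ^ (n - m)) +
        ∑ m ∈ Icc 2 n, δ * (u m * (1 - a) ^ (n - m)) +
        δ * ((n + 1) * decay d n) * (1 - a) ^ n := by
          refine (_root_.norm_sub_le _ _).trans (add_le_add
            ((norm_add_le _ _).trans (add_le_add ?_ ?_)) ?_)
          · refine (norm_sum_le _ _).trans (Finset.sum_le_sum fun m hm => ?_)
            obtain ⟨hm2, hmn⟩ := mem_Icc.1 hm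
            rw [norm_mul, hnD, ← mul_assoc]
            gcongr
            exact h.norm_sub_le m hm2 (by omega)
          · refine (norm_sum_le _ _).trans (Finset.sum_le_sum fun m hm => ?_)
            obtain ⟨hm2, hmn⟩ := mem_Icc.1 hm
            have h7 : ‖(1 : ℂ) - ((1 - a : ℝ) : ℂ) ^ m‖ ≤ min ((m + 1) * a) 1 := by
              have h8 : (1 : ℂ) - ((1 - a : ℝ) : ℂ) ^ m = ((1 - (1 - a) ^ m : ℝ) : ℂ) := by
                push_cast; rfl
              rw [h8, Complex.norm_real, Real.norm_of_nonneg]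
              · exact one_sub_pow_le_min ha0 ha1 m
              · have := pow_le_one₀ (n := m) hD0 (by linarith)
                linarith
            rw [norm_mul, norm_mul, hnD]
            calc _ ≤ δ * decay d m * ((1 - a) ^ (n - m) * min ((m + 1) * a) 1) := by
                  have := (decay_pos d m).le
                  gcongr
                  exact h.norm_p0_le m hm2 (by omega)
              _ = _ := by simp only [u]; ring
          · rw [norm_mul, hnD]
            gcongr
            exact h.norm_tail_le n hn
      _ = _ := by rw [← Finset.mul_sum]; ring
  have hu1 : u n * (2 * (n + 1) / (1 + n * a)) ≤ 2 * ((n + 1) * decay d n / (1 + n * a)) := by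
    have h9 : u n ≤ decay d n := by
      simp only [u]
      exact mul_le_of_le_one_left (decay_pos d n).le (min_le_right _ _)
    calc _ ≤ decay d n * (2 * (n + 1) / (1 + n * a)) := by gcongr
      _ = _ := by ring
  have hD : (n + 1) * decay d n * (1 - a) ^ n ≤
      heatConst d * ((n + 1) * decay d n / (1 + n * a)) := by
    have h9 := one_sub_pow_le_heat d ha0 ha1 n
    have h10 := (decay_pos d n).le
    have h11 : heat d a n ≤ 1 / (1 + n * a) := by
      unfold heat
      have : 0 ≤ n * a := by positivity
      gcongr
      exact le_self_pow₀ (by linarith) (by omega)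
    calc _ ≤ (n + 1) * decay d n * (heatConst d * (1 / (1 + n * a))) := by
          gcongr
          exact h9.trans (by gcongr)
      _ = _ := by ring
  have hM := momSum_nonneg d
  set X := a * heat d a n
  set Y := (n + 1) * decay d n / (1 + n * a)
  have hX : 0 ≤ X := mul_nonneg ha0 (heat_nonneg d ha0 n)
  have hY : 0 ≤ Y := by
    have := (decay_pos d n).le
    positivity
  have h2d : (1 : ℝ) ≤ 2 ^ d := one_le_pow₀ (by norm_num)
  calc _ ≤ δ * (2 * (heatConst d * (2 ^ d * (2 * Y + X * momSum d))) + heatConst d * Y) := by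
        refine h1.trans ?_
        gcongr
        refine hsum.trans ?_
        gcongr
        refine hconv.trans ?_
        gcongr 2 ^ d * (?_ + ?_)
        exact le_of_eq (by simp only [X]; ring)
    _ = δ * heatConst d * (2 * 2 ^ d * (2 * Y + X * momSum d) + 1 * Y) := by ring
    _ ≤ δ * heatConst d * (2 * 2 ^ d * (2 * Y + X * momSum d) + 2 ^ d * Y) := by gcongr
    _ ≤ δ * heatConst d * (2 * 2 ^ d * (2 * Y + X * momSum d) + 2 ^ d * Y) +
        δ * heatConst d * 2 ^ d * (X * (2 * momSum d + 12) + Y * (4 * momSum d + 7)) :=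
        le_add_of_nonneg_right (by positivity)
    _ = kernConst d * δ * (X + Y) := by unfold kernConst; ring
    _ = _ := rfl

/-- The constant in the convolution estimate for `incWt`. -/
noncomputable def incConst (d : ℕ) : ℝ := 2 ^ (d + 2) * (2 + momSum d)

theorem incWt_conv_le (hd : 4 < d) (ha0 : 0 ≤ a) (ha1 : a ≤ 1) (n : ℕ) :
    ∑ j ∈ range (n + 1), incWt d a j * incWt d a (n - j) ≤ incConst d * incWt d a n := by
  refine (sum_conv_le (incWt_nonneg d ha0) (incWt_nonneg d ha0) (by positivity)
    (fun j hj hj' => incWt_doubling d ha0 ha1 hj hj')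
    (fun j hj hj' => incWt_doubling d ha0 ha1 hj hj') (sum_incWt_le hd ha0 ha1 n)
    (sum_incWt_le hd ha0 ha1 n)).trans (le_of_eq ?_)
  unfold incConst
  ring

theorem kernConst_nonneg (d : ℕ) : 0 ≤ kernConst d := by
  have := one_le_heatConst d
  have := momSum_nonneg d
  unfold kernConst
  positivity

theorem norm_incr_le (hd : 4 < d) (h : Renewal d N q δ a p p0 f)
    (hδ : 2 * kernConst d * incConst d * δ ≤ 1) {n : ℕ} (hn1 : 1 ≤ n) (hn : n ≤ N) :
    ‖incr (1 - a : ℝ) f n‖ ≤ 2 * kernConst d * δ * incWt d a n := by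
  have ha0 := h.a_nonneg
  have ha1 := h.a_le_one
  have hδ0 := h.delta_nonneg
  have hk := kernConst_nonneg d
  induction n using Nat.strong_induction_on with
  | _ n ih =>
    obtain ⟨n, rfl⟩ := Nat.exists_eq_add_of_le' hn1
    rw [h.incr_eq (by omega), Finset.sum_range_succ']
    have hw := incWt_nonneg d ha0
    have h0 : incr (1 - a : ℝ) f 0 = 1 := h.zero
    rw [h0, one_mul, Nat.sub_zero]
    calc _ ≤ ∑ j ∈ range n, (2 * kernConst d * δ * incWt d a (j + 1)) *
          (kernConst d * δ * incWt d a (n + 1 - (j + 1))) +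
          kernConst d * δ * incWt d a (n + 1) := by
          refine (norm_add_le _ _).trans (add_le_add ((norm_sum_le _ _).trans
            (Finset.sum_le_sum fun j hj => ?_)) (h.norm_kern_le hd hn))
          have hj := mem_range.1 hj
          rw [norm_mul]
          have := hw (j + 1)
          gcongr
          · exact ih (j + 1) (by omega) (by omega) (by omega)
          · exact h.norm_kern_le hd (by omega)
      _ = 2 * kernConst d * δ * (kernConst d * δ) *
          (∑ j ∈ range n, incWt d a (j + 1) * incWt d a (n + 1 - (j + 1))) +
          kernConst d * δ * incWt d a (n + 1) := by
          rw [Finset.mul_sum]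
          congr 1
          exact Finset.sum_congr rfl fun j _ => by ring
      _ ≤ 2 * kernConst d * δ * (kernConst d * δ) * (incConst d * incWt d a (n + 1)) +
          kernConst d * δ * incWt d a (n + 1) := by
          gcongr
          refine le_trans ?_ (incWt_conv_le hd ha0 ha1 (n + 1))
          rw [Finset.sum_range_succ, Finset.sum_range_succ']
          have h1 := mul_nonneg (hw 0) (hw (n + 1 - 0))
          have h2 := mul_nonneg (hw (n + 1)) (hw (n + 1 - (n + 1)))
          linarith
      _ = (2 * kernConst d * incConst d * δ) * (kernConst d * δ * incWt d a (n + 1)) +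
          kernConst d * δ * incWt d a (n + 1) := by ring
      _ ≤ 1 * (kernConst d * δ * incWt d a (n + 1)) + kernConst d * δ * incWt d a (n + 1) := by
          have := hw (n + 1)
          gcongr
      _ = _ := by ring

theorem norm_le_heat_add (hd : 4 < d) (h : Renewal d N q δ a p p0 f)
    (hδ : 2 * kernConst d * incConst d * δ ≤ 1) {n : ℕ} (hn : n ≤ N) :
    ‖f n‖ ≤ heat d a n * heatConst d + 2 * kernConst d * δ *
      ∑ j ∈ range (n + 1), incWt d a j * (heatConst d * heat d a (n - j)) ∧
    ‖f n‖ ≤ 1 + 2 * kernConst d * δ * (2 + momSum d) := by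
  have ha0 := h.a_nonneg
  have ha1 := h.a_le_one
  have hδ0 := h.delta_nonneg
  have hk := kernConst_nonneg d
  have hw := incWt_nonneg d ha0
  have hD0 : 0 ≤ 1 - a := by linarith
  have key : ‖f n‖ ≤ (1 - a) ^ n +
      2 * kernConst d * δ * ∑ j ∈ range (n + 1), incWt d a j * (1 - a) ^ (n - j) := by
    rw [eq_sum_incr (1 - a : ℝ) f n, Finset.sum_range_succ', Nat.sub_zero]
    have h0 : incr (1 - a : ℝ) f 0 = 1 := h.zero
    rw [h0, mul_one]
    calc _ ≤ ∑ j ∈ range n, (1 - a) ^ (n - (j + 1)) * (2 * kernConst d * δ * incWt d a (j + 1)) +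
          (1 - a) ^ n := by
          refine (norm_add_le _ _).trans (add_le_add ((norm_sum_le _ _).trans
            (Finset.sum_le_sum fun j hj => ?_)) ?_)
          · have hj := mem_range.1 hj
            rw [norm_mul, norm_pow, Complex.norm_real, Real.norm_of_nonneg hD0]
            gcongr
            exact h.norm_incr_le hd hδ (by omega) (by omega)
          · rw [norm_pow, Complex.norm_real, Real.norm_of_nonneg hD0]
      _ = (1 - a) ^ n + 2 * kernConst d * δ *
          ∑ j ∈ range n, incWt d a (j + 1) * (1 - a) ^ (n - (j + 1)) := by
          rw [Finset.mul_sum, add_comm]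
          congr 1
          exact Finset.sum_congr rfl fun j _ => by ring
      _ ≤ _ := by
          gcongr
          rw [Finset.sum_range_succ']
          have := mul_nonneg (hw 0) (pow_nonneg hD0 (n - 0))
          linarith
  refine ⟨key.trans ?_, key.trans ?_⟩
  · gcongr with j
    · rw [mul_comm]; exact one_sub_pow_le_heat d ha0 ha1 n
    · exact hw j
    · exact one_sub_pow_le_heat d ha0 ha1 _
  · gcongr
    · exact pow_le_one₀ hD0 (by linarith)
    · refine le_trans (Finset.sum_le_sum fun j _ => ?_) (sum_incWt_le hd ha0 ha1 n)
      exact mul_le_of_le_one_right (hw j) (pow_le_one₀ hD0 (by linarith))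

/-- The constant in `norm_le`. -/
noncomputable def fourConst (d : ℕ) : ℝ :=
  heatConst d * (1 + kernConst d * 2 ^ (d + 4) * (6 + momSum d))

theorem norm_le (hd : 4 < d) (h : Renewal d N q δ a p p0 f)
    (hδ : 2 * kernConst d * incConst d * δ ≤ 1) (hδ1 : δ ≤ 1) {n : ℕ} (hn : n ≤ N) :
    ‖f n‖ ≤ fourConst d * (heat d a n + (n + 1) ^ 2 * decay d n / (1 + n * a) ^ 2) := by
  have ha0 := h.a_nonneg
  have ha1 := h.a_le_one
  have hδ0 := h.delta_nonneg
  have hk := kernConst_nonneg d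
  have hw := incWt_nonneg d ha0
  have hM := momSum_nonneg d
  have hC := one_le_heatConst d
  refine (h.norm_le_heat_add hd hδ hn).1.trans ?_
  have hconv : ∑ j ∈ range (n + 1), incWt d a j * heat d a (n - j) ≤
      2 ^ (d + 1) * (incWt d a n * (2 * (n + 1) / (1 + n * a)) + heat d a n * (2 + momSum d)) := by
    refine sum_conv_le hw (heat_nonneg d ha0) (by positivity)
      (fun j hj hj' => incWt_doubling d ha0 ha1 hj hj') (fun j _ hj' => ?_)
      (sum_incWt_le hd ha0 ha1 n) (sum_heat_le (by omega) ha0 ha1 n)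
    refine (heat_doubling d ha0 ha1 hj').trans ?_
    have := heat_nonneg d ha0 n
    gcongr <;> norm_num
  have h1 : incWt d a n * (2 * (n + 1) / (1 + n * a)) ≤
      2 * heat d a n + 2 * ((n + 1) ^ 2 * decay d n / (1 + n * a) ^ 2) := by
    unfold incWt
    rw [add_mul]
    gcongr ?_ + ?_
    · have := mul_sum_heat_le ha0 ha1 n
      calc _ = (a * (2 * (n + 1) / (1 + n * a))) * heat d a n := by ring
        _ ≤ _ := by
          have := heat_nonneg d ha0 n
          gcongr
    · exact le_of_eq (by field_simp)
  set X := heat d a n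
  set Y := (n + 1) ^ 2 * decay d n / (1 + n * a) ^ 2
  have hX : 0 ≤ X := heat_nonneg d ha0 n
  have hY : 0 ≤ Y := by
    have := (decay_pos d n).le
    positivity
  calc _ = X * heatConst d + 2 * kernConst d * δ * heatConst d *
        ∑ j ∈ range (n + 1), incWt d a j * heat d a (n - j) := by
        have : ∑ j ∈ range (n + 1), incWt d a j * (heatConst d * heat d a (n - j)) =
            heatConst d * ∑ j ∈ range (n + 1), incWt d a j * heat d a (n - j) := by
          rw [Finset.mul_sum]
          exact Finset.sum_congr rfl fun j _ => by ring
        rw [this]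
        ring
    _ ≤ X * heatConst d + 2 * kernConst d * 1 * heatConst d *
        (2 ^ (d + 1) * ((2 * X + 2 * Y) + X * (2 + momSum d))) := by
        have hS : 0 ≤ ∑ j ∈ range (n + 1), incWt d a j * heat d a (n - j) :=
          Finset.sum_nonneg fun j _ => mul_nonneg (hw j) (heat_nonneg d ha0 _)
        gcongr
        exact hconv.trans (by gcongr)
    _ ≤ X * heatConst d + 2 * kernConst d * 1 * heatConst d *
        (2 ^ (d + 1) * ((2 * X + 2 * Y) + X * (2 + momSum d))) + (heatConst d * Y +
        kernConst d * heatConst d * 2 ^ (d + 2) *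
          (X * (20 + 3 * momSum d) + Y * (22 + 4 * momSum d))) :=
        le_add_of_nonneg_right (by positivity)
    _ = _ := by unfold fourConst; ring

end Renewal

end Scalar

end WSAW

namespace WSAW

open Finset MeasureTheory

section OneDim

theorem two_div_pi_sq_mul_sq_le {t : ℝ} (ht : |t| ≤ Real.pi) :
    2 / Real.pi ^ 2 * t ^ 2 ≤ 1 - Real.cos t := by
  have := Real.cos_le_one_sub_mul_cos_sq ht
  linarith

theorem integral_inv_one_add_cos_le {s : ℝ} (hs : 0 < s) :
    ∫ t in (-Real.pi)..Real.pi, (1 + s * (1 - Real.cos t))⁻¹ ≤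
      Real.pi ^ 2 * s ^ (-(1 / 2 : ℝ)) := by
  have hpi := Real.pi_pos
  set b := √(2 * s) / Real.pi
  have hb : 0 < b := by positivity
  have hbsq : b ^ 2 = s * (2 / Real.pi ^ 2) := by
    simp only [b]
    rw [div_pow, Real.sq_sqrt (by positivity)]
    ring
  have h1 : ∫ t in (-Real.pi)..Real.pi, (1 + s * (1 - Real.cos t))⁻¹ ≤
      ∫ t in (-Real.pi)..Real.pi, (1 + (b * t) ^ 2)⁻¹ := by
    refine intervalIntegral.integral_mono_on (by linarith) ?_ ?_ fun t ht => ?_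
    · refine Continuous.intervalIntegrable (Continuous.inv₀ (by fun_prop) fun t => ?_) _ _
      have := mul_nonneg hs.le (sub_nonneg.2 (Real.cos_le_one t))
      positivity
    · refine Continuous.intervalIntegrable (Continuous.inv₀ (by fun_prop) fun t => ?_) _ _
      positivity
    · have := two_div_pi_sq_mul_sq_le (abs_le.2 ht)
      have : (b * t) ^ 2 ≤ s * (1 - Real.cos t) := by
        rw [mul_pow, hbsq, mul_assoc]
        gcongr
      gcongr
  refine h1.trans ?_
  rw [intervalIntegral.integral_comp_mul_left (fun x => (1 + x ^ 2)⁻¹) hb.ne',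
    integral_inv_one_add_sq]
  have h2 := Real.arctan_lt_pi_div_two (b * Real.pi)
  have h3 := Real.neg_pi_div_two_lt_arctan (b * -Real.pi)
  have h4 : b⁻¹ * Real.pi ≤ Real.pi ^ 2 * s ^ (-(1 / 2 : ℝ)) := by
    rw [Real.rpow_neg hs.le, ← Real.sqrt_eq_rpow]
    have h5 : √s ≤ √(2 * s) := Real.sqrt_le_sqrt (by linarith)
    have h6 : 0 < √s := Real.sqrt_pos.2 hs
    calc b⁻¹ * Real.pi = Real.pi ^ 2 * (√(2 * s))⁻¹ := by
          simp only [b]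
          rw [inv_div]
          ring
      _ ≤ _ := by gcongr
  rw [smul_eq_mul]
  refine le_trans ?_ h4
  gcongr
  linarith

theorem integral_rpow_one_add_cos_le {s p : ℝ} (hs : 0 < s) (hp0 : 0 < p) (hp : 2 * p < 1) :
    ∫ t in (-Real.pi)..Real.pi, (1 + s * (1 - Real.cos t)) ^ (-p) ≤
      (2 * (2 / Real.pi ^ 2) ^ (-p) * (Real.pi ^ (1 - 2 * p) / (1 - 2 * p))) * s ^ (-p) := by
  have hpi := Real.pi_pos
  have hb : ∀ t, 1 ≤ 1 + s * (1 - Real.cos t) := fun t => by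
    have := mul_nonneg hs.le (sub_nonneg.2 (Real.cos_le_one t))
    linarith
  have hc : Continuous fun t => (1 + s * (1 - Real.cos t)) ^ (-p) :=
    Continuous.rpow_const (by fun_prop) fun t => Or.inl (by linarith [hb t])
  have h0 : ∫ t in (-Real.pi)..Real.pi, (1 + s * (1 - Real.cos t)) ^ (-p) =
      2 * ∫ t in (0)..Real.pi, (1 + s * (1 - Real.cos t)) ^ (-p) := by
    rw [← intervalIntegral.integral_add_adjacent_intervals (hc.intervalIntegrable _ 0)
      (hc.intervalIntegrable _ _)]
    have := intervalIntegral.integral_comp_neg (a := 0) (b := Real.pi)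
      (fun t => (1 + s * (1 - Real.cos t)) ^ (-p))
    simp only [Real.cos_neg, neg_zero] at this
    rw [← this]
    ring
  have h1 : ∫ t in (0)..Real.pi, (1 + s * (1 - Real.cos t)) ^ (-p) ≤
      ∫ t in (0)..Real.pi, (2 / Real.pi ^ 2) ^ (-p) * s ^ (-p) * t ^ (-(2 * p)) := by
    refine intervalIntegral.integral_mono_on_of_le_Ioo hpi.le (hc.intervalIntegrable _ _) ?_
      fun t ht => ?_
    · exact (intervalIntegral.intervalIntegrable_rpow' (by linarith)).const_mul _
    · have h2 := two_div_pi_sq_mul_sq_le (t := t) (by rw [abs_of_pos ht.1]; exact ht.2.le)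
      have ht0 := ht.1
      calc (1 + s * (1 - Real.cos t)) ^ (-p) ≤ (s * (2 / Real.pi ^ 2 * t ^ 2)) ^ (-p) := by
            refine Real.rpow_le_rpow_of_nonpos (by positivity) ?_ (by linarith)
            have := mul_le_mul_of_nonneg_left h2 hs.le
            linarith
        _ = _ := by
            rw [Real.mul_rpow hs.le (by positivity), Real.mul_rpow (by positivity) (by positivity),
              ← Real.rpow_natCast t 2, ← Real.rpow_mul ht0.le]
            push_cast
            rw [mul_neg]
            ring
  rw [h0]
  calc _ ≤ 2 * ∫ t in (0)..Real.pi, (2 / Real.pi ^ 2) ^ (-p) * s ^ (-p) * t ^ (-(2 * p)) := by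
        gcongr
    _ = _ := by
        rw [intervalIntegral.integral_const_mul, integral_rpow (Or.inl (by linarith)),
          Real.zero_rpow (by linarith)]
        have : -(2 * p) + 1 = 1 - 2 * p := by ring
        rw [this]
        ring

theorem integral_comp_add_cos (h : ℝ → ℝ) :
    ∫ t in (-Real.pi)..Real.pi, h (1 + Real.cos t) =
      ∫ t in (-Real.pi)..Real.pi, h (1 - Real.cos t) := by
  have h1 := intervalIntegral.integral_comp_add_right (a := -Real.pi) (b := Real.pi)
    (fun t => h (1 - Real.cos t)) Real.pi
  simp only [Real.cos_add_pi, sub_neg_eq_add] at h1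
  rw [h1]
  have h2 : Function.Periodic (fun t => h (1 - Real.cos t)) (2 * Real.pi) := fun t => by
    simp
  have := h2.intervalIntegral_add_eq (-Real.pi + Real.pi) (-Real.pi)
  convert this using 2 <;> ring

end OneDim

section Torus

/-- Lebesgue measure on the cube `(-π, π]^d`. -/
noncomputable def torusMeasure (d : ℕ) : Measure (Fin d → ℝ) :=
  Measure.pi fun _ => volume.restrict (Set.Ioc (-Real.pi) Real.pi)

instance (d : ℕ) : IsFiniteMeasure (torusMeasure d) := by
  unfold torusMeasure; infer_instance

/-- The Fourier transform of the step distribution of the simple random walk. -/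
noncomputable def cosMean (d : ℕ) (k : Fin d → ℝ) : ℝ := (∑ i, Real.cos (k i)) / d

theorem one_sub_mul_cosMean {d : ℕ} (hd : 0 < d) (k : Fin d → ℝ) (e : ℝ) :
    1 - e * cosMean d k = (∑ i, (1 - e * Real.cos (k i))) / d := by
  have : (d : ℝ) ≠ 0 := by positivity
  rw [cosMean, Finset.sum_sub_distrib, ← Finset.mul_sum]
  simp
  field_simp

theorem one_sub_mul_cos_nonneg {e : ℝ} (he : |e| ≤ 1) (t : ℝ) : 0 ≤ 1 - e * Real.cos t := by
  have : |e * Real.cos t| ≤ 1 := by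
    rw [abs_mul]
    exact mul_le_one₀ he (abs_nonneg _) (Real.abs_cos_le_one t)
  linarith [(abs_le.1 this).2]

theorem rpow_le_prod {d : ℕ} (hd : 0 < d) (n : ℕ) (k : Fin d → ℝ) {e : ℝ} (he : |e| ≤ 1)
    (p : ℝ) (hp : 0 ≤ p) : (1 + n * (1 - e * cosMean d k)) ^ (-(d * p)) ≤
      ∏ i, (1 + n / d * (1 - e * Real.cos (k i))) ^ (-p) := by
  have hd' : (0 : ℝ) < d := by positivity
  have h0 : ∀ i, 0 ≤ 1 - e * Real.cos (k i) := fun i => one_sub_mul_cos_nonneg he _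
  have h1 : ∀ i, 1 + n / d * (1 - e * Real.cos (k i)) ≤ 1 + n * (1 - e * cosMean d k) := by
    intro i
    rw [one_sub_mul_cosMean hd, div_mul_eq_mul_div, mul_div_assoc]
    gcongr
    exact Finset.single_le_sum (f := fun i => 1 - e * Real.cos (k i)) (fun i _ => h0 i)
      (Finset.mem_univ i)
  have h2 : 0 ≤ 1 - e * cosMean d k := by
    rw [one_sub_mul_cosMean hd]
    exact div_nonneg (Finset.sum_nonneg fun i _ => h0 i) hd'.le
  calc _ = ∏ i : Fin d, (1 + n * (1 - e * cosMean d k)) ^ (-p) := by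
        rw [Finset.prod_const, Finset.card_univ, Fintype.card_fin, ← Real.rpow_natCast,
          ← Real.rpow_mul (by positivity)]
        congr 1
        ring
    _ ≤ _ := by
        refine Finset.prod_le_prod (fun i _ => Real.rpow_nonneg (by positivity) _) fun i _ => ?_
        have := h0 i
        exact Real.rpow_le_rpow_of_nonpos (by positivity) (h1 i) (by linarith)

theorem integral_prod_le {d : ℕ} (h : ℝ → ℝ) {C : ℝ} (h0 : ∀ t, 0 ≤ h t)
    (hC : ∫ t in (-Real.pi)..Real.pi, h t ≤ C) :
    ∫ k, ∏ i, h (k i) ∂(torusMeasure d) ≤ C ^ d := by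
  unfold torusMeasure
  rw [integral_fintype_prod_eq_prod (𝕜 := ℝ) (f := fun _ => h)]
  rw [Finset.prod_const, Finset.card_univ, Fintype.card_fin]
  rw [intervalIntegral.integral_of_le (by linarith [Real.pi_pos])] at hC
  exact pow_le_pow_left₀ (integral_nonneg h0) hC d

theorem integrable_prod {d : ℕ} {h : ℝ → ℝ} (hc : Continuous h) :
    Integrable (fun k => ∏ i, h (k i)) (torusMeasure d) := by
  unfold torusMeasure
  exact Integrable.fintype_prod (f := fun _ => h) fun _ => hc.integrableOn_Ioc

/-- The bound on the Fourier transform provided by `Renewal.norm_le`. -/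
noncomputable def fourBound (d n : ℕ) (a : ℝ) : ℝ :=
  heat d a n + (n + 1) ^ 2 * decay d n / (1 + n * a) ^ 2

theorem exists_integral_le {d : ℕ} (hd : 4 < d) : ∃ C : ℝ, 0 ≤ C ∧ ∀ n : ℕ, 1 ≤ n →
    ∀ F : (Fin d → ℝ) → ℝ, (∀ k, 0 ≤ F k) →
    (∀ k, F k ≤ fourBound d n (1 - cosMean d k) ∨ F k ≤ fourBound d n (1 + cosMean d k)) →
    ∫ k, F k ∂(torusMeasure d) ≤ C * decay d n := by
  have hd0 : (0 : ℝ) < d := by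
    have : 0 < d := by omega
    exact_mod_cast this
  have hd4 : (4 : ℝ) < d := by exact_mod_cast hd
  have hpi := Real.pi_pos
  set p : ℝ := 2 / d
  have hp0 : 0 < p := by positivity
  have hp1 : 2 * p < 1 := by
    simp only [p]
    rw [← mul_div_assoc, div_lt_one hd0]
    linarith
  set c1 : ℝ := Real.pi ^ 2
  set c2 : ℝ := 2 * (2 / Real.pi ^ 2) ^ (-p) * (Real.pi ^ (1 - 2 * p) / (1 - 2 * p))
  have hc2 : 0 ≤ c2 := by
    have : 0 < 1 - 2 * p := by linarith
    positivity
  refine ⟨2 * (c1 ^ d * (2 * d : ℝ) ^ ((d : ℝ) / 2) + c2 ^ d * (2 * d) ^ 2), by positivity,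
    fun n hn F hF0 hF => ?_⟩
  have hn0 : (0 : ℝ) < n := by exact_mod_cast hn
  have hn1 : (1 : ℝ) ≤ n := by exact_mod_cast hn
  set s : ℝ := n / d
  have hs : 0 < s := by positivity
  have hsn : ((n : ℝ) + 1) / (2 * d) ≤ s := by
    simp only [s]
    rw [div_le_div_iff₀ (by positivity) hd0]
    nlinarith
  let V : ℝ → ℝ → ℝ → ℝ := fun e q t => (1 + s * (1 - e * Real.cos t)) ^ (-q)
  have hpos : ∀ e : ℝ, |e| ≤ 1 → ∀ t, 0 < 1 + s * (1 - e * Real.cos t) := fun e he t => by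
    have := one_sub_mul_cos_nonneg he t
    positivity
  have hV0 : ∀ e q : ℝ, |e| ≤ 1 → ∀ t, 0 ≤ V e q t := fun e q he t =>
    Real.rpow_nonneg (hpos e he t).le _
  have hVc : ∀ e q : ℝ, |e| ≤ 1 → Continuous (V e q) := fun e q he =>
    Continuous.rpow_const (by fun_prop) fun t => Or.inl (hpos e he t).ne'
  let B : ℝ → (Fin d → ℝ) → ℝ := fun e k =>
    ∏ i, V e 1 (k i) + (n + 1) ^ 2 * decay d n * ∏ i, V e p (k i)
  have hB : ∀ e : ℝ, |e| ≤ 1 → ∀ k, fourBound d n (1 - e * cosMean d k) ≤ B e k := by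
    intro e he k
    have h2 : 0 ≤ 1 - e * cosMean d k := by
      rw [one_sub_mul_cosMean (by omega)]
      exact div_nonneg (Finset.sum_nonneg fun i _ => one_sub_mul_cos_nonneg he _) hd0.le
    have h3 : 0 < 1 + n * (1 - e * cosMean d k) := by positivity
    have h4 := rpow_le_prod (by omega) n k he 1 zero_le_one
    have h5 := rpow_le_prod (by omega) n k he p hp0.le
    have h6 : (d : ℝ) * p = (2 : ℕ) := by simp only [p]; push_cast; field_simp
    rw [Real.rpow_neg h3.le, h6, Real.rpow_natCast] at h5
    rw [Real.rpow_neg h3.le, mul_one, Real.rpow_natCast] at h4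
    have h7 := (decay_pos d n).le
    unfold fourBound heat
    rw [one_div, div_eq_mul_inv _ ((1 + n * (1 - e * cosMean d k)) ^ 2)]
    simp only [B]
    gcongr
  have hBi : ∀ e : ℝ, |e| ≤ 1 → Integrable (B e) (torusMeasure d) := fun e he =>
    (integrable_prod (hVc e 1 he)).add ((integrable_prod (hVc e p he)).const_mul _)
  have hB0 : ∀ e : ℝ, |e| ≤ 1 → ∀ k, 0 ≤ B e k := fun e he k => by
    have h7 := (decay_pos d n).le
    exact add_nonneg (Finset.prod_nonneg fun i _ => hV0 e 1 he _)
      (mul_nonneg (by positivity) (Finset.prod_nonneg fun i _ => hV0 e p he _))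
  have h1D : ∀ e : ℝ, e = 1 ∨ e = -1 → ∀ q, ∫ t in (-Real.pi)..Real.pi, V e q t =
      ∫ t in (-Real.pi)..Real.pi, (1 + s * (1 - Real.cos t)) ^ (-q) := by
    rintro e (rfl | rfl) q
    · simp [V]
    · have := integral_comp_add_cos fun x => (1 + s * x) ^ (-q)
      simp only [V]
      rw [← this]
      simp
  have hintegral : ∀ e : ℝ, e = 1 ∨ e = -1 → ∫ k, B e k ∂(torusMeasure d) ≤
      (c1 ^ d * (2 * d : ℝ) ^ ((d : ℝ) / 2) + c2 ^ d * (2 * d) ^ 2) * decay d n := by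
    intro e he'
    have he : |e| ≤ 1 := by rcases he' with rfl | rfl <;> simp
    have h7 := (decay_pos d n).le
    simp only [B]
    rw [integral_add (integrable_prod (hVc e 1 he)) ((integrable_prod (hVc e p he)).const_mul _),
      integral_const_mul, add_mul]
    have h8 : ∫ k, ∏ i, V e 1 (k i) ∂(torusMeasure d) ≤ (c1 * s ^ (-(1 / 2 : ℝ))) ^ d := by
      refine integral_prod_le _ (hV0 e 1 he) ?_
      rw [h1D e he']
      refine le_trans (le_of_eq ?_) (integral_inv_one_add_cos_le hs)
      refine intervalIntegral.integral_congr fun t _ => ?_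
      exact Real.rpow_neg_one _
    have h9 : ∫ k, ∏ i, V e p (k i) ∂(torusMeasure d) ≤ (c2 * s ^ (-p)) ^ d := by
      refine integral_prod_le _ (hV0 e p he) ?_
      rw [h1D e he']
      exact integral_rpow_one_add_cos_le hs hp0 hp1
    have hpw : ∀ r : ℝ, 0 ≤ r → s ^ (-r) ≤ (2 * d) ^ r * ((n : ℝ) + 1) ^ (-r) := by
      intro r hr
      calc s ^ (-r) ≤ (((n : ℝ) + 1) / (2 * d)) ^ (-r) :=
            Real.rpow_le_rpow_of_nonpos (by positivity) hsn (by linarith)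
        _ = _ := by
            rw [Real.div_rpow (by positivity) (by positivity), Real.rpow_neg (x := 2 * (d : ℝ))
              (by positivity), div_inv_eq_mul, mul_comm]
    refine add_le_add ?_ ?_
    · refine h8.trans ?_
      rw [mul_pow, ← Real.rpow_natCast (s ^ _), ← Real.rpow_mul hs.le]
      have := hpw ((d : ℝ) / 2) (by positivity)
      rw [show -(1 / 2 : ℝ) * d = -((d : ℝ) / 2) by ring, mul_assoc]
      unfold decay
      gcongr
    · have h10 := hpw 2 (by norm_num)
      have h11 : ((n : ℝ) + 1) ^ 2 * ((n : ℝ) + 1) ^ (-2 : ℝ) = 1 := by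
        rw [← Real.rpow_natCast, ← Real.rpow_add (by positivity)]
        norm_num
      calc _ ≤ ((n : ℝ) + 1) ^ 2 * decay d n * (c2 * s ^ (-p)) ^ d := by gcongr
        _ = ((n : ℝ) + 1) ^ 2 * decay d n * (c2 ^ d * s ^ (-2 : ℝ)) := by
            rw [mul_pow, ← Real.rpow_natCast (s ^ _), ← Real.rpow_mul hs.le]
            congr 4
            simp only [p]
            field_simp
        _ ≤ ((n : ℝ) + 1) ^ 2 * decay d n * (c2 ^ d *
          ((2 * d) ^ (2 : ℝ) * ((n : ℝ) + 1) ^ (-2 : ℝ))) := by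
            gcongr
        _ = c2 ^ d * (2 * d) ^ (2 : ℝ) * decay d n *
            (((n : ℝ) + 1) ^ 2 * ((n : ℝ) + 1) ^ (-2 : ℝ)) := by ring
        _ = _ := by
            rw [h11, mul_one, ← Real.rpow_natCast (2 * (d : ℝ)) 2]
            norm_num
  have h1 : |(1 : ℝ)| ≤ 1 := by simp
  have h2 : |(-1 : ℝ)| ≤ 1 := by simp
  calc ∫ k, F k ∂(torusMeasure d) ≤ ∫ k, (B 1 k + B (-1) k) ∂(torusMeasure d) := by
        refine integral_mono_of_nonneg (Filter.Eventually.of_forall hF0) ((hBi 1 h1).add (hBi _ h2))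
          (Filter.Eventually.of_forall fun k => ?_)
        rcases hF k with h | h
        · have := hB 1 h1 k
          rw [one_mul] at this
          exact h.trans (this.trans (le_add_of_nonneg_right (hB0 _ h2 k)))
        · have := hB (-1) h2 k
          rw [neg_one_mul, sub_neg_eq_add] at this
          exact h.trans (this.trans (le_add_of_nonneg_left (hB0 _ h1 k)))
    _ = ∫ k, B 1 k ∂(torusMeasure d) + ∫ k, B (-1) k ∂(torusMeasure d) :=
        integral_add (hBi 1 h1) (hBi _ h2)
    _ ≤ _ := by
        have := hintegral 1 (Or.inl rfl)
        have := hintegral (-1) (Or.inr rfl)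
        linarith

end Torus

end WSAW

namespace WSAW

open Finset Lace MeasureTheory

section Fourier

variable {d : ℕ}

/-- The inner product of a wave vector with a lattice point. -/
def phase (k : Fin d → ℝ) (x : Fin d → ℤ) : ℝ := ∑ i, k i * x i

theorem phase_add (k : Fin d → ℝ) (x y : Fin d → ℤ) : phase k (x + y) = phase k x + phase k y := by
  simp [phase, mul_add, Finset.sum_add_distrib]

theorem phase_neg (k : Fin d → ℝ) (x : Fin d → ℤ) : phase k (-x) = -phase k x := by
  simp [phase, Finset.sum_neg_distrib]

theorem phase_zero_left (x : Fin d → ℤ) : phase 0 x = 0 := by simp [phase]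

/-- Reversal of the sign of a step. -/
def flipStep (d : ℕ) : Fin d × Bool ≃ Fin d × Bool := Equiv.prodCongr (Equiv.refl _) Equiv.boolNot

theorem wsawStep_flipStep (e : Fin d × Bool) : wsawStep d (flipStep d e) = -wsawStep d e := by
  obtain ⟨i, b⟩ := e
  funext j
  cases b <;> simp [wsawStep, flipStep] <;> split_ifs <;> rfl

theorem endpt_map_flipStep (l : List (Fin d × Bool)) : endpt (l.map (flipStep d)) = -endpt l := by
  induction l with
  | nil => simp
  | cons e l ih => rw [List.map_cons, endpt_cons, endpt_cons, ih, wsawStep_flipStep, neg_add]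

theorem pairWt_map_flipStep (β : ℝ) (l : List (Fin d × Bool)) :
    pairWt β (l.map (flipStep d)) = pairWt β l := by
  funext s t
  have h : ∀ k, listPos (l.map (flipStep d)) k = -listPos l k := fun k => by
    rw [listPos, ← List.map_take, endpt_map_flipStep, listPos]
  unfold pairWt
  rw [h, h]
  exact if_congr neg_inj rfl rfl

theorem wt_map_flipStep (β : ℝ) (l : List (Fin d × Bool)) :
    wt β (l.map (flipStep d)) = wt β l := by
  rw [wt, pairWt_map_flipStep, List.length_map, wt]

/-- The lace expansion coefficient of a walk. -/
noncomputable def laceWt (β : ℝ) (m : ℕ) (l : List (Fin d × Bool)) : ℝ :=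
  laceSum (pairWt β l) 0 1 m

/-- The Fourier transform of a sum over walks, for symmetric `G`. -/
noncomputable def fourier (z : ℝ) (n : ℕ) (G : List (Fin d × Bool) → ℝ) (k : Fin d → ℝ) : ℝ :=
  walkSum z n fun l => G l * Real.cos (phase k (endpt l))

theorem fourier_zero_right (z : ℝ) (n : ℕ) (G : List (Fin d × Bool) → ℝ) :
    fourier z n G 0 = walkSum z n G := by
  simp [fourier, phase_zero_left]

theorem walkSum_mul_sin (z : ℝ) (n : ℕ) {G : List (Fin d × Bool) → ℝ}
    (hG : ∀ l, G (l.map (flipStep d)) = G l) (k : Fin d → ℝ) :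
    walkSum z n (fun l => G l * Real.sin (phase k (endpt l))) = 0 := by
  have h := walkSum_comp_equiv z n (flipStep d) fun l => G l * Real.sin (phase k (endpt l))
  simp only [hG, endpt_map_flipStep, phase_neg, Real.sin_neg, mul_neg] at h
  have h2 := walkSum_mul_left z n (-1) fun l => G l * Real.sin (phase k (endpt l))
  simp only [neg_one_mul] at h2
  linarith

theorem fourier_wt_eq_sum (z β : ℝ) {n : ℕ} (hn : 1 ≤ n) (k : Fin d → ℝ) :
    fourier z n (wt β) k =
      ∑ m ∈ Icc 1 n, fourier z m (laceWt β m) k * fourier z (n - m) (wt β) k := by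
  have h1 : ∀ l : List (Fin d × Bool), l.length = n →
      wt β l * Real.cos (phase k (endpt l)) = ∑ m ∈ Icc 1 n,
        laceWt β m l * pairProd (pairWt β l) m n * Real.cos (phase k (endpt l)) := by
    intro l hl
    have hne : l ≠ [] := by
      rintro rfl
      simp at hl
      omega
    rw [← Finset.sum_mul, wt, hl, pairProd_eq_sum_laceSum _ (pairWt_zero_one β hne) hn]
    rfl
  rw [fourier, walkSum_congr z h1, walkSum_sum]
  refine Finset.sum_congr rfl fun m hm => ?_
  obtain ⟨hm1, hmn⟩ := mem_Icc.1 hm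
  have h2 := walkSum_add_length z m (n - m) fun l : List (Fin d × Bool) =>
    laceWt β m l * pairProd (pairWt β l) m n * Real.cos (phase k (endpt l))
  rw [Nat.add_sub_cancel' hmn] at h2
  rw [h2]
  calc _ = walkSum z m fun l : List (Fin d × Bool) =>
        laceWt β m l * Real.cos (phase k (endpt l)) * fourier z (n - m) (wt β) k := by
        refine walkSum_congr z fun l hl => ?_
        have h3 : ∀ l' : List (Fin d × Bool), l'.length = n - m →
            laceWt β m (l ++ l') * pairProd (pairWt β (l ++ l')) m n *
              Real.cos (phase k (endpt (l ++ l'))) =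
            laceWt β m l * Real.cos (phase k (endpt l)) *
              (wt β l' * Real.cos (phase k (endpt l'))) +
            (-(laceWt β m l * Real.sin (phase k (endpt l)))) *
              (wt β l' * Real.sin (phase k (endpt l'))) := by
          intro l' hl'
          have h4 := pairProd_append_right β l l' 0 l'.length
          rw [hl, hl', Nat.add_zero, Nat.add_sub_cancel' hmn] at h4
          rw [laceWt, laceSum_append_left β l l' 0 1 hl.ge, h4, endpt_append, phase_add,
            Real.cos_add, wt, hl', laceWt]
          ring
        rw [walkSum_congr z h3, walkSum_add, walkSum_mul_left, walkSum_mul_left,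
          walkSum_mul_sin z _ (wt_map_flipStep β), mul_zero, add_zero]
        rfl
    _ = _ := walkSum_mul_right z m _ _

theorem laceWt_one (β : ℝ) {l : List (Fin d × Bool)} (hl : l ≠ []) : laceWt β 1 l = 1 := by
  have h01 := pairWt_zero_one β hl
  have h := pairProd_eq_sum_laceSum _ h01 le_rfl
  rw [Icc_self, Finset.sum_singleton] at h
  have h1 : pairProd (pairWt β l) 0 1 = 1 := by
    rw [pairProd, show Ioc 0 1 = {1} from rfl]
    simp [h01]
  have h2 : pairProd (pairWt β l) 1 1 = 1 := by simp [pairProd]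
  rw [h1, h2, mul_one] at h
  exact h.symm

theorem phase_wsawStep (k : Fin d → ℝ) (i : Fin d) (b : Bool) :
    phase k (wsawStep d (i, b)) = if b then k i else -k i := by
  unfold phase wsawStep
  rw [Finset.sum_eq_single i]
  · cases b <;> simp
  · intro j _ hj
    simp [hj]
  · simp

theorem fourier_laceWt_one (hd : 0 < d) (z β : ℝ) (k : Fin d → ℝ) :
    fourier z 1 (laceWt β 1) k = 2 * d * z * cosMean d k := by
  have hd' : (d : ℝ) ≠ 0 := by positivity
  rw [fourier, walkSum_succ]
  simp only [walkSum_zero]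
  have : ∀ e : Fin d × Bool, laceWt β 1 [e] * Real.cos (phase k (endpt [e])) =
      Real.cos (k e.1) := by
    rintro ⟨i, b⟩
    rw [laceWt_one β (by simp), endpt_cons, endpt_nil, add_zero, phase_wsawStep]
    cases b <;> simp
  rw [Finset.sum_congr rfl fun e _ => this e, Fintype.sum_prod_type, cosMean]
  simp only [Finset.sum_const, Finset.card_univ, Fintype.card_bool, nsmul_eq_mul,
    ← Finset.mul_sum]
  push_cast
  field_simp

theorem abs_sin_sum_le {ι : Type*} (s : Finset ι) (φ : ι → ℝ) :
    |Real.sin (∑ i ∈ s, φ i)| ≤ ∑ i ∈ s, |Real.sin (φ i)| := by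
  classical
  induction s using Finset.induction_on with
  | empty => simp
  | insert i s hi ih =>
    rw [Finset.sum_insert hi, Finset.sum_insert hi, Real.sin_add]
    refine (abs_add_le _ _).trans (add_le_add ?_ (le_trans ?_ ih)) <;> rw [abs_mul]
    · exact mul_le_of_le_one_right (abs_nonneg _) (Real.abs_cos_le_one _)
    · exact mul_le_of_le_one_left (abs_nonneg _) (Real.abs_cos_le_one _)

theorem abs_sin_int_mul_le (m : ℤ) (t : ℝ) : |Real.sin (t * m)| ≤ |(m : ℝ)| * |Real.sin t| := by
  have h : ∀ n : ℕ, |Real.sin (t * n)| ≤ n * |Real.sin t| := fun n => by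
    have := abs_sin_sum_le (Finset.range n) fun _ => t
    simpa [mul_comm] using this
  obtain ⟨n, rfl | rfl⟩ := m.eq_nat_or_neg
  · simpa using h n
  · simpa using h n

theorem one_sub_cos_eq (t : ℝ) : 1 - Real.cos t = 2 * |Real.sin (t / 2)| ^ 2 := by
  have h1 := Real.cos_two_mul (t / 2)
  have h2 := Real.sin_sq_add_cos_sq (t / 2)
  rw [show 2 * (t / 2) = t by ring] at h1
  rw [sq_abs]
  linarith

theorem one_sub_cos_phase_le (hd : 0 < d) (k : Fin d → ℝ) (x : Fin d → ℤ) :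
    1 - Real.cos (phase k x) ≤ d * (1 - cosMean d k) * sqLen x := by
  have hd' : (d : ℝ) ≠ 0 := by positivity
  have h1 : |Real.sin (phase k x / 2)| ≤ ∑ i, |(x i : ℝ)| * |Real.sin (k i / 2)| := by
    unfold phase
    rw [Finset.sum_div]
    refine (abs_sin_sum_le _ _).trans (Finset.sum_le_sum fun i _ => ?_)
    rw [mul_div_right_comm]
    exact abs_sin_int_mul_le _ _
  have h2 : (d : ℝ) * (1 - cosMean d k) = ∑ i, 2 * |Real.sin (k i / 2)| ^ 2 := by
    have := one_sub_mul_cosMean hd k 1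
    simp only [one_mul] at this
    rw [this, mul_div_cancel₀ _ hd']
    exact Finset.sum_congr rfl fun i _ => one_sub_cos_eq _
  have h3 : sqLen x = ∑ i, |(x i : ℝ)| ^ 2 := by simp [sqLen]
  rw [one_sub_cos_eq, h2, h3, ← Finset.mul_sum]
  have h4 := Finset.sum_mul_sq_le_sq_mul_sq Finset.univ (fun i => |(x i : ℝ)|)
    fun i => |Real.sin (k i / 2)|
  have h5 := pow_le_pow_left₀ (abs_nonneg _) h1 2
  linarith

theorem abs_fourier_le {z : ℝ} (hz : 0 ≤ z) (n : ℕ) (G : List (Fin d × Bool) → ℝ) (k : Fin d → ℝ) :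
    |fourier z n G k| ≤ walkSum z n fun l => |G l| := by
  unfold fourier walkSum
  rw [abs_mul, abs_of_nonneg (pow_nonneg hz n)]
  gcongr
  refine (Finset.abs_sum_le_sum_abs _ _).trans (Finset.sum_le_sum fun v _ => ?_)
  rw [abs_mul]
  exact mul_le_of_le_one_right (abs_nonneg _) (Real.abs_cos_le_one _)

theorem walkSum_neg_real (z : ℝ) (n : ℕ) (G : List (Fin d × Bool) → ℝ) :
    walkSum z n (fun l => -G l) = -walkSum z n G := by
  have := walkSum_mul_left z n (-1) G
  simpa using this

theorem fourier_zero_sub (z : ℝ) (n : ℕ) (G : List (Fin d × Bool) → ℝ) (k : Fin d → ℝ) :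
    fourier z n G 0 - fourier z n G k =
      walkSum z n fun l => G l * (1 - Real.cos (phase k (endpt l))) := by
  rw [fourier_zero_right, fourier, sub_eq_add_neg, ← walkSum_neg_real, ← walkSum_add]
  exact walkSum_congr z fun l _ => by ring

theorem abs_fourier_sub_le (hd : 0 < d) {z : ℝ} (hz : 0 ≤ z) (n : ℕ)
    (G : List (Fin d × Bool) → ℝ) (k : Fin d → ℝ) :
    |fourier z n G 0 - fourier z n G k| ≤
      d * (1 - cosMean d k) * walkSum z n fun l => |G l| * sqLen (endpt l) := by
  rw [fourier_zero_sub, ← walkSum_mul_left]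
  unfold walkSum
  rw [abs_mul, abs_of_nonneg (pow_nonneg hz n)]
  gcongr
  refine (Finset.abs_sum_le_sum_abs _ _).trans (Finset.sum_le_sum fun v _ => ?_)
  rw [abs_mul, abs_of_nonneg (sub_nonneg.2 (Real.cos_le_one _))]
  calc _ ≤ |G (List.ofFn v)| * (d * (1 - cosMean d k) * sqLen (endpt (List.ofFn v))) := by
        gcongr
        exact one_sub_cos_phase_le hd k _
    _ = _ := by ring

theorem neg_one_zpow_sum_endpt (l : List (Fin d × Bool)) :
    (-1 : ℝ) ^ (∑ i, endpt l i) = (-1) ^ l.length := by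
  induction l with
  | nil => simp
  | cons e l ih =>
    obtain ⟨i, b⟩ := e
    have h : ∑ j, wsawStep d (i, b) j = if b then 1 else -1 := by
      unfold wsawStep
      simp
    rw [endpt_cons, List.length_cons, pow_succ']
    simp only [Pi.add_apply, Finset.sum_add_distrib]
    rw [zpow_add₀ (by norm_num), ih, h]
    cases b <;> simp

theorem fourier_add_pi (z : ℝ) (n : ℕ) (G : List (Fin d × Bool) → ℝ) (k : Fin d → ℝ) :
    fourier z n G (fun i => k i + Real.pi) = (-1) ^ n * fourier z n G k := by
  unfold fourier
  rw [← walkSum_mul_left]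
  refine walkSum_congr z fun l hl => ?_
  have h : phase (fun i => k i + Real.pi) (endpt l) =
      phase k (endpt l) + (∑ i, endpt l i : ℤ) * Real.pi := by
    unfold phase
    push_cast
    rw [Finset.sum_mul, ← Finset.sum_add_distrib]
    exact Finset.sum_congr rfl fun i _ => by ring
  rw [h, Real.cos_add_int_mul_pi, neg_one_zpow_sum_endpt, hl]
  ring

theorem cosMean_add_pi (k : Fin d → ℝ) : cosMean d (fun i => k i + Real.pi) = -cosMean d k := by
  simp [cosMean, Finset.sum_neg_distrib, neg_div]

end Fourier

end WSAW

namespace WSAW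

open Finset Lace MeasureTheory
open scoped ENNReal

section Inversion

variable {d : ℕ}

theorem integral_exp_int_mul (w : ℤ) :
    ∫ t in (-Real.pi)..Real.pi, Complex.exp (w * Complex.I * t) =
      if w = 0 then ((2 * Real.pi : ℝ) : ℂ) else 0 := by
  split_ifs with h
  · subst h
    simp
    ring
  · have hw : (w : ℂ) * Complex.I ≠ 0 := mul_ne_zero (by exact_mod_cast h) Complex.I_ne_zero
    rw [integral_exp_mul_complex hw]
    have : Complex.exp (w * Complex.I * (Real.pi : ℝ)) =
        Complex.exp (w * Complex.I * (-Real.pi : ℝ)) := by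
      rw [Complex.exp_eq_exp_iff_exists_int]
      exact ⟨w, by push_cast; ring⟩
    rw [this, sub_self, zero_div]

theorem integral_cos_phase (w : Fin d → ℤ) :
    ∫ k, Real.cos (phase k w) ∂(torusMeasure d) = if w = 0 then (2 * Real.pi) ^ d else 0 := by
  have h1 : ∀ k : Fin d → ℝ, Complex.exp (phase k w * Complex.I) =
      ∏ i, Complex.exp (w i * Complex.I * k i) := fun k => by
    rw [← Complex.exp_sum, phase]
    congr 1
    push_cast
    rw [Finset.sum_mul]
    exact Finset.sum_congr rfl fun i _ => by ring
  have h2 : ∫ k, Complex.exp (phase k w * Complex.I) ∂(torusMeasure d) =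
      ((if w = 0 then (2 * Real.pi) ^ d else 0 : ℝ) : ℂ) := by
    simp_rw [h1]
    unfold torusMeasure
    rw [integral_fintype_prod_eq_prod (𝕜 := ℂ)
      (f := fun i (t : ℝ) => Complex.exp (w i * Complex.I * t))]
    have h3 : ∀ i, ∫ t in Set.Ioc (-Real.pi) Real.pi, Complex.exp (w i * Complex.I * t) =
        if w i = 0 then ((2 * Real.pi : ℝ) : ℂ) else 0 := fun i => by
      rw [← intervalIntegral.integral_of_le (by linarith [Real.pi_pos])]
      exact integral_exp_int_mul (w i)
    rw [Finset.prod_congr rfl fun i _ => h3 i]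
    split_ifs with hw
    · subst hw
      simp
    · obtain ⟨i, hi⟩ := Function.ne_iff.1 hw
      rw [Complex.ofReal_zero]
      exact Finset.prod_eq_zero (Finset.mem_univ i) (if_neg hi)
  have hc : Continuous fun k : Fin d → ℝ => Complex.exp (phase k w * Complex.I) := by
    unfold phase
    fun_prop
  have hi : Integrable (fun k : Fin d → ℝ => Complex.exp (phase k w * Complex.I))
      (torusMeasure d) :=
    Integrable.of_bound hc.aestronglyMeasurable 1
      (Filter.Eventually.of_forall fun k => by rw [Complex.norm_exp_ofReal_mul_I])
  have h4 := integral_re hi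
  simp only [RCLike.re_to_complex, Complex.exp_ofReal_mul_I_re] at h4
  rw [h4, h2, Complex.ofReal_re]

theorem integrable_cos_phase (w : Fin d → ℤ) :
    Integrable (fun k : Fin d → ℝ => Real.cos (phase k w)) (torusMeasure d) := by
  have hc : Continuous fun k : Fin d → ℝ => Real.cos (phase k w) := by
    unfold phase
    fun_prop
  exact Integrable.of_bound hc.aestronglyMeasurable 1
    (Filter.Eventually.of_forall fun k => Real.abs_cos_le_one _)

theorem cos_phase_mul (k : Fin d → ℝ) (x y : Fin d → ℤ) :
    Real.cos (phase k x) * Real.cos (phase k y) =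
      2⁻¹ * (Real.cos (phase k (x + -y)) + Real.cos (phase k (x + y))) := by
  rw [phase_add, phase_add, phase_neg, Real.cos_add, Real.cos_add, Real.cos_neg, Real.sin_neg]
  ring

theorem integral_fourier_mul_cos (z : ℝ) (n : ℕ) (G : List (Fin d × Bool) → ℝ) (x : Fin d → ℤ) :
    ∫ k, fourier z n G k * Real.cos (phase k x) ∂(torusMeasure d) =
      walkSum z n fun l => G l * (2⁻¹ * ((if endpt l + -x = 0 then (2 * Real.pi) ^ d else 0) +
        if endpt l + x = 0 then (2 * Real.pi) ^ d else 0)) := by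
  have hi : ∀ y : Fin d → ℤ, Integrable (fun k : Fin d → ℝ => 2⁻¹ * (Real.cos (phase k (y + -x)) +
      Real.cos (phase k (y + x)))) (torusMeasure d) := fun y =>
    ((integrable_cos_phase _).add (integrable_cos_phase _)).const_mul _
  have h : ∀ k : Fin d → ℝ, fourier z n G k * Real.cos (phase k x) =
      z ^ n * ∑ v : Fin n → Fin d × Bool, G (List.ofFn v) * (2⁻¹ *
        (Real.cos (phase k (endpt (List.ofFn v) + -x)) +
        Real.cos (phase k (endpt (List.ofFn v) + x)))) := fun k => by
    rw [fourier, walkSum, mul_assoc, Finset.sum_mul]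
    congr 1
    refine Finset.sum_congr rfl fun v _ => ?_
    rw [← cos_phase_mul]
    ring
  simp_rw [h]
  rw [integral_const_mul, integral_finsetSum _ fun v _ => (hi _).const_mul _, walkSum]
  congr 1
  refine Finset.sum_congr rfl fun v _ => ?_
  rw [integral_const_mul, integral_const_mul,
    integral_add (integrable_cos_phase _) (integrable_cos_phase _), integral_cos_phase,
    integral_cos_phase]

theorem continuous_fourier (z : ℝ) (n : ℕ) (G : List (Fin d × Bool) → ℝ) :
    Continuous (fourier z n G) := by
  unfold fourier walkSum phase
  fun_prop

theorem integrable_fourier {z : ℝ} (hz : 0 ≤ z) (n : ℕ) (G : List (Fin d × Bool) → ℝ) :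
    Integrable (fourier z n G) (torusMeasure d) :=
  Integrable.of_bound (continuous_fourier z n G).aestronglyMeasurable _
    (Filter.Eventually.of_forall fun k => abs_fourier_le hz n G k)

theorem walkSum_endpt_le {z : ℝ} (hz : 0 ≤ z) (n : ℕ) {G : List (Fin d × Bool) → ℝ}
    (hG : ∀ l, 0 ≤ G l) (x : Fin d → ℤ) :
    (walkSum z n fun l => if endpt l = x then G l else 0) ≤
      2 * ((2 * Real.pi) ^ d)⁻¹ * ∫ k, |fourier z n G k| ∂(torusMeasure d) := by
  have hpi := Real.pi_pos
  have h1 : 2⁻¹ * (2 * Real.pi) ^ d * (walkSum z n fun l => if endpt l = x then G l else 0) ≤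
      ∫ k, fourier z n G k * Real.cos (phase k x) ∂(torusMeasure d) := by
    rw [integral_fourier_mul_cos, ← walkSum_mul_left]
    refine walkSum_mono_real hz fun l _ => ?_
    have h0 := hG l
    have h2 : (0 : ℝ) ≤ if endpt l + x = 0 then (2 * Real.pi) ^ d else 0 := by
      split_ifs <;> positivity
    by_cases h : endpt l = x
    · rw [if_pos h, if_pos (by rw [h, add_neg_cancel])]
      have := mul_nonneg h0 h2
      nlinarith
    · rw [if_neg h, mul_zero]
      have h3 : (0 : ℝ) ≤ if endpt l + -x = 0 then (2 * Real.pi) ^ d else 0 := by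
        split_ifs <;> positivity
      positivity
  have h2 : ∫ k, fourier z n G k * Real.cos (phase k x) ∂(torusMeasure d) ≤
      ∫ k, |fourier z n G k| ∂(torusMeasure d) := by
    refine integral_mono ?_ (integrable_fourier hz n G).abs fun k => ?_
    · refine (integrable_fourier hz n G).mul_bdd (c := 1)
        (integrable_cos_phase x).aestronglyMeasurable
        (Filter.Eventually.of_forall fun k => Real.abs_cos_le_one _)
    · refine (le_abs_self _).trans ?_
      rw [abs_mul]
      exact mul_le_of_le_one_right (abs_nonneg _) (Real.abs_cos_le_one _)
  have h3 := h1.trans h2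
  have h4 : (0 : ℝ) < (2 * Real.pi) ^ d := by positivity
  rw [mul_assoc, ← div_le_iff₀' (by norm_num), ← div_eq_inv_mul, le_div_iff₀ h4]
  linarith

end Inversion

section Sequences

theorem sum_Ioc_rpow_le {s : ℝ} (hs : 0 < s) {n N : ℕ} (h : n ≤ N) :
    ∑ m ∈ Ioc n N, ((m : ℝ) + 1) ^ (-(s + 1)) ≤
      s⁻¹ * (((n : ℝ) + 1) ^ (-s) - ((N : ℝ) + 1) ^ (-s)) := by
  induction N, h using Nat.le_induction with
  | base => simp
  | succ N h ih =>
    rw [Finset.sum_Ioc_succ_top (by omega)]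
    have hx : (0 : ℝ) < (N : ℝ) + 1 + 1 := by positivity
    have h1 : s * ((N : ℝ) + 1 + 1) ^ (-(s + 1)) ≤
        ((N : ℝ) + 1) ^ (-s) - ((N : ℝ) + 1 + 1) ^ (-s) := by
      have e1 : ((N : ℝ) + 1 + 1) ^ (-(s + 1)) =
          ((N : ℝ) + 1 + 1) ^ (-s) * ((N : ℝ) + 1 + 1)⁻¹ := by
        rw [neg_add, Real.rpow_add hx, Real.rpow_neg_one]
      have e2 : (N : ℝ) + 1 = ((N : ℝ) + 1 + 1) * (1 - ((N : ℝ) + 1 + 1)⁻¹) := by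
        field_simp
        ring
      have h2 : ((N : ℝ) + 1 + 1)⁻¹ < 1 := inv_lt_one_of_one_lt₀ (by
        have : (0 : ℝ) ≤ N := Nat.cast_nonneg N
        linarith)
      have h3 : 1 + s * ((N : ℝ) + 1 + 1)⁻¹ ≤ (1 - ((N : ℝ) + 1 + 1)⁻¹) ^ (-s) := by
        rw [Real.rpow_def_of_pos (by linarith)]
        have h4 := Real.log_le_sub_one_of_pos (x := 1 - ((N : ℝ) + 1 + 1)⁻¹) (by linarith)
        have h5 := Real.add_one_le_exp (Real.log (1 - ((N : ℝ) + 1 + 1)⁻¹) * -s)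
        nlinarith
      have h6 : ((N : ℝ) + 1) ^ (-s) =
          ((N : ℝ) + 1 + 1) ^ (-s) * (1 - ((N : ℝ) + 1 + 1)⁻¹) ^ (-s) := by
        rw [← Real.mul_rpow hx.le (by linarith), ← e2]
      rw [e1, h6]
      have := mul_le_mul_of_nonneg_left h3 (Real.rpow_nonneg hx.le (-s))
      linarith
    have h2 : ((N : ℝ) + 1 + 1) ^ (-(s + 1)) ≤
        s⁻¹ * (((N : ℝ) + 1) ^ (-s) - ((N : ℝ) + 1 + 1) ^ (-s)) := by
      rw [inv_mul_eq_div, le_div_iff₀ hs]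
      linarith
    push_cast
    linarith

theorem sum_Ioc_decay_le {d : ℕ} (hd : 4 < d) {n N : ℕ} (h : n ≤ N) :
    ∑ m ∈ Ioc n N, decay d m ≤ (n + 1) * decay d n := by
  have hd' : (5 : ℝ) ≤ d := by exact_mod_cast hd
  have h1 := sum_Ioc_rpow_le (s := (d : ℝ) / 2 - 1) (by linarith) h
  have h2 : ((n : ℝ) + 1) * decay d n = ((n : ℝ) + 1) ^ (-((d : ℝ) / 2 - 1)) := by
    unfold decay
    rw [show -((d : ℝ) / 2 - 1) = 1 + -((d : ℝ) / 2) by ring, Real.rpow_add (by positivity),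
      Real.rpow_one]
  rw [h2]
  simp only [sub_add_cancel] at h1
  unfold decay
  refine h1.trans ?_
  have h3 : 0 ≤ ((N : ℝ) + 1) ^ (-((d : ℝ) / 2 - 1)) := by positivity
  have h4 : 0 ≤ ((n : ℝ) + 1) ^ (-((d : ℝ) / 2 - 1)) := by positivity
  have h5 : ((d : ℝ) / 2 - 1)⁻¹ ≤ 1 := inv_le_one_of_one_le₀ (by linarith)
  have h6 : 0 ≤ ((d : ℝ) / 2 - 1)⁻¹ := by
    apply inv_nonneg.2
    linarith
  nlinarith

theorem sum_Icc_one_eq (g : ℕ → ℝ) (n : ℕ) : ∑ m ∈ Icc 1 n, g m = ∑ m ∈ range n, g (m + 1) := by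
  induction n with
  | zero => simp
  | succ n ih => rw [Finset.sum_Icc_succ_top (by omega), ih, Finset.sum_range_succ]

theorem mk_eq_one_add_mul {f p : ℕ → ℝ} (h0 : f 0 = 1)
    (hf : ∀ n, 1 ≤ n → f n = ∑ m ∈ Icc 1 n, p m * f (n - m)) :
    PowerSeries.mk f * (1 - PowerSeries.mk fun m => if m = 0 then 0 else p m) = 1 := by
  have : PowerSeries.mk f = 1 + (PowerSeries.mk fun m => if m = 0 then 0 else p m) *
      PowerSeries.mk f := by
    ext n
    rw [map_add, PowerSeries.coeff_mul, PowerSeries.coeff_mk, PowerSeries.coeff_one,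
      Finset.Nat.sum_antidiagonal_eq_sum_range_succ_mk]
    simp only [PowerSeries.coeff_mk]
    rw [Finset.sum_range_succ']
    rcases n.eq_zero_or_pos with rfl | hn
    · simp [h0]
    · rw [if_neg hn.ne', hf n hn, if_pos rfl, zero_mul, add_zero, zero_add,
        sum_Icc_one_eq]
      refine Finset.sum_congr rfl fun m _ => ?_
      rw [if_neg (Nat.succ_ne_zero m)]
  linear_combination this

theorem abs_sub_le_of_renewal {f f' p p' : ℕ → ℝ} {K E : ℝ} {N : ℕ} (h0 : f 0 = 1) (h0' : f' 0 = 1)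
    (hf : ∀ n, 1 ≤ n → f n = ∑ m ∈ Icc 1 n, p m * f (n - m))
    (hf' : ∀ n, 1 ≤ n → f' n = ∑ m ∈ Icc 1 n, p' m * f' (n - m))
    (hK : ∀ n ≤ N, |f n| ≤ K) (hK' : ∀ n ≤ N, |f' n| ≤ K)
    (hE : ∑ m ∈ Icc 1 N, |p m - p' m| ≤ E) {n : ℕ} (hn : n ≤ N) :
    |f n - f' n| ≤ K ^ 2 * (n + 1) * E := by
  set P := PowerSeries.mk fun m => if m = 0 then 0 else p m
  set P' := PowerSeries.mk fun m => if m = 0 then 0 else p' m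
  have hK0 : 0 ≤ K := (abs_nonneg _).trans (hK 0 (Nat.zero_le _))
  have h1 := mk_eq_one_add_mul h0 hf
  have h2 := mk_eq_one_add_mul h0' hf'
  have h3 : PowerSeries.mk f - PowerSeries.mk f' =
      (P - P') * (PowerSeries.mk f * PowerSeries.mk f') := by
    linear_combination PowerSeries.mk f' * h1 - PowerSeries.mk f * h2
  have h4 := congrArg (PowerSeries.coeff n) h3
  rw [map_sub, PowerSeries.coeff_mk, PowerSeries.coeff_mk, PowerSeries.coeff_mul,
    Finset.Nat.sum_antidiagonal_eq_sum_range_succ_mk] at h4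
  have h5 : ∀ j ≤ N, |PowerSeries.coeff j (PowerSeries.mk f * PowerSeries.mk f')| ≤
      (j + 1) * (K * K) := by
    intro j hj
    rw [PowerSeries.coeff_mul, Finset.Nat.sum_antidiagonal_eq_sum_range_succ_mk]
    refine (Finset.abs_sum_le_sum_abs _ _).trans ?_
    refine (Finset.sum_le_card_nsmul _ _ (K * K) fun i hi => ?_).trans (le_of_eq (by simp))
    have := mem_range.1 hi
    simp only [PowerSeries.coeff_mk]
    rw [abs_mul]
    gcongr
    · exact hK _ (by omega)
    · exact hK' _ (by omega)
  rw [h4, Finset.sum_range_succ']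
  have h6 : PowerSeries.coeff 0 (P - P') = 0 := by simp [P, P']
  rw [h6, zero_mul, add_zero]
  calc _ ≤ ∑ m ∈ range n, |p (m + 1) - p' (m + 1)| * ((n + 1) * (K * K)) := by
        refine (Finset.abs_sum_le_sum_abs _ _).trans (Finset.sum_le_sum fun m hm => ?_)
        have := mem_range.1 hm
        have h7 : PowerSeries.coeff (m + 1) (P - P') = p (m + 1) - p' (m + 1) := by simp [P, P']
        rw [abs_mul, h7]
        gcongr
        refine (h5 _ (by omega)).trans ?_
        gcongr
        omega
    _ = (∑ m ∈ Icc 1 n, |p m - p' m|) * ((n + 1) * (K * K)) := by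
        rw [← Finset.sum_mul, sum_Icc_one_eq]
    _ ≤ E * ((n + 1) * (K * K)) := by
        gcongr
        refine le_trans (Finset.sum_le_sum_of_subset_of_nonneg ?_ fun _ _ _ => abs_nonneg _) hE
        exact Finset.Icc_subset_Icc_right hn
    _ = _ := by ring

end Sequences

end WSAW

namespace WSAW

open Finset Lace MeasureTheory
open scoped ENNReal

section Diffusive

variable {d : ℕ}

/-- Real-valued bounds on the lace expansion coefficient of order `m`. -/
def LaceBound (d m : ℕ) (z β δ : ℝ) : Prop :=
  (walkSum z m fun l : List (Fin d × Bool) => |laceWt β m l|) ≤ δ * decay d m ∧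
  (walkSum z m fun l : List (Fin d × Bool) => |laceWt β m l| * sqLen (endpt l)) ≤
    δ * ((m + 1) * decay d m)

theorem laceBound_of_laceNorm_le {m : ℕ} {z β δ : ℝ} (hz : 0 ≤ z) (hδ : 0 ≤ δ)
    (h : laceNorm d m (ENNReal.ofReal z) β ≤ ENNReal.ofReal (δ * decay d m)) :
    LaceBound d m z β δ := by
  have h7 := (decay_pos d m).le
  constructor
  · rw [← ENNReal.ofReal_le_ofReal_iff (by positivity), ofReal_walkSum hz fun _ => abs_nonneg _]
    refine le_trans (walkSum_mono _ fun l _ => ?_) h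
    rw [← Real.enorm_eq_ofReal_abs]
    exact le_mul_of_one_le_left zero_le (one_le_rho _ _)
  · rw [← ENNReal.ofReal_le_ofReal_iff (by positivity),
      ofReal_walkSum hz fun l => mul_nonneg (abs_nonneg _) (sqLen_nonneg _)]
    have h1 : ENNReal.ofReal (δ * ((m + 1) * decay d m)) =
        ((m : ℝ≥0∞) + 1) * ENNReal.ofReal (δ * decay d m) := by
      have : ((m : ℝ≥0∞) + 1) = ENNReal.ofReal (m + 1) := by
        rw [ENNReal.ofReal_add (by positivity) zero_le_one]
        simp
      rw [this, ← ENNReal.ofReal_mul (by positivity)]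
      congr 1
      ring
    rw [h1]
    refine le_trans ?_ (mul_le_mul_right h ((m : ℝ≥0∞) + 1))
    rw [laceNorm, ← walkSum_mul_left]
    refine walkSum_mono _ fun l _ => ?_
    rw [ENNReal.ofReal_mul (abs_nonneg _), ← Real.enorm_eq_ofReal_abs, mul_comm, ← mul_assoc]
    gcongr
    · have h2 : ((m : ℝ≥0∞) + 1) * ((m : ℝ≥0∞) + 1)⁻¹ = 1 :=
        ENNReal.mul_inv_cancel (by simp) (by finiteness)
      have h3 : esqLen (endpt l) * ((m : ℝ≥0∞) + 1)⁻¹ ≤ rho m (endpt l) := by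
        unfold rho
        calc _ = 1 * (0 + esqLen (endpt l) * ((m : ℝ≥0∞) + 1)⁻¹) := by ring
          _ ≤ _ := by gcongr <;> norm_num
      calc ENNReal.ofReal (sqLen (endpt l)) =
            ((m : ℝ≥0∞) + 1) * ((m : ℝ≥0∞) + 1)⁻¹ * esqLen (endpt l) := by
            rw [h2, one_mul, esqLen]
        _ = ((m : ℝ≥0∞) + 1) * (esqLen (endpt l) * ((m : ℝ≥0∞) + 1)⁻¹) := by ring
        _ ≤ _ := by gcongr
    · exact le_rfl

/-- The truncated lace expansion function whose root approximates the critical point. -/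
noncomputable def rootSum (d : ℕ) (β : ℝ) (N : ℕ) (z : ℝ) : ℝ :=
  2 * d * z + ∑ m ∈ Icc 2 N, walkSum z m (laceWt (d := d) β m)

theorem abs_walkSum_le {z : ℝ} (hz : 0 ≤ z) (n : ℕ) (G : List (Fin d × Bool) → ℝ) :
    |walkSum z n G| ≤ walkSum z n fun l => |G l| := by
  have := abs_fourier_le hz n G 0
  rwa [fourier_zero_right] at this

theorem abs_one_sub_rootSum_le (hd : 4 < d) {z β δ : ℝ} {N : ℕ} (hz : 0 ≤ z) (hδ : 0 ≤ δ)
    (hπ : ∀ m ∈ Icc 2 N, LaceBound d m z β δ) (hroot : rootSum d β N z = 1) {n : ℕ} (hn : n ≤ N) :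
    |1 - rootSum d β n z| ≤ δ * ((n + 1) * decay d n) := by
  have h1 : 1 - rootSum d β n z =
      ∑ m ∈ Icc 2 N \ Icc 2 n, walkSum z m (laceWt (d := d) β m) := by
    have := Finset.sum_sdiff (f := fun m => walkSum z m (laceWt (d := d) β m))
      (Finset.Icc_subset_Icc_right (a := 2) hn)
    rw [← hroot, rootSum, rootSum]
    linarith
  rw [h1]
  calc _ ≤ ∑ m ∈ Icc 2 N \ Icc 2 n, δ * decay d m := by
        refine (Finset.abs_sum_le_sum_abs _ _).trans (Finset.sum_le_sum fun m hm => ?_)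
        exact (abs_walkSum_le hz m _).trans (hπ m (Finset.mem_sdiff.1 hm).1).1
    _ ≤ ∑ m ∈ Ioc n N, δ * decay d m := by
        refine Finset.sum_le_sum_of_subset_of_nonneg (fun m hm => ?_)
          fun m _ _ => mul_nonneg hδ (decay_pos d m).le
        simp only [Finset.mem_sdiff, mem_Icc, mem_Ioc] at *
        omega
    _ ≤ _ := by
        rw [← Finset.mul_sum]
        exact mul_le_mul_of_nonneg_left (sum_Ioc_decay_le hd hn) hδ

theorem fourier_wt_zero (z β : ℝ) (k : Fin d → ℝ) : fourier z 0 (wt β) k = 1 := by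
  simp [fourier, walkSum_zero, wt, pairProd, phase]

theorem fourier_wt_succ (hd : 0 < d) (z β : ℝ) (k : Fin d → ℝ) (n : ℕ) :
    fourier z (n + 1) (wt β) k = 2 * d * z * cosMean d k * fourier z n (wt β) k +
      ∑ m ∈ Icc 2 (n + 1), fourier z m (laceWt β m) k * fourier z (n + 1 - m) (wt β) k := by
  rw [fourier_wt_eq_sum z β (by omega) k, ← Finset.add_sum_Ioc_eq_sum_Icc (by omega : 1 ≤ n + 1),
    fourier_laceWt_one hd, Nat.add_sub_cancel]
  rfl

theorem cosMean_le_one (hd : 0 < d) (k : Fin d → ℝ) : cosMean d k ≤ 1 := by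
  have := one_sub_mul_cosMean hd k 1
  have h2 : 0 ≤ (∑ i, (1 - 1 * Real.cos (k i))) / (d : ℝ) :=
    div_nonneg (Finset.sum_nonneg fun i _ => one_sub_mul_cos_nonneg (by simp) _) (by positivity)
  linarith

theorem renewal_fourier (hd : 4 < d) {z β δ : ℝ} {N : ℕ} (hz : 0 ≤ z) (hδ : 0 ≤ δ)
    (hπ : ∀ m ∈ Icc 2 N, LaceBound d m z β δ) (hroot : rootSum d β N z = 1)
    {k : Fin d → ℝ} (hk : 0 ≤ cosMean d k) :
    Renewal d N (2 * d * z) (d * δ) (1 - cosMean d k)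
      (fun m => (fourier z m (laceWt β m) k : ℂ))
      (fun m => (fourier z m (laceWt (d := d) β m) 0 : ℂ))
      (fun n => (fourier z n (wt β) k : ℂ)) := by
  have hd1 : (4 : ℝ) < d := by exact_mod_cast hd
  have ha := cosMean_le_one (by omega : 0 < d) k
  have hδd : δ ≤ d * δ := le_mul_of_one_le_left hδ (by linarith)
  refine ⟨by linarith, by linarith, by positivity, ?_, ?_, ?_, ?_, ?_⟩
  · simp [fourier_wt_zero]
  · intro n _
    have := fourier_wt_succ (by omega : 0 < d) z β k n
    rw [this]
    push_cast
    ring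
  · intro m hm2 hmN
    have h1 := (hπ m (mem_Icc.2 ⟨hm2, hmN⟩)).1
    rw [Complex.norm_real, Real.norm_eq_abs]
    refine ((abs_fourier_le hz m _ _).trans h1).trans ?_
    have := (decay_pos d m).le
    gcongr
  · intro m hm2 hmN
    obtain ⟨h1, h2⟩ := hπ m (mem_Icc.2 ⟨hm2, hmN⟩)
    have h7 := (decay_pos d m).le
    rw [← Complex.ofReal_sub, Complex.norm_real, Real.norm_eq_abs, abs_sub_comm]
    rw [min_mul_of_nonneg _ _ h7, mul_min_of_nonneg _ _ (by positivity)]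
    refine le_min ?_ ?_
    · refine (abs_fourier_sub_le (by omega) hz m _ _).trans ?_
      calc _ ≤ d * (1 - cosMean d k) * (δ * ((m + 1) * decay d m)) := by
            have : 0 ≤ 1 - cosMean d k := by linarith
            gcongr
        _ = _ := by ring
    · have h3 := (abs_fourier_le hz m (laceWt (d := d) β m) 0).trans h1
      have h4 := (abs_fourier_le hz m (laceWt β m) k).trans h1
      have h5 := abs_sub (fourier z m (laceWt (d := d) β m) 0) (fourier z m (laceWt β m) k)
      have h6 : 0 ≤ ((d : ℝ) - 2) * (δ * decay d m) := by
        apply mul_nonneg (by linarith) (by positivity)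
      linarith
  · intro n hn
    have h1 := abs_one_sub_rootSum_le hd hz hδ hπ hroot hn
    have h2 : (1 : ℂ) - ((2 * d * z : ℝ) : ℂ) -
        ∑ m ∈ Icc 2 n, (fourier z m (laceWt (d := d) β m) 0 : ℂ) =
        ((1 - rootSum d β n z : ℝ) : ℂ) := by
      rw [rootSum]
      simp only [fourier_zero_right]
      push_cast
      ring
    rw [h2, Complex.norm_real, Real.norm_eq_abs]
    refine h1.trans ?_
    have := (decay_pos d n).le
    gcongr

theorem abs_endpt_le (l : List (Fin d × Bool)) (i : Fin d) : |(endpt l i : ℝ)| ≤ l.length := by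
  induction l with
  | nil => simp
  | cons e l ih =>
    rw [endpt_cons, List.length_cons]
    simp only [Pi.add_apply]
    push_cast
    have h : |(wsawStep d e i : ℝ)| ≤ 1 := by
      unfold wsawStep
      split_ifs <;> simp
    exact (abs_add_le _ _).trans (by linarith)

theorem cosMean_single (hd : 0 < d) (i : Fin d) (t : ℝ) :
    1 - cosMean d (Pi.single i t) = (1 - Real.cos t) / d := by
  have := one_sub_mul_cosMean hd (Pi.single i t) 1
  simp only [one_mul] at this
  rw [this, Finset.sum_eq_single i]
  · simp
  · intro j _ hj
    simp [Pi.single_eq_of_ne hj]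
  · simp

theorem phase_single (i : Fin d) (t : ℝ) (x : Fin d → ℤ) : phase (Pi.single i t) x = t * x i := by
  unfold phase
  rw [Finset.sum_eq_single i]
  · simp
  · intro j _ hj
    simp [Pi.single_eq_of_ne hj]
  · simp

theorem walkSum_sq_coord_le {z β : ℝ} (hz : 0 ≤ z) (h1 : β ≤ 1) {n : ℕ} (hn : 1 ≤ n) (i : Fin d) :
    (walkSum z n fun l => wt β l * (endpt l i : ℝ) ^ 2) ≤ n ^ 2 / 2 *
      |fourier z n (wt (d := d) β) 0 - fourier z n (wt β) (Pi.single i (Real.pi / n))| := by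
  have hpi := Real.pi_pos
  have hn0 : (0 : ℝ) < n := by exact_mod_cast hn
  refine le_trans ?_ (mul_le_mul_of_nonneg_left (le_abs_self _) (by positivity))
  rw [fourier_zero_sub, ← walkSum_mul_left]
  refine walkSum_mono_real hz fun l hl => ?_
  rw [phase_single]
  have h2 : |Real.pi / n * (endpt l i : ℝ)| ≤ Real.pi := by
    have := abs_endpt_le l i
    rw [hl] at this
    rw [abs_mul, abs_of_pos (by positivity), div_mul_eq_mul_div, div_le_iff₀ hn0]
    gcongr
  have h3 := two_div_pi_sq_mul_sq_le h2
  have h4 : (endpt l i : ℝ) ^ 2 =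
      n ^ 2 / 2 * (2 / Real.pi ^ 2 * (Real.pi / n * (endpt l i : ℝ)) ^ 2) := by
    field_simp
  have h5 := wt_nonneg h1 l
  calc _ = wt β l * (n ^ 2 / 2 * (2 / Real.pi ^ 2 * (Real.pi / n * (endpt l i : ℝ)) ^ 2)) := by
        rw [← h4]
    _ ≤ wt β l * (n ^ 2 / 2 * (1 - Real.cos (Real.pi / n * (endpt l i : ℝ)))) := by gcongr
    _ = _ := by ring

theorem exists_diffusive_of_laceBound (hd : 4 < d) : ∃ K δ₀ : ℝ, 1 ≤ K ∧ 0 < δ₀ ∧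
    ∀ (β z δ : ℝ) (N : ℕ), β ≤ 1 → 0 ≤ z → 0 ≤ δ → δ ≤ δ₀ →
    (∀ m ∈ Icc 2 N, LaceBound d m z β δ) → rootSum d β N z = 1 →
    ∀ n ≤ N, Diffusive d (ENNReal.ofReal z) β (ENNReal.ofReal K) n := by
  obtain ⟨C, hC, hintegral⟩ := exists_integral_le hd
  have hd1 : (4 : ℝ) < d := by exact_mod_cast hd
  have hd0 : 0 < d := by omega
  have hpi := Real.pi_pos
  have hk := Renewal.kernConst_nonneg d
  have hM := momSum_nonneg d
  have hi : 0 ≤ Renewal.incConst d := by unfold Renewal.incConst; positivity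
  have hf : 0 < Renewal.fourConst d := by
    have := one_le_heatConst d
    unfold Renewal.fourConst
    positivity
  have hKb : 0 ≤ 2 * ((2 * Real.pi) ^ d)⁻¹ * (Renewal.fourConst d * C) := by positivity
  have hKc : 0 ≤ Real.pi ^ 2 * (2 + momSum d) := by positivity
  refine ⟨2 + 2 * ((2 * Real.pi) ^ d)⁻¹ * (Renewal.fourConst d * C) + Real.pi ^ 2 * (2 + momSum d),
    (d * (1 + 2 * Renewal.kernConst d * Renewal.incConst d))⁻¹, by linarith, by positivity, ?_⟩
  set K := 2 + 2 * ((2 * Real.pi) ^ d)⁻¹ * (Renewal.fourConst d * C) +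
    Real.pi ^ 2 * (2 + momSum d) with hK
  intro β z δ N h1 hz hδ hδ0 hπ hroot n hn
  have hδ1 : d * δ * (1 + 2 * Renewal.kernConst d * Renewal.incConst d) ≤ 1 := by
    have := mul_le_mul_of_nonneg_right hδ0
      (by positivity : 0 ≤ d * (1 + 2 * Renewal.kernConst d * Renewal.incConst d))
    rw [inv_mul_cancel₀ (by positivity)] at this
    linarith
  have hdδ : 0 ≤ d * δ := by positivity
  have hdδ1 : d * δ ≤ 1 := by
    have : 0 ≤ d * δ * (2 * Renewal.kernConst d * Renewal.incConst d) := by positivity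
    linarith
  have hδ2 : 2 * Renewal.kernConst d * Renewal.incConst d * (d * δ) ≤ 1 := by linarith
  have hδ3 : 2 * Renewal.kernConst d * (d * δ) * (2 + momSum d) ≤ 1 := by
    refine le_trans ?_ hδ2
    unfold Renewal.incConst
    have : (1 : ℝ) ≤ 2 ^ (d + 2) := one_le_pow₀ (by norm_num)
    calc _ = 2 * Renewal.kernConst d * (1 * (2 + momSum d)) * (d * δ) := by ring
      _ ≤ _ := by gcongr
  have hren : ∀ k : Fin d → ℝ, 0 ≤ cosMean d k → _ := fun k hk =>
    renewal_fourier hd hz hδ hπ hroot hk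
  have hbd : ∀ k : Fin d → ℝ, 0 ≤ cosMean d k → ∀ n ≤ N, |fourier z n (wt β) k| ≤ 2 := by
    intro k hk n hn
    have := ((hren k hk).norm_le_heat_add hd hδ2 hn).2
    rw [Complex.norm_real, Real.norm_eq_abs] at this
    linarith
  have hcos0 : cosMean d (0 : Fin d → ℝ) = 1 := by
    have : (d : ℝ) ≠ 0 := by positivity
    simp [cosMean, this]
  refine ⟨?_, fun x => ?_, ?_⟩
  · have h2 := hbd 0 (by rw [hcos0]; norm_num) n hn
    rw [fourier_zero_right] at h2
    have h3 : walkSum z n (wt (d := d) β) ≤ K := (le_abs_self _).trans (h2.trans (by linarith))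
    have := ENNReal.ofReal_le_ofReal h3
    rwa [ofReal_walkSum hz (wt_nonneg h1)] at this
  · have h3 : (walkSum z n fun l : List (Fin d × Bool) => if endpt l = x then wt β l else 0) ≤
        K * decay d n := by
      have h7 := (decay_pos d n).le
      rcases n.eq_zero_or_pos with rfl | hn1
      · rw [walkSum_zero]
        have : decay d 0 = 1 := by simp [decay]
        rw [this, wt]
        split_ifs
        · simp [pairProd]
          linarith
        · linarith
      · have h4 := hintegral n hn1 (fun k => |fourier z n (wt β) k| * (Renewal.fourConst d)⁻¹)
          (fun k => by positivity) fun k => by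
            simp only [← div_eq_mul_inv]
            rw [div_le_iff₀' hf, div_le_iff₀' hf]
            rcases le_total 0 (cosMean d k) with hk | hk
            · left
              have := (hren k hk).norm_le hd hδ2 hdδ1 hn
              rwa [Complex.norm_real, Real.norm_eq_abs] at this
            · right
              have hk' : 0 ≤ cosMean d (fun i => k i + Real.pi) := by
                rw [cosMean_add_pi]
                linarith
              have := (hren _ hk').norm_le hd hδ2 hdδ1 hn
              rw [Complex.norm_real, Real.norm_eq_abs, fourier_add_pi, abs_mul, abs_pow, abs_neg,
                abs_one, one_pow, one_mul, cosMean_add_pi, sub_neg_eq_add] at this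
              exact this
        rw [integral_mul_const, ← div_eq_mul_inv, div_le_iff₀' hf] at h4
        refine (walkSum_endpt_le hz n (wt_nonneg h1) x).trans ?_
        calc _ ≤ 2 * ((2 * Real.pi) ^ d)⁻¹ * (Renewal.fourConst d * (C * decay d n)) := by gcongr
          _ = 2 * ((2 * Real.pi) ^ d)⁻¹ * (Renewal.fourConst d * C) * decay d n := by ring
          _ ≤ _ := by
            gcongr
            linarith
    have h5 := ENNReal.ofReal_le_ofReal h3
    rw [ofReal_walkSum hz fun l => by split_ifs; exacts [wt_nonneg h1 l, le_rfl],
      ENNReal.ofReal_mul (by linarith)] at h5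
    refine le_trans (le_of_eq (walkSum_congr _ fun l _ => ?_)) h5
    split_ifs <;> simp [ewt]
  · have h3 : (walkSum z n fun l : List (Fin d × Bool) => sqLen (endpt l) * wt β l) ≤
        K * (n + 1) := by
      rcases n.eq_zero_or_pos with rfl | hn1
      · rw [walkSum_zero]
        simp [sqLen]
        linarith
      · have hn0 : (1 : ℝ) ≤ n := by exact_mod_cast hn1
        have h2dz : 2 * d * z ≤ 2 := by
          have := abs_one_sub_rootSum_le hd hz hδ hπ hroot (Nat.zero_le N)
          have h8 : decay d 0 = 1 := by simp [decay]
          have h9 : δ ≤ d * δ := le_mul_of_one_le_left hδ (by linarith)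
          simp only [rootSum, h8, Nat.cast_zero, mul_one, zero_add,
            Finset.Icc_eq_empty (show ¬ 2 ≤ 0 by norm_num), Finset.sum_empty, add_zero] at this
          linarith [(abs_le.1 this).1]
        have hcoord : ∀ i : Fin d, (walkSum z n fun l => wt β l * (endpt l i : ℝ) ^ 2) ≤
            Real.pi ^ 2 * (2 + momSum d) * (n + 1) / d := by
          intro i
          refine (walkSum_sq_coord_le hz h1 hn1 i).trans ?_
          set t := Real.pi / n
          set k : Fin d → ℝ := Pi.single i t
          have ha : 1 - cosMean d k = (1 - Real.cos t) / d := cosMean_single hd0 i t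
          have ha2 : 1 - cosMean d k ≤ t ^ 2 / (2 * d) := by
            rw [ha, ← div_div]
            have := Real.one_sub_sq_div_two_le_cos (x := t)
            gcongr
            linarith
          have ha0 : 0 ≤ 1 - cosMean d k := by
            have := cosMean_le_one hd0 k
            linarith
          have hk : 0 ≤ cosMean d k := by
            have h8 : (1 - Real.cos t) / d ≤ 1 := by
              rw [div_le_one (by positivity)]
              linarith [Real.neg_one_le_cos t]
            linarith
          have hE : ∑ m ∈ Icc 1 n,
              |fourier z m (laceWt (d := d) β m) 0 - fourier z m (laceWt β m) k| ≤
              (1 - cosMean d k) * (2 + momSum d) := by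
            rw [← Finset.add_sum_Ioc_eq_sum_Icc hn1, fourier_laceWt_one hd0, fourier_laceWt_one hd0,
              hcos0, ← mul_sub, abs_mul, abs_of_nonneg ha0, abs_of_nonneg (by positivity)]
            have h8 : ∑ m ∈ Ioc 1 n,
                |fourier z m (laceWt (d := d) β m) 0 - fourier z m (laceWt β m) k| ≤
                (1 - cosMean d k) * momSum d := by
              calc _ ≤ ∑ m ∈ Ioc 1 n, (1 - cosMean d k) * ((m + 1) * decay d m) := by
                    refine Finset.sum_le_sum fun m hm => ?_
                    obtain ⟨hm1, hm2⟩ := mem_Ioc.1 hm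
                    refine (abs_fourier_sub_le hd0 hz m _ k).trans ?_
                    have h9 := (hπ m (mem_Icc.2 ⟨hm1, by omega⟩)).2
                    have h10 := (decay_pos d m).le
                    calc _ ≤ d * (1 - cosMean d k) * (δ * ((m + 1) * decay d m)) := by gcongr
                      _ = (d * δ) * ((1 - cosMean d k) * ((m + 1) * decay d m)) := by ring
                      _ ≤ 1 * ((1 - cosMean d k) * ((m + 1) * decay d m)) := by gcongr
                      _ = _ := one_mul _
                _ ≤ _ := by
                    rw [← Finset.mul_sum]
                    gcongr
                    exact sum_mul_decay_le hd _
            have h9 : 2 * d * z * (1 - cosMean d k) ≤ 2 * (1 - cosMean d k) := by gcongr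
            linarith
          have h8 := abs_sub_le_of_renewal (N := n) (fourier_wt_zero z β 0) (fourier_wt_zero z β k)
            (fun j hj => fourier_wt_eq_sum z β hj 0) (fun j hj => fourier_wt_eq_sum z β hj k)
            (fun j hj => hbd 0 (by rw [hcos0]; norm_num) j (by omega))
            (fun j hj => hbd k hk j (by omega)) hE le_rfl
          calc _ ≤ (n : ℝ) ^ 2 / 2 * (2 ^ 2 * (n + 1) * (t ^ 2 / (2 * d) * (2 + momSum d))) := by
                gcongr
                refine h8.trans ?_
                gcongr
            _ = _ := by
                simp only [t]
                field_simp
        have h4 : (walkSum z n fun l : List (Fin d × Bool) => sqLen (endpt l) * wt β l) =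
            ∑ i : Fin d, walkSum z n fun l => wt β l * (endpt l i : ℝ) ^ 2 := by
          rw [← walkSum_sum]
          refine walkSum_congr z fun l _ => ?_
          rw [sqLen, mul_comm, Finset.mul_sum]
        rw [h4]
        calc _ ≤ ∑ i : Fin d, Real.pi ^ 2 * (2 + momSum d) * (n + 1) / d :=
              Finset.sum_le_sum fun i _ => hcoord i
          _ = Real.pi ^ 2 * (2 + momSum d) * (n + 1) := by
              rw [Finset.sum_const, Finset.card_univ, Fintype.card_fin, nsmul_eq_mul]
              field_simp
          _ ≤ _ := by
              gcongr
              linarith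
    have h5 := ENNReal.ofReal_le_ofReal h3
    rw [ofReal_walkSum hz fun l => mul_nonneg (sqLen_nonneg _) (wt_nonneg h1 l),
      ENNReal.ofReal_mul (by linarith)] at h5
    have h6 : ENNReal.ofReal ((n : ℝ) + 1) = (n : ℝ≥0∞) + 1 := by
      rw [ENNReal.ofReal_add (by positivity) zero_le_one]
      simp
    rw [h6] at h5
    refine le_trans (le_of_eq (walkSum_congr _ fun l _ => ?_)) h5
    rw [ENNReal.ofReal_mul (sqLen_nonneg _)]
    rfl

end Diffusive

end WSAW

namespace WSAW

open Finset Lace Filter Topology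
open scoped ENNReal

section CriticalPoint

variable {d : ℕ}

theorem exists_laceBound_of_diffusive (hd : 4 < d) {K : ℝ≥0∞} (hK : K ≠ ∞) :
    ∃ β₁ C : ℝ, 0 < β₁ ∧ 0 ≤ C ∧ ∀ (β z : ℝ) (L : ℕ), 2 ≤ L → 0 ≤ β → β ≤ 1 → β ≤ β₁ → 0 ≤ z →
      (∀ n < L, Diffusive d (ENNReal.ofReal z) β K n) → LaceBound d L z β (C * β) := by
  have hdbl : ∀ c, dbl d c ≠ ∞ := fun c => ENNReal.ofReal_ne_top
  set A : ℝ≥0∞ := 4 * K + 8 * dbl d 3 * K ^ 2 with hA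
  have hAt : A ≠ ∞ := by
    have := hdbl 3
    rw [hA]
    finiteness
  have hM : 2 * (A * A * dbl d 2) + 2 * A ≠ ∞ := by
    have := hdbl 2
    finiteness
  have hT : triConst d * (A * A) ≠ ∞ := by
    have h1 := hdbl 3
    have h2 := decaySum_ne_top hd
    unfold triConst
    finiteness
  set T := (triConst d * (A * A)).toReal with hTdef
  have hT0 : 0 ≤ T := ENNReal.toReal_nonneg
  refine ⟨(2 * (T + 1))⁻¹, (2 * (A * A * dbl d 2) + 2 * A).toReal, by positivity,
    ENNReal.toReal_nonneg, fun β z L hL h0 h1 h2 hz hdiff => ?_⟩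
  refine laceBound_of_laceNorm_le hz (mul_nonneg ENNReal.toReal_nonneg h0) ?_
  have h3 := laceNorm_le hL h0 h1 (good_rhoPt h0 h1 hdiff) (by
    rw [← ENNReal.ofReal_toReal hT, ← hTdef, ← ENNReal.ofReal_mul h0]
    have : (2⁻¹ : ℝ≥0∞) = ENNReal.ofReal 2⁻¹ := by
      rw [ENNReal.ofReal_inv_of_pos (by norm_num)]
      simp
    rw [this]
    refine ENNReal.ofReal_le_ofReal ?_
    calc β * T ≤ (2 * (T + 1))⁻¹ * (T + 1) := by gcongr; linarith
      _ = 2⁻¹ := by field_simp)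
  refine h3.trans (le_of_eq ?_)
  rw [ENNReal.ofReal_mul (mul_nonneg ENNReal.toReal_nonneg h0),
    ENNReal.ofReal_mul ENNReal.toReal_nonneg, ENNReal.ofReal_toReal hM, edecay]
  ring

theorem Diffusive.of_pow_le {ζ ζ' K c : ℝ≥0∞} {β : ℝ} {n : ℕ} (h : Diffusive d ζ β K n)
    (hc : ζ' ^ n ≤ c * ζ ^ n) : Diffusive d ζ' β (c * K) n := by
  have key : ∀ F : List (Fin d × Bool) → ℝ≥0∞, walkSum ζ' n F ≤ c * walkSum ζ n F := fun F => by
    rw [walkSum_eq_pow_mul ζ', walkSum_eq_pow_mul ζ, ← mul_assoc]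
    gcongr
  obtain ⟨h1, h2, h3⟩ := h
  refine ⟨(key _).trans (by gcongr), fun x => ?_, (key _).trans ?_⟩
  · rw [mul_assoc]
    exact (key _).trans (by gcongr; exact h2 x)
  · rw [mul_assoc]
    gcongr

theorem one_add_pow_le_two {η : ℝ} {n N : ℕ} (hη : η = (2 * ((N : ℝ) + 1))⁻¹) (hn : n ≤ N + 1) :
    (1 + η) ^ n ≤ 2 := by
  have hη0 : 0 ≤ η := by rw [hη]; positivity
  have h1 : (1 + η) ^ n ≤ Real.exp (1 / 2) := by
    calc (1 + η) ^ n ≤ Real.exp η ^ n := by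
          gcongr
          linarith [Real.add_one_le_exp η]
      _ = Real.exp (n * η) := by rw [← Real.exp_nat_mul]
      _ ≤ _ := by
          gcongr
          have : (n : ℝ) ≤ N + 1 := by exact_mod_cast hn
          calc n * η ≤ (N + 1) * η := by gcongr
            _ = 1 / 2 := by rw [hη]; field_simp
  refine h1.trans ?_
  have h2 : Real.exp (1 / 2) ^ 2 = Real.exp 1 := by
    rw [← Real.exp_nat_mul]
    norm_num
  have h3 := Real.exp_one_lt_d9
  nlinarith [Real.exp_pos (1 / 2)]

theorem abs_pow_sub_one_le {η t : ℝ} {m N : ℕ} (hη : η = (2 * ((N : ℝ) + 1))⁻¹) (hm : m ≤ N + 1)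
    (ht : |t - 1| ≤ η) : |t ^ m - 1| ≤ 2 * η * m := by
  have h1 : t ^ m - 1 = (∑ i ∈ range m, t ^ i) * (t - 1) := (geom_sum_mul t m).symm
  have hη0 : 0 ≤ η := by rw [hη]; positivity
  have h2 : |t| ≤ 1 + η := by
    have := abs_add_le (t - 1) 1
    rw [sub_add_cancel, abs_one] at this
    linarith
  rw [h1, abs_mul]
  have h3 : |∑ i ∈ range m, t ^ i| ≤ ∑ i ∈ range m, (2 : ℝ) := by
    refine (Finset.abs_sum_le_sum_abs _ _).trans (Finset.sum_le_sum fun i hi => ?_)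
    rw [abs_pow]
    have hi' := Finset.mem_range.1 hi
    exact (pow_le_pow_left₀ (abs_nonneg _) h2 i).trans (one_add_pow_le_two hη (by omega))
  rw [Finset.sum_const, Finset.card_range, nsmul_eq_mul] at h3
  calc _ ≤ (m * 2) * η := by gcongr
    _ = _ := by ring

theorem decay_succ_le (hd : 4 < d) (N : ℕ) : decay d (N + 1) ≤ ((N : ℝ) + 1)⁻¹ := by
  have hd' : (4 : ℝ) < d := by exact_mod_cast hd
  unfold decay
  calc _ ≤ ((N + 1 : ℕ) + 1 : ℝ) ^ (-(1 : ℝ)) := by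
        apply Real.rpow_le_rpow_of_exponent_le
        · push_cast
          linarith [(Nat.cast_nonneg N : (0 : ℝ) ≤ N)]
        · linarith
    _ ≤ _ := by
        rw [Real.rpow_neg_one]
        gcongr
        linarith

theorem continuous_walkSum (n : ℕ) (G : List (Fin d × Bool) → ℝ) :
    Continuous fun z : ℝ => walkSum z n G := by
  unfold walkSum
  fun_prop

theorem continuous_rootSum (β : ℝ) (N : ℕ) : Continuous (rootSum d β N) := by
  have := fun m => continuous_walkSum m (laceWt (d := d) β m)
  unfold rootSum
  fun_prop

theorem abs_rootSum_sub_le (hd : 4 < d) {β δ z t η : ℝ} {N : ℕ} (hz : 0 ≤ z) (hδ : 0 ≤ δ)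
    (hη : η = (2 * ((N : ℝ) + 1))⁻¹) (hπ : ∀ m ∈ Icc 2 (N + 1), LaceBound d m z β δ)
    (hroot : rootSum d β N z = 1) (hN : 1 ≤ N) (ht : |t - 1| ≤ η) :
    |rootSum d β (N + 1) (z * t) - 1 - 2 * d * z * (t - 1)| ≤ 2 * η * δ * (momSum d + 1) := by
  have hη0 : 0 ≤ η := by rw [hη]; positivity
  set P : ℕ → ℝ := fun m => walkSum z m (laceWt (d := d) β m) with hP
  have hPb : ∀ m ∈ Icc 2 (N + 1), |P m| ≤ δ * decay d m := fun m hm =>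
    (abs_walkSum_le hz m _).trans (hπ m hm).1
  have h1 : ∀ m, walkSum (z * t) m (laceWt (d := d) β m) = (t ^ m - 1) * P m + P m := by
    intro m
    simp only [hP]
    rw [walkSum_eq_pow_mul (z * t), walkSum_eq_pow_mul z]
    ring
  have h2 : rootSum d β (N + 1) (z * t) - 1 - 2 * d * z * (t - 1) =
      ∑ m ∈ Icc 2 (N + 1), (t ^ m - 1) * P m + P (N + 1) := by
    have h3 : ∑ m ∈ Icc 2 (N + 1), P m = ∑ m ∈ Icc 2 N, P m + P (N + 1) :=
      Finset.sum_Icc_succ_top (by omega) _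
    have h4 : 1 = 2 * d * z + ∑ m ∈ Icc 2 N, P m := hroot.symm
    simp only [rootSum, h1]
    rw [Finset.sum_add_distrib, h3]
    linarith
  rw [h2]
  have h5 : |∑ m ∈ Icc 2 (N + 1), (t ^ m - 1) * P m| ≤ 2 * η * δ * momSum d := by
    calc _ ≤ ∑ m ∈ Icc 2 (N + 1), 2 * η * δ * ((m + 1) * decay d m) := by
          refine (Finset.abs_sum_le_sum_abs _ _).trans (Finset.sum_le_sum fun m hm => ?_)
          have h6 := abs_pow_sub_one_le hη (mem_Icc.1 hm).2 ht
          have h7 := (decay_pos d m).le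
          rw [abs_mul]
          calc _ ≤ 2 * η * m * (δ * decay d m) := by
                gcongr
                exact hPb m hm
            _ = 2 * η * δ * (m * decay d m) := by ring
            _ ≤ _ := by
                gcongr
                linarith
      _ ≤ _ := by
          rw [← Finset.mul_sum]
          gcongr
          exact sum_mul_decay_le hd _
  have h8 : |P (N + 1)| ≤ 2 * η * δ := by
    refine (hPb (N + 1) (mem_Icc.2 ⟨by omega, le_rfl⟩)).trans ?_
    calc _ ≤ δ * ((N : ℝ) + 1)⁻¹ := by
          gcongr
          exact decay_succ_le hd N
      _ = _ := by rw [hη]; field_simp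
  refine (abs_add_le _ _).trans ?_
  linarith

end CriticalPoint

end WSAW

namespace WSAW

open Finset Lace Filter Topology
open scoped ENNReal

section CriticalPoint

variable {d : ℕ}

theorem exists_root_succ (hd : 4 < d) {β δ z : ℝ} {N : ℕ} (hz : 0 ≤ z) (hδ : 0 ≤ δ)
    (hδ0 : 4 * δ * (momSum d + 1) ≤ 1) (hN : 1 ≤ N)
    (hπ : ∀ (z' : ℝ), 0 ≤ z' → z' ≤ z * (1 + (2 * ((N : ℝ) + 1))⁻¹) →
      ∀ m ∈ Icc 2 (N + 1), LaceBound d m z' β δ)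
    (hroot : rootSum d β N z = 1) :
    ∃ z', 0 ≤ z' ∧ rootSum d β (N + 1) z' = 1 ∧ ∀ m ∈ Icc 2 (N + 1), LaceBound d m z' β δ := by
  set η : ℝ := (2 * ((N : ℝ) + 1))⁻¹ with hη
  have hη0 : 0 ≤ η := by rw [hη]; positivity
  have hη1 : η ≤ 1 := by
    rw [hη]
    refine inv_le_one_of_one_le₀ ?_
    linarith [(Nat.cast_nonneg N : (0 : ℝ) ≤ N)]
  have hM := momSum_nonneg d
  have hδ1 : 4 * δ ≤ 1 := by
    have : 0 ≤ 4 * δ * momSum d := by positivity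
    linarith
  have hπz : ∀ m ∈ Icc 2 (N + 1), LaceBound d m z β δ := hπ z hz (by
    have : 0 ≤ z * η := by positivity
    linarith)
  have h2dz : 1 / 2 ≤ 2 * d * z := by
    have h1 := abs_one_sub_rootSum_le hd hz hδ
      (fun m hm => hπz m (Finset.Icc_subset_Icc_right (by omega) hm)) hroot (Nat.zero_le N)
    have h8 : decay d 0 = 1 := by simp [decay]
    simp only [rootSum, h8, Nat.cast_zero, mul_one, zero_add,
      Finset.Icc_eq_empty (show ¬ 2 ≤ 0 by norm_num), Finset.sum_empty, add_zero] at h1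
    linarith [(abs_le.1 h1).2]
  have hsmall : 2 * η * δ * (momSum d + 1) ≤ 1 / 2 * η := by
    calc _ = 4 * δ * (momSum d + 1) * (1 / 2 * η) := by ring
      _ ≤ 1 * (1 / 2 * η) := by gcongr
      _ = _ := one_mul _
  have hlin : 1 / 2 * η ≤ 2 * d * z * η := by gcongr
  have hlo : rootSum d β (N + 1) (z * (1 - η)) ≤ 1 := by
    have := abs_rootSum_sub_le hd (t := 1 - η) hz hδ hη hπz hroot hN
      (by rw [sub_sub_cancel_left, abs_neg, abs_of_nonneg hη0])
    have := (abs_le.1 this).2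
    linarith
  have hhi : 1 ≤ rootSum d β (N + 1) (z * (1 + η)) := by
    have := abs_rootSum_sub_le hd (t := 1 + η) hz hδ hη hπz hroot hN
      (by rw [add_sub_cancel_left, abs_of_nonneg hη0])
    have := (abs_le.1 this).1
    linarith
  obtain ⟨z', hz', hz'root⟩ := intermediate_value_Icc
    (mul_le_mul_of_nonneg_left (by linarith : 1 - η ≤ 1 + η) hz)
    (continuous_rootSum β (N + 1)).continuousOn ⟨hlo, hhi⟩
  have hz'0 : 0 ≤ z' := le_trans (mul_nonneg hz (by linarith)) hz'.1
  exact ⟨z', hz'0, hz'root, hπ z' hz'0 hz'.2⟩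

theorem exists_approx_root (hd : 4 < d) : ∃ β₀ C : ℝ, 0 < β₀ ∧ 0 ≤ C ∧
    ∀ β : ℝ, 0 ≤ β → β ≤ β₀ → ∀ N : ℕ,
      ∃ z, 0 ≤ z ∧ rootSum d β (N + 1) z = 1 ∧ ∀ m ∈ Icc 2 (N + 1), LaceBound d m z β (C * β) := by
  obtain ⟨K, δ₀, hK, hδ₀, hdiff⟩ := exists_diffusive_of_laceBound hd
  obtain ⟨β₁, C, hβ₁, hC, hlace⟩ :=
    exists_laceBound_of_diffusive hd (K := 2 * ENNReal.ofReal K) (by finiteness)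
  have hM := momSum_nonneg d
  refine ⟨min (min 1 β₁) (min (δ₀ / (C + 1)) (4 * (C + 1) * (momSum d + 1))⁻¹),
    C, by positivity, hC,
    fun β hβ hβ0 N => ?_⟩
  obtain ⟨⟨h1, h2⟩, h3, h4⟩ : (β ≤ 1 ∧ β ≤ β₁) ∧ β ≤ δ₀ / (C + 1) ∧
      β ≤ (4 * (C + 1) * (momSum d + 1))⁻¹ := by simpa only [le_min_iff] using hβ0
  have hδ : 0 ≤ C * β := by positivity
  have h5 : C * β ≤ δ₀ := by
    rw [le_div_iff₀ (by positivity)] at h3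
    linarith
  have h6 : 4 * (C * β) * (momSum d + 1) ≤ 1 := by
    calc _ ≤ 4 * ((C + 1) * (4 * (C + 1) * (momSum d + 1))⁻¹) * (momSum d + 1) := by
          gcongr
          linarith
      _ = 1 := by field_simp
  induction N with
  | zero =>
    have hd0 : (d : ℝ) ≠ 0 := by positivity
    exact ⟨(2 * d)⁻¹, by positivity, by simp [rootSum]; field_simp, by simp⟩
  | succ N ih =>
    obtain ⟨z, hz, hroot, hπ⟩ := ih
    have hK2 := hdiff β z (C * β) (N + 1) h1 hz hδ h5 hπ hroot
    refine exists_root_succ hd hz hδ h6 (by omega) (fun z' hz' hz'z m hm => ?_) hroot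
    obtain ⟨hm1, hm2⟩ := mem_Icc.1 hm
    refine hlace β z' m hm1 hβ h1 h2 hz' fun n hn => (hK2 n (by omega)).of_pow_le ?_
    have hpow := one_add_pow_le_two (n := n) (N := N + 1) rfl (by omega)
    rw [← ENNReal.ofReal_pow hz', ← ENNReal.ofReal_pow hz]
    have h2e : (2 : ℝ≥0∞) = ENNReal.ofReal 2 := by simp
    rw [h2e, ← ENNReal.ofReal_mul (by norm_num)]
    refine ENNReal.ofReal_le_ofReal ?_
    calc z' ^ n ≤ (z * (1 + (2 * (((N + 1 : ℕ) : ℝ) + 1))⁻¹)) ^ n := by gcongr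
      _ = (1 + (2 * (((N + 1 : ℕ) : ℝ) + 1))⁻¹) ^ n * z ^ n := by rw [mul_pow, mul_comm]
      _ ≤ _ := by gcongr

theorem exists_root (hd : 4 < d) {β δ : ℝ} (hδ : 0 ≤ δ)
    (h : ∀ N : ℕ, ∃ z, 0 ≤ z ∧ rootSum d β (N + 1) z = 1 ∧
      ∀ m ∈ Icc 2 (N + 1), LaceBound d m z β δ) :
    ∃ z, 0 ≤ z ∧ (∀ m, 2 ≤ m → |walkSum z m (laceWt (d := d) β m)| ≤ δ * decay d m) ∧
      ∀ n, |1 - rootSum d β n z| ≤ δ * ((n + 1) * decay d n) := by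
  choose z hz hroot hπ using h
  have hd1 : (4 : ℝ) < d := by exact_mod_cast hd
  have hbdd : ∀ N, z N ∈ Set.Icc 0 (1 + δ) := by
    intro N
    have h1 := abs_one_sub_rootSum_le hd (hz N) hδ (hπ N) (hroot N) (Nat.zero_le (N + 1))
    have h8 : decay d 0 = 1 := by simp [decay]
    simp only [rootSum, h8, Nat.cast_zero, mul_one, zero_add,
      Finset.Icc_eq_empty (show ¬ 2 ≤ 0 by norm_num), Finset.sum_empty, add_zero] at h1
    have h2 : 1 * z N ≤ 2 * d * z N := mul_le_mul_of_nonneg_right (by linarith) (hz N)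
    exact ⟨hz N, by linarith [(abs_le.1 h1).1]⟩
  obtain ⟨z₀, hz₀, φ, hφ, hlim⟩ := isCompact_Icc.tendsto_subseq hbdd
  refine ⟨z₀, hz₀.1, fun m hm => ?_, fun n => ?_⟩
  · refine le_of_tendsto (((continuous_walkSum m (laceWt β m)).abs.tendsto z₀).comp hlim) ?_
    filter_upwards [eventually_ge_atTop m] with k hk
    have hk' := hφ.id_le k
    exact (abs_walkSum_le (hz _) m _).trans (hπ (φ k) m (mem_Icc.2 ⟨hm, by simp at hk'; omega⟩)).1
  · refine le_of_tendsto (((continuous_const.sub (continuous_rootSum β n)).abs.tendsto z₀).comp hlim)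
      ?_
    filter_upwards [eventually_ge_atTop n] with k hk
    have hk' := hφ.id_le k
    exact abs_one_sub_rootSum_le hd (hz _) hδ (hπ (φ k)) (hroot _) (by simp at hk'; omega)

theorem renewal_walkSum (hd : 4 < d) {z β δ : ℝ} (hδ : 0 ≤ δ)
    (hπ : ∀ m, 2 ≤ m → |walkSum z m (laceWt (d := d) β m)| ≤ δ * decay d m)
    (hroot : ∀ n, |1 - rootSum d β n z| ≤ δ * ((n + 1) * decay d n)) (N : ℕ) :
    Renewal d N (2 * d * z) δ 0
      (fun m => ((walkSum z m (laceWt (d := d) β m) : ℝ) : ℂ))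
      (fun m => ((walkSum z m (laceWt (d := d) β m) : ℝ) : ℂ))
      (fun n => ((walkSum z n (wt (d := d) β) : ℝ) : ℂ)) := by
  refine ⟨le_rfl, zero_le_one, hδ, ?_, ?_, ?_, ?_, ?_⟩
  · rw [← fourier_zero_right, fourier_wt_zero]
    simp
  · intro n _
    have h1 := fourier_wt_succ (by omega : 0 < d) z β 0 n
    have hcos0 : cosMean d (0 : Fin d → ℝ) = 1 := by
      have : (d : ℝ) ≠ 0 := by
        have : d ≠ 0 := by omega
        exact_mod_cast this
      simp [cosMean, this]
    simp only [fourier_zero_right, hcos0] at h1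
    rw [h1]
    push_cast
    ring
  · intro m hm _
    rw [Complex.norm_real, Real.norm_eq_abs]
    exact hπ m hm
  · intro m _ _
    simp
  · intro n _
    have h2 : (1 : ℂ) - ((2 * d * z : ℝ) : ℂ) -
        ∑ m ∈ Icc 2 n, ((walkSum z m (laceWt (d := d) β m) : ℝ) : ℂ) =
        ((1 - rootSum d β n z : ℝ) : ℂ) := by
      rw [rootSum]
      push_cast
      ring
    rw [h2, Complex.norm_real, Real.norm_eq_abs]
    exact hroot n

end CriticalPoint

end WSAW

namespace WSAW

open Finset Lace Filter Topology
open scoped ENNReal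

section Asymptotics

variable {d : ℕ}

theorem exists_limit_of_sub_le (hd : 4 < d) {u : ℕ → ℝ} {B : ℝ}
    (hu : ∀ n : ℕ, |u (n + 1) - u n| ≤ B * (((n + 1 : ℕ) + 1) * decay d (n + 1))) :
    ∃ A, Tendsto u atTop (𝓝 A) ∧
      ∀ n : ℕ, |u n - A| ≤ 2 * B * ((n : ℝ) + 1) ^ (-((d : ℝ) / 2 - 2)) := by
  have hd' : (5 : ℝ) ≤ d := by exact_mod_cast hd
  have hs : 0 < (d : ℝ) / 2 - 2 := by linarith
  have hB : 0 ≤ B := by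
    have h1 := (abs_nonneg _).trans (hu 0)
    exact nonneg_of_mul_nonneg_left h1 (by have := decay_pos d (0 + 1); positivity)
  have hcauchy : CauchySeq u := by
    refine cauchySeq_of_dist_le_of_summable _ (fun n => ?_)
      (((summable_nat_add_iff 1).2 (summable_mul_decay hd)).mul_left B)
    rw [dist_comm, Real.dist_eq]
    exact hu n
  obtain ⟨A, hA⟩ := cauchySeq_tendsto_of_complete hcauchy
  refine ⟨A, hA, fun n => ?_⟩
  have hstep : ∀ N, n ≤ N → |u n - u N| ≤ ∑ m ∈ Ioc n N, B * ((m + 1) * decay d m) := by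
    intro N hN
    induction N, hN using Nat.le_induction with
    | base => simp
    | succ N hN ih =>
      rw [Finset.sum_Ioc_succ_top (by omega)]
      have h1 := abs_sub_le (u n) (u N) (u (N + 1))
      have h2 := hu N
      rw [abs_sub_comm] at h2
      linarith
  have hmd : ∀ m : ℕ, ((m : ℝ) + 1) * decay d m = ((m : ℝ) + 1) ^ (-((d : ℝ) / 2 - 2 + 1)) := by
    intro m
    unfold decay
    rw [show -((d : ℝ) / 2 - 2 + 1) = 1 + -((d : ℝ) / 2) by ring, Real.rpow_add (by positivity),
      Real.rpow_one]
  refine le_of_tendsto ((tendsto_const_nhds.sub hA).abs) ?_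
  filter_upwards [eventually_ge_atTop n] with N hN
  refine (hstep N hN).trans ?_
  rw [← Finset.mul_sum]
  simp only [hmd]
  have h3 := sum_Ioc_rpow_le hs hN
  have h4 : 0 ≤ ((N : ℝ) + 1) ^ (-((d : ℝ) / 2 - 2)) := by positivity
  have h5 : ((d : ℝ) / 2 - 2)⁻¹ ≤ 2 := by
    rw [inv_le_comm₀ hs (by norm_num)]
    linarith
  calc _ ≤ B * (2 * ((n : ℝ) + 1) ^ (-((d : ℝ) / 2 - 2))) := by
        gcongr
        refine h3.trans ?_
        calc _ ≤ ((d : ℝ) / 2 - 2)⁻¹ * ((n : ℝ) + 1) ^ (-((d : ℝ) / 2 - 2)) := by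
              gcongr
              linarith
          _ ≤ _ := by gcongr
    _ = _ := by ring

theorem abs_walkSum_wt_sub_le (hd : 4 < d) {z β δ : ℝ} (hδ : 0 ≤ δ)
    (hδ0 : 2 * Renewal.kernConst d * Renewal.incConst d * δ ≤ 1)
    (hπ : ∀ m, 2 ≤ m → |walkSum z m (laceWt (d := d) β m)| ≤ δ * decay d m)
    (hroot : ∀ n, |1 - rootSum d β n z| ≤ δ * ((n + 1) * decay d n)) (n : ℕ) :
    |walkSum z (n + 1) (wt (d := d) β) - walkSum z n (wt (d := d) β)| ≤
      2 * Renewal.kernConst d * δ * (((n + 1 : ℕ) + 1) * decay d (n + 1)) := by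
  have h1 := (renewal_walkSum hd hδ hπ hroot (n + 1)).norm_incr_le hd hδ0 (n := n + 1)
    (by omega) le_rfl
  simp only [incr, incWt, sub_zero, Complex.ofReal_one, one_mul, zero_mul, mul_zero, zero_add,
    add_zero, div_one] at h1
  rwa [← Complex.ofReal_sub, Complex.norm_real, Real.norm_eq_abs] at h1

theorem growthConst_eq_inv {β μ z A : ℝ} (hβ : β ≤ 1) (hz : 0 < z) (hA : 0 < A)
    (hlim : Tendsto (fun n => walkSum z n (wt (d := d) β)) atTop (𝓝 A))
    (hμ : HasGrowthConst d β μ) : μ = z⁻¹ := by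
  refine tendsto_nhds_unique hμ ?_
  have h1 : Tendsto (fun n : ℕ => (walkSum z n (wt (d := d) β)) ^ ((n : ℝ)⁻¹)) atTop (𝓝 1) := by
    have := hlim.rpow (tendsto_inv_atTop_nhds_zero_nat (𝕜 := ℝ)) (Or.inl hA.ne')
    rwa [Real.rpow_zero] at this
  have h2 := h1.mul_const z⁻¹
  rw [one_mul] at h2
  refine h2.congr' ?_
  filter_upwards [eventually_ge_atTop 1] with n hn
  have hn' : (n : ℝ) ≠ 0 := by positivity
  have h3 : cZ d β n = walkSum z n (wt (d := d) β) * (z⁻¹) ^ n := by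
    rw [cZ_eq_walkSum, walkSum_eq_pow_mul z, mul_comm (z ^ n), mul_assoc, ← mul_pow,
      mul_inv_cancel₀ hz.ne', one_pow, mul_one]
  rw [h3, Real.mul_rpow (walkSum_nonneg hz.le (wt_nonneg hβ)) (by positivity),
    Real.pow_rpow_inv_natCast (by positivity) (by omega)]

theorem exists_abs_cZ_div_pow_sub_le (hd : 4 < d) : ∃ β₀ C : ℝ, 0 < β₀ ∧ 0 < C ∧
    ∀ β : ℝ, 0 < β → β ≤ β₀ → ∀ μ : ℝ, HasGrowthConst d β μ →
      0 < μ ∧ ∃ A : ℝ, 0 < A ∧ Tendsto (fun n => cZ d β n / μ ^ n) atTop (𝓝 A) ∧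
        ∀ n : ℕ, |cZ d β n / μ ^ n - A| ≤ C * β * ((n : ℝ) + 1) ^ (-((d : ℝ) / 2 - 2)) := by
  obtain ⟨β₁, C, hβ₁, hC, hroots⟩ := exists_approx_root hd
  have hM := momSum_nonneg d
  have hk := Renewal.kernConst_nonneg d
  have hi : 0 ≤ Renewal.incConst d := by unfold Renewal.incConst; positivity
  set κ := Renewal.kernConst d
  set ι := Renewal.incConst d
  set Q := (C + 1) * (4 + 2 * κ * ι + 8 * κ) with hQ
  have hQ0 : 0 < Q := by positivity
  refine ⟨min (min 1 β₁) Q⁻¹, 4 * κ * C + 1, by positivity, by positivity, ?_⟩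
  intro β hβ hβ0 μ hμ
  obtain ⟨⟨h1, h2⟩, h3⟩ : (β ≤ 1 ∧ β ≤ β₁) ∧ β ≤ Q⁻¹ := by simpa only [le_min_iff] using hβ0
  have hQβ : Q * β ≤ 1 := by
    calc _ ≤ Q * Q⁻¹ := by gcongr
      _ = 1 := mul_inv_cancel₀ hQ0.ne'
  have hδ : 0 ≤ C * β := by positivity
  have hsplit : C * β * 4 + C * β * (2 * κ * ι) + C * β * (8 * κ) ≤ 1 := by
    refine le_trans ?_ hQβ
    rw [hQ]
    calc _ = C * (4 + 2 * κ * ι + 8 * κ) * β := by ring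
      _ ≤ _ := by gcongr; linarith
  have e1 : 0 ≤ C * β * 4 := by positivity
  have e2 : 0 ≤ C * β * (2 * κ * ι) := by positivity
  have e3 : 0 ≤ C * β * (8 * κ) := by positivity
  obtain ⟨z, hz, hπ, hroot⟩ := exists_root hd hδ (hroots β hβ.le h2)
  have hz0 : 0 < z := by
    refine lt_of_le_of_ne hz fun h => ?_
    have h4 := hroot 0
    have h8 : decay d 0 = 1 := by simp [decay]
    simp only [rootSum, h8, ← h, Nat.cast_zero, mul_one, zero_add, mul_zero, sub_zero, abs_one,
      Finset.Icc_eq_empty (show ¬ 2 ≤ 0 by norm_num), Finset.sum_empty] at h4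
    linarith
  obtain ⟨A, hA, hbd⟩ := exists_limit_of_sub_le hd
    (u := fun n => walkSum z n (wt (d := d) β)) (abs_walkSum_wt_sub_le hd hδ (by linarith) hπ hroot)
  have hA0 : 0 < A := by
    have h5 := hbd 0
    have h6 : walkSum z 0 (wt (d := d) β) = 1 := by
      rw [← fourier_zero_right, fourier_wt_zero]
    rw [h6] at h5
    simp only [Nat.cast_zero, zero_add, Real.one_rpow, mul_one] at h5
    linarith [(abs_le.1 h5).2]
  have hμz := growthConst_eq_inv h1 hz0 hA0 hA hμ
  have hcu : ∀ n, cZ d β n / μ ^ n = walkSum z n (wt (d := d) β) := by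
    intro n
    rw [cZ_eq_walkSum, walkSum_eq_pow_mul z, hμz, inv_pow, div_inv_eq_mul, mul_comm]
  refine ⟨by rw [hμz]; positivity, A, hA0, hA.congr fun n => (hcu n).symm, fun n => ?_⟩
  rw [hcu]
  refine (hbd n).trans ?_
  calc _ = 4 * κ * C * β * ((n : ℝ) + 1) ^ (-((d : ℝ) / 2 - 2)) := by ring
    _ ≤ _ := by
      gcongr
      linarith

end Asymptotics

end WSAW

namespace WSAW

open Finset Filter Topology

section PowerSums

/-- The generating function of the sequence `(n + 1) ^ (-α)`. -/
noncomputable def powSum (α s : ℝ) : ℝ := ∑' n : ℕ, ((n : ℝ) + 1) ^ (-α) * s ^ n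

theorem summable_succ_mul_pow {s : ℝ} (h0 : 0 ≤ s) (h1 : s < 1) :
    Summable fun n : ℕ => ((n : ℝ) + 1) * s ^ n := by
  have hs : ‖s‖ < 1 := by rwa [Real.norm_eq_abs, abs_of_nonneg h0]
  have := (hasSum_coe_mul_geometric_of_norm_lt_one hs).summable.add
    (summable_geometric_of_lt_one h0 h1)
  exact this.congr fun n => by ring

theorem summable_rpow_mul_pow {α s : ℝ} (hα : -1 ≤ α) (h0 : 0 ≤ s) (h1 : s < 1) :
    Summable fun n : ℕ => ((n : ℝ) + 1) ^ (-α) * s ^ n := by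
  refine Summable.of_nonneg_of_le (fun n => by positivity) (fun n => ?_)
    (summable_succ_mul_pow h0 h1)
  gcongr
  calc ((n : ℝ) + 1) ^ (-α) ≤ ((n : ℝ) + 1) ^ (1 : ℝ) := by
        apply Real.rpow_le_rpow_of_exponent_le
        · linarith [(Nat.cast_nonneg n : (0 : ℝ) ≤ n)]
        · linarith
    _ = _ := Real.rpow_one _

theorem powSum_le_const {α : ℝ} (hα : 1 < α) :
    ∃ C : ℝ, 0 ≤ C ∧ ∀ s, 0 ≤ s → s < 1 → powSum α s ≤ C := by
  have hsum : Summable fun n : ℕ => ((n : ℝ) + 1) ^ (-α) := by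
    have := (summable_nat_add_iff 1).2 (Real.summable_nat_rpow.2 (by linarith : -α < -1))
    exact this.congr fun n => by push_cast; rfl
  refine ⟨∑' n : ℕ, ((n : ℝ) + 1) ^ (-α), tsum_nonneg fun n => by positivity, fun s h0 h1 => ?_⟩
  refine (summable_rpow_mul_pow (by linarith) h0 h1).tsum_le_tsum (fun n => ?_) hsum
  exact mul_le_of_le_one_right (by positivity) (pow_le_one₀ h0 h1.le)

theorem powSum_one_le {s : ℝ} (h0 : 0 ≤ s) (h1 : s < 1) :
    powSum 1 s ≤ 1 + |Real.log (1 - s)| := by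
  have hsum := summable_rpow_mul_pow (α := 1) (by norm_num) h0 h1
  have hlog := Real.hasSum_pow_div_log_of_abs_lt_one (by rwa [abs_of_nonneg h0] : |s| < 1)
  rw [powSum, hsum.tsum_eq_zero_add]
  gcongr
  · simp
  · refine le_trans ?_ (neg_le_abs _)
    rw [← hlog.tsum_eq]
    refine ((summable_nat_add_iff 1).2 hsum).tsum_le_tsum (fun n => ?_) hlog.summable
    rw [Real.rpow_neg_one, div_eq_inv_mul]
    gcongr
    linarith

theorem powSum_zero {s : ℝ} (h0 : 0 ≤ s) (h1 : s < 1) : powSum 0 s = (1 - s)⁻¹ := by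
  simp [powSum, tsum_geometric_of_lt_one h0 h1]

theorem sum_range_rpow_neg_half_le (M : ℕ) :
    ∑ n ∈ range M, ((n : ℝ) + 1) ^ (-(1 / 2 : ℝ)) ≤ 2 * √M := by
  induction M with
  | zero => simp
  | succ M ih =>
    rw [Finset.sum_range_succ]
    have hy : 0 < √((M : ℝ) + 1) := Real.sqrt_pos.2 (by positivity)
    have h1 : ((M : ℝ) + 1) ^ (-(1 / 2 : ℝ)) = (√((M : ℝ) + 1))⁻¹ := by
      rw [Real.rpow_neg (by positivity), Real.sqrt_eq_rpow]
    have h2 := Real.sq_sqrt (by positivity : (0 : ℝ) ≤ M)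
    have h3 := Real.sq_sqrt (by positivity : (0 : ℝ) ≤ (M : ℝ) + 1)
    have h4 : 2 * √M + (√((M : ℝ) + 1))⁻¹ ≤ 2 * √((M : ℝ) + 1) := by
      rw [← sub_nonneg]
      have : 2 * √((M : ℝ) + 1) - (2 * √M + (√((M : ℝ) + 1))⁻¹) =
          (√((M : ℝ) + 1) - √M) ^ 2 * (√((M : ℝ) + 1))⁻¹ := by
        field_simp
        linarith
      rw [this]
      positivity
    rw [h1]
    push_cast
    linarith

theorem powSum_half_le {s : ℝ} (h0 : 0 ≤ s) (h1 : s < 1) :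
    powSum (1 / 2) s ≤ 5 * (1 - s) ^ (-(1 / 2 : ℝ)) := by
  have hε : 0 < 1 - s := by linarith
  have hε1 : 1 - s ≤ 1 := by linarith
  set ε := 1 - s with hεdef
  set M := ⌈ε⁻¹⌉₊
  have hM : ε⁻¹ ≤ M := Nat.le_ceil _
  have hM2 : (M : ℝ) ≤ 2 * ε⁻¹ := by
    have := Nat.ceil_lt_add_one (inv_nonneg.2 hε.le)
    have h2 : 1 ≤ ε⁻¹ := one_le_inv₀ hε |>.2 hε1
    linarith
  have hy : 0 < √ε := Real.sqrt_pos.2 hε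
  have hpow : ε ^ (-(1 / 2 : ℝ)) = (√ε)⁻¹ := by
    rw [Real.rpow_neg hε.le, Real.sqrt_eq_rpow]
  have hpt : ∀ n : ℕ, ((n : ℝ) + 1) ^ (-(1 / 2 : ℝ)) * s ^ n ≤
      (if n ∈ range M then ((n : ℝ) + 1) ^ (-(1 / 2 : ℝ)) else 0) + √ε * s ^ n := by
    intro n
    split_ifs with hn
    · have h2 : ((n : ℝ) + 1) ^ (-(1 / 2 : ℝ)) * s ^ n ≤ ((n : ℝ) + 1) ^ (-(1 / 2 : ℝ)) :=
        mul_le_of_le_one_right (by positivity) (pow_le_one₀ h0 h1.le)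
      have h3 : 0 ≤ √ε * s ^ n := by positivity
      linarith
    · rw [zero_add]
      gcongr
      rw [Finset.mem_range, not_lt] at hn
      have hn' : (M : ℝ) ≤ n := by exact_mod_cast hn
      rw [Real.rpow_neg (by positivity), ← Real.sqrt_eq_rpow, ← Real.sqrt_inv]
      refine Real.sqrt_le_sqrt ?_
      exact inv_le_of_inv_le₀ hε (by linarith)
  have hgeo := summable_geometric_of_lt_one h0 h1
  have hfin : HasSum (fun n : ℕ => if n ∈ range M then ((n : ℝ) + 1) ^ (-(1 / 2 : ℝ)) else 0)
      (∑ n ∈ range M, ((n : ℝ) + 1) ^ (-(1 / 2 : ℝ))) := by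
    have : HasSum (fun n : ℕ => if n ∈ range M then ((n : ℝ) + 1) ^ (-(1 / 2 : ℝ)) else 0)
        (∑ n ∈ range M, if n ∈ range M then ((n : ℝ) + 1) ^ (-(1 / 2 : ℝ)) else 0) :=
      hasSum_sum_of_ne_finset_zero fun n hn => if_neg hn
    rwa [Finset.sum_ite_mem, Finset.inter_self] at this
  have h5 := (summable_rpow_mul_pow (by norm_num) h0 h1).tsum_le_tsum hpt
    (hfin.summable.add (hgeo.mul_left _))
  rw [hfin.summable.tsum_add (hgeo.mul_left _), hfin.tsum_eq, tsum_mul_left,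
    tsum_geometric_of_lt_one h0 h1, ← hεdef] at h5
  rw [powSum, hpow]
  refine h5.trans ?_
  have h6 : √(M : ℝ) ≤ 2 * (√ε)⁻¹ := by
    rw [← Real.sqrt_inv, Real.sqrt_le_left (by positivity), mul_pow, Real.sq_sqrt (by positivity)]
    have : 0 ≤ ε⁻¹ := by positivity
    linarith
  have h7 : √ε * ε⁻¹ = (√ε)⁻¹ := by
    have := Real.sq_sqrt hε.le
    field_simp
    exact this
  have h8 := sum_range_rpow_neg_half_le M
  linarith

theorem powSum_neg_half_le {s : ℝ} (h0 : 0 ≤ s) (h1 : s < 1) :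
    powSum (-(1 / 2)) s ≤ (1 - s) ^ (-(3 / 2 : ℝ)) := by
  have hε : 0 < 1 - s := by linarith
  set ε := 1 - s with hεdef
  have hy : 0 < √ε := Real.sqrt_pos.2 hε
  have hε2 := Real.sq_sqrt hε.le
  have hs : ‖s‖ < 1 := by rwa [Real.norm_eq_abs, abs_of_nonneg h0]
  have hpow : ε ^ (-(3 / 2 : ℝ)) = ε⁻¹ * (√ε)⁻¹ := by
    rw [show -(3 / 2 : ℝ) = -1 + -(1 / 2) by norm_num, Real.rpow_add hε, Real.rpow_neg_one,
      Real.rpow_neg hε.le, Real.sqrt_eq_rpow]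
  have hpt : ∀ n : ℕ, ((n : ℝ) + 1) ^ (- -(1 / 2 : ℝ)) * s ^ n ≤
      √ε / 2 * (((n : ℝ) + 1) * s ^ n) + (√ε)⁻¹ / 2 * s ^ n := by
    intro n
    rw [neg_neg, ← Real.sqrt_eq_rpow, ← mul_assoc, ← add_mul]
    gcongr
    have h2 := Real.sq_sqrt (by positivity : (0 : ℝ) ≤ (n : ℝ) + 1)
    rw [← sub_nonneg]
    have : √ε / 2 * ((n : ℝ) + 1) + (√ε)⁻¹ / 2 - √((n : ℝ) + 1) =
        (√ε * √((n : ℝ) + 1) - 1) ^ 2 * ((√ε)⁻¹ / 2) := by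
      rw [sub_sq, mul_pow, h2]
      field_simp
      ring
    rw [this]
    positivity
  have hgeo := summable_geometric_of_lt_one h0 h1
  have hlin := summable_succ_mul_pow h0 h1
  have hlinv : ∑' n : ℕ, ((n : ℝ) + 1) * s ^ n = ε⁻¹ ^ 2 := by
    have h3 : ∀ n : ℕ, ((n : ℝ) + 1) * s ^ n = n * s ^ n + s ^ n := fun n => by ring
    simp only [h3]
    rw [(hasSum_coe_mul_geometric_of_norm_lt_one hs).summable.tsum_add hgeo,
      tsum_coe_mul_geometric_of_norm_lt_one hs, tsum_geometric_of_lt_one h0 h1, ← hεdef]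
    field_simp
    linarith
  have h5 := (summable_rpow_mul_pow (by norm_num) h0 h1).tsum_le_tsum hpt
    ((hlin.mul_left _).add (hgeo.mul_left _))
  rw [(hlin.mul_left _).tsum_add (hgeo.mul_left _), tsum_mul_left, tsum_mul_left, hlinv,
    tsum_geometric_of_lt_one h0 h1, ← hεdef] at h5
  rw [powSum, hpow]
  refine h5.trans (le_of_eq ?_)
  have h6 : √ε * ε⁻¹ = (√ε)⁻¹ := by
    field_simp
    exact hε2
  linear_combination (ε⁻¹ / 2) * h6

theorem exists_powSum_le {α : ℝ} (h : α = -(1 / 2) ∨ α = 0 ∨ α = 1 / 2 ∨ 1 < α) :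
    ∃ C : ℝ, 0 ≤ C ∧ ∀ s, 0 ≤ s → s < 1 → powSum α s ≤ C * (1 - s) ^ (-max (1 - α) 0) := by
  rcases h with rfl | rfl | rfl | h
  · refine ⟨1, by norm_num, fun s h0 h1 => ?_⟩
    rw [max_eq_left (by norm_num), one_mul]
    convert powSum_neg_half_le h0 h1 using 2
    norm_num
  · refine ⟨1, by norm_num, fun s h0 h1 => ?_⟩
    rw [max_eq_left (by norm_num), one_mul, sub_zero, Real.rpow_neg_one, powSum_zero h0 h1]
  · refine ⟨5, by norm_num, fun s h0 h1 => ?_⟩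
    rw [max_eq_left (by norm_num)]
    convert powSum_half_le h0 h1 using 3
    norm_num
  · obtain ⟨C, hC, hb⟩ := powSum_le_const h
    refine ⟨C, hC, fun s h0 h1 => ?_⟩
    rw [max_eq_right (by linarith), neg_zero, Real.rpow_zero, mul_one]
    exact hb s h0 h1

end PowerSums

section Susceptibility

theorem hasDerivAt_tsum_mul_pow {c : ℕ → ℝ} {r B z : ℝ} (hr : 0 < r) (hc : ∀ n, |c n| * r ^ n ≤ B)
    (hz : |z| < r) :
    HasDerivAt (fun y => ∑' n, c n * y ^ n) (∑' n, c n * (n * z ^ (n - 1))) z := by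
  obtain ⟨r', hzr', hr'r⟩ := exists_between hz
  have hr'0 : 0 < r' := (abs_nonneg z).trans_lt hzr'
  have hq0 : 0 ≤ r' / r := by positivity
  have hq1 : r' / r < 1 := (div_lt_one hr).2 hr'r
  have hsum : Summable fun n : ℕ => B / r' * (((n : ℝ) + 1) * (r' / r) ^ n) :=
    (summable_succ_mul_pow hq0 hq1).mul_left _
  refine hasDerivAt_tsum_of_isPreconnected (t := Set.Ioo (-r') r') (y₀ := 0) hsum isOpen_Ioo
    isPreconnected_Ioo (fun n y _ => (hasDerivAt_pow n y).const_mul (c n)) (fun n y hy => ?_)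
    ⟨by linarith, hr'0⟩ ?_ (abs_lt.1 hzr')
  · have hy' : |y| ≤ r' := (abs_lt.2 hy).le
    rw [Real.norm_eq_abs, abs_mul, abs_mul, abs_pow, Nat.abs_cast]
    have hB : 0 ≤ B := (by positivity : 0 ≤ |c 0| * r ^ 0).trans (hc 0)
    rcases n.eq_zero_or_pos with rfl | hn
    · simp
      positivity
    · calc _ ≤ |c n| * (n * r' ^ (n - 1)) := by gcongr
        _ = |c n| * r ^ n * (n * (r' / r) ^ n / r') := by
          rw [div_pow, ← Nat.succ_pred_eq_of_pos hn, Nat.succ_eq_add_one, Nat.add_sub_cancel]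
          field_simp
          ring
        _ ≤ B * (((n : ℝ) + 1) * (r' / r) ^ n / r') := by
          gcongr
          · exact hc n
          · linarith
        _ = _ := by ring
  · refine summable_of_ne_finset_zero (s := {0}) fun n hn => ?_
    rw [Finset.mem_singleton] at hn
    simp [hn]

end Susceptibility

end WSAW

namespace WSAW

open Finset Filter Topology

theorem abs_tsum_mul_pow_sub_le {u : ℕ → ℝ} {A K α s : ℝ} (hα : -1 ≤ α)
    (hu : ∀ n : ℕ, |u n - A| ≤ K * ((n : ℝ) + 1) ^ (-α)) (h0 : 0 ≤ s) (h1 : s < 1) :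
    |∑' n, u n * s ^ n - A / (1 - s)| ≤ K * powSum α s := by
  have hg := (hasSum_geometric_of_lt_one h0 h1).mul_left A
  have hb := (summable_rpow_mul_pow hα h0 h1).mul_left K
  have hle : ∀ n, ‖(u n - A) * s ^ n‖ ≤ K * (((n : ℝ) + 1) ^ (-α) * s ^ n) := fun n => by
    rw [Real.norm_eq_abs, abs_mul, abs_of_nonneg (pow_nonneg h0 n), ← mul_assoc]
    exact mul_le_mul_of_nonneg_right (hu n) (pow_nonneg h0 n)
  have hd : Summable fun n => (u n - A) * s ^ n := hb.of_norm_bounded hle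
  have h := hd.hasSum.add hg
  have hsum : ∑' n, u n * s ^ n = ∑' n, (u n - A) * s ^ n + A * (1 - s)⁻¹ := by
    rw [← h.tsum_eq]
    exact tsum_congr fun n => by ring
  rw [hsum, div_eq_mul_inv, add_sub_cancel_right, powSum, ← tsum_mul_left]
  exact tsum_of_norm_bounded hb.hasSum hle

theorem abs_tsum_cast_mul_pow_sub_le {u : ℕ → ℝ} {A K α s : ℝ} (hα : -1 ≤ α)
    (hu : ∀ n : ℕ, |u n - A| ≤ K * ((n : ℝ) + 1) ^ (-(α + 1))) (h0 : 0 ≤ s) (h1 : s < 1) :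
    |∑' n : ℕ, n * u n * s ^ n - A * s / (1 - s) ^ 2| ≤ K * powSum α s := by
  have hs : ‖s‖ < 1 := by rwa [Real.norm_eq_abs, abs_of_nonneg h0]
  have hg := (hasSum_coe_mul_geometric_of_norm_lt_one hs).mul_left A
  have hb := (summable_rpow_mul_pow hα h0 h1).mul_left K
  have hle : ∀ n : ℕ, ‖n * (u n - A) * s ^ n‖ ≤ K * (((n : ℝ) + 1) ^ (-α) * s ^ n) := fun n => by
    have hn : ((n : ℝ) + 1) ^ (-α) = ((n : ℝ) + 1) * ((n : ℝ) + 1) ^ (-(α + 1)) := by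
      rw [mul_comm, ← Real.rpow_add_one (by positivity)]
      congr 1
      ring
    rw [Real.norm_eq_abs, abs_mul, abs_mul, Nat.abs_cast, abs_of_nonneg (pow_nonneg h0 n),
      ← mul_assoc, hn]
    refine mul_le_mul_of_nonneg_right ?_ (pow_nonneg h0 n)
    calc _ ≤ ((n : ℝ) + 1) * (K * ((n : ℝ) + 1) ^ (-(α + 1))) := by
          gcongr
          · linarith
          · exact hu n
      _ = _ := by ring
  have hd : Summable fun n : ℕ => n * (u n - A) * s ^ n := hb.of_norm_bounded hle
  have h := hd.hasSum.add hg
  have hsum : ∑' n : ℕ, n * u n * s ^ n =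
      ∑' n : ℕ, n * (u n - A) * s ^ n + A * (s / (1 - s) ^ 2) := by
    rw [← h.tsum_eq]
    exact tsum_congr fun n => by ring
  rw [hsum, mul_div_assoc, add_sub_cancel_right, powSum, ← tsum_mul_left]
  exact tsum_of_norm_bounded hb.hasSum hle

theorem exists_powSum_half_sub_le {d k : ℕ} (hd : 4 < d) (hk : k = 6 ∨ k = 8) :
    ∃ C : ℝ, 0 ≤ C ∧ ∀ s, 0 ≤ s → s < 1 →
      (d ≠ k → powSum ((d : ℝ) / 2 - (k / 2 - 1)) s ≤
        C * (1 - s) ^ (-(max ((k : ℝ) - d) 0) / 2)) ∧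
      (d = k → powSum ((d : ℝ) / 2 - (k / 2 - 1)) s ≤ C * (1 + |Real.log (1 - s)|)) := by
  by_cases hdk : d = k
  · refine ⟨1, zero_le_one, fun s h0 h1 => ⟨fun h => absurd hdk h, fun _ => ?_⟩⟩
    rw [one_mul, hdk, show (k : ℝ) / 2 - (k / 2 - 1) = 1 by ring]
    exact powSum_one_le h0 h1
  · have hα : (d : ℝ) / 2 - (k / 2 - 1) = -(1 / 2) ∨ (d : ℝ) / 2 - (k / 2 - 1) = 0 ∨
        (d : ℝ) / 2 - (k / 2 - 1) = 1 / 2 ∨ 1 < (d : ℝ) / 2 - (k / 2 - 1) := by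
      have h : d + 3 = k ∨ d + 2 = k ∨ d + 1 = k ∨ k + 1 ≤ d := by omega
      rcases h with h | h | h | h
      · have h' : (d : ℝ) + 3 = k := by exact_mod_cast h
        left; linarith
      · have h' : (d : ℝ) + 2 = k := by exact_mod_cast h
        right; left; linarith
      · have h' : (d : ℝ) + 1 = k := by exact_mod_cast h
        right; right; left; linarith
      · have h' : (k : ℝ) + 1 ≤ d := by exact_mod_cast h
        right; right; right; linarith
    obtain ⟨C, hC, hb⟩ := exists_powSum_le hα
    refine ⟨C, hC, fun s h0 h1 => ⟨fun _ => ?_, fun h => absurd h hdk⟩⟩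
    have he : -(max ((k : ℝ) - d) 0) / 2 = -max (1 - ((d : ℝ) / 2 - (k / 2 - 1))) 0 := by
      rw [neg_div, ← max_div_div_right (zero_le_two (α := ℝ)), zero_div]
      congr 2
      ring
    rw [he]
    exact hb s h0 h1

end WSAW


/-- near-critical asymptotics of `χ` and `zχ'` on `ℤ^d` for `d > 4`,
with `ε = 1 - z/z_c = 1 - zμ` and `A = lim c_n μ^{-n}`. -/
theorem statement13 (d : ℕ) (hd : 4 < d) :
    ∃ β0 C : ℝ, 0 < β0 ∧ 0 < C ∧
      ∀ β : ℝ, 0 < β → β ≤ β0 →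
        ∀ μ : ℝ, HasGrowthConst d β μ →
          ∃ A : ℝ, 0 < A ∧
            Filter.Tendsto (fun n : ℕ => cZ d β n / μ ^ n) Filter.atTop (nhds A) ∧
            ∀ z : ℝ, 0 ≤ z → z < μ⁻¹ →
              (d ≠ 6 →
                |chiR d β z - A / (1 - z * μ)| ≤
                  C * β * (1 - z * μ) ^ (-(max (6 - (d : ℝ)) 0) / 2)) ∧
              (d = 6 →
                |chiR d β z - A / (1 - z * μ)| ≤
                  C * β * (1 + |Real.log (1 - z * μ)|)) ∧
              (d ≠ 8 →
                |z * deriv (chiR d β) z - A * (z * μ) / (1 - z * μ) ^ 2| ≤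
                  C * β * (1 - z * μ) ^ (-(max (8 - (d : ℝ)) 0) / 2)) ∧
              (d = 8 →
                |z * deriv (chiR d β) z - A * (z * μ) / (1 - z * μ) ^ 2| ≤
                  C * β * (1 + |Real.log (1 - z * μ)|)) := by
  obtain ⟨β₀, C₀, hβ₀, hC₀, hmain⟩ := WSAW.exists_abs_cZ_div_pow_sub_le hd
  obtain ⟨C₁, hC₁, hb₁⟩ := WSAW.exists_powSum_half_sub_le (k := 6) hd (.inl rfl)
  obtain ⟨C₂, hC₂, hb₂⟩ := WSAW.exists_powSum_half_sub_le (k := 8) hd (.inr rfl)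
  refine ⟨β₀, C₀ * (C₁ + C₂ + 1), hβ₀, by positivity, fun β hβ hββ₀ μ hμ => ?_⟩
  obtain ⟨hμ0, A, hA, htend, hbd⟩ := hmain β hβ hββ₀ μ hμ
  refine ⟨A, hA, htend, fun z hz0 hz => ?_⟩
  have hd' : (5 : ℝ) ≤ d := by exact_mod_cast hd
  have hs0 : 0 ≤ z * μ := by positivity
  have hs1 : z * μ < 1 := by
    rwa [← lt_div_iff₀ hμ0, one_div]
  have hε : 0 < 1 - z * μ := by linarith
  have hterm : ∀ n : ℕ, cZ d β n * z ^ n = cZ d β n / μ ^ n * (z * μ) ^ n := fun n => by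
    rw [mul_pow]
    field_simp
  have hbdd : ∀ n : ℕ, |cZ d β n| * μ⁻¹ ^ n ≤ A + C₀ * β := fun n => by
    have h1 : ((n : ℝ) + 1) ^ (-((d : ℝ) / 2 - 2)) ≤ 1 :=
      Real.rpow_le_one_of_one_le_of_nonpos (by linarith [n.cast_nonneg (α := ℝ)]) (by linarith)
    have h2 : C₀ * β * ((n : ℝ) + 1) ^ (-((d : ℝ) / 2 - 2)) ≤ C₀ * β :=
      mul_le_of_le_one_right (by positivity) h1
    have h3 : |cZ d β n| * μ⁻¹ ^ n = |cZ d β n / μ ^ n| := by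
      rw [abs_div, abs_of_pos (pow_pos hμ0 n), inv_pow, div_eq_mul_inv]
    have h4 := abs_sub_abs_le_abs_sub (cZ d β n / μ ^ n) A
    rw [abs_of_pos hA] at h4
    linarith [hbd n]
  have hderiv : z * deriv (chiR d β) z =
      ∑' n : ℕ, n * (cZ d β n / μ ^ n) * (z * μ) ^ n := by
    have h := WSAW.hasDerivAt_tsum_mul_pow (inv_pos.2 hμ0) hbdd (by rwa [abs_of_nonneg hz0])
    have h' : deriv (chiR d β) z = _ := h.deriv
    rw [h', ← tsum_mul_left]
    refine tsum_congr fun n => ?_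
    rw [mul_assoc, ← hterm]
    rcases n with _ | n
    · simp
    · rw [Nat.add_sub_cancel]
      ring
  have hχ : |chiR d β z - A / (1 - z * μ)| ≤
      C₀ * β * WSAW.powSum ((d : ℝ) / 2 - ((6 : ℕ) / 2 - 1)) (z * μ) := by
    have h : chiR d β z = ∑' n : ℕ, cZ d β n / μ ^ n * (z * μ) ^ n := tsum_congr hterm
    rw [h]
    refine WSAW.abs_tsum_mul_pow_sub_le (by push_cast; linarith) (fun n => ?_) hs0 hs1
    convert hbd n using 4
    norm_num
  have hχ' : |z * deriv (chiR d β) z - A * (z * μ) / (1 - z * μ) ^ 2| ≤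
      C₀ * β * WSAW.powSum ((d : ℝ) / 2 - ((8 : ℕ) / 2 - 1)) (z * μ) := by
    rw [hderiv]
    refine WSAW.abs_tsum_cast_mul_pow_sub_le (by push_cast; linarith) (fun n => ?_) hs0 hs1
    convert hbd n using 3
    push_cast
    ring
  have hC₁' : C₁ ≤ C₁ + C₂ + 1 := by linarith
  have hC₂' : C₂ ≤ C₁ + C₂ + 1 := by linarith
  have hcombine : ∀ {x p D y : ℝ}, x ≤ C₀ * β * p → p ≤ D * y → D ≤ C₁ + C₂ + 1 → 0 ≤ y →
      x ≤ C₀ * (C₁ + C₂ + 1) * β * y := fun {x p D y} hx hp hD hy => by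
    calc x ≤ C₀ * β * p := hx
      _ ≤ C₀ * β * ((C₁ + C₂ + 1) * y) := by
        gcongr
        exact hp.trans (by gcongr)
      _ = _ := by ring
  have hb₁ := hb₁ _ hs0 hs1
  have hb₂ := hb₂ _ hs0 hs1
  exact ⟨fun h => hcombine hχ (hb₁.1 h) hC₁' (by positivity),
    fun h => hcombine hχ (hb₁.2 h) hC₁' (by positivity),
    fun h => hcombine hχ' (hb₂.1 h) hC₂' (by positivity),
    fun h => hcombine hχ' (hb₂.2 h) hC₂' (by positivity)⟩
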